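/- arXiv:2409.04129 — 2 statements merged into one kernel-verified Lean document; each statement's English description precedes it below -/
import Mathlib

section
/- Let n ≥ 1 and let f₀ : ℝ²ⁿ → [0,∞) be measurable. Let (f^m)_{m∈ℕ} be a family of measurable nonnegative functions on [0,∞)×ℝⁿ×ℝⁿ and (G^m)_{m∈ℕ} measurable functions with G^m ∈ L^∞([0,∞);L¹(ℝ²ⁿ)), such that each f^m is a weak solution of ∂_t f^m + v·∇ₓ f^m = G^m with f^m(0,·,·) = f₀, in the sense that for every φ ∈ C_c^∞(ℝ²ⁿ) and every t ≥ 0, ∬ f^m(t,x,v) φ(x,v) dx dv = ∬ f₀ φ dx dv + ∫₀^t ∬ f^m (v·∇ₓφ) dx dv ds + ∫₀^t ∬ G^m φ dx dv ds. Assume that ∫_{ℝⁿ} G^m(t,x,v) dv ≤ 0 for a.e. (t,x), and that ℰ := sup_m sup_{t≥0} ∬_{ℝ²ⁿ} (1+|v|²) f^m(t,x,v) dx dv < ∞. Let σ ∈ [0,2) and let ψ ∈ C⁰(ℝⁿ) satisfy |ψ(v)| ≤ (1+|v|²)^{σ/2} for all v. Then for every T > 0 and R > 0, sup_m sup_{t∈[0,T]}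 ∫_{|x|≥2R} | ∫_{ℝⁿ} f^m(t,x,v) ψ(v) dv | dx ≤ ℰ^{σ/2} ( ∫_{|x|≥R} ∫_{ℝⁿ} f₀(x,v) dv dx + 2ℰT/R )^{1−σ/2}. -/
open MeasureTheory Real

noncomputable section

abbrev En (n : ℕ) := EuclideanSpace ℝ (Fin n)

open scoped ContDiff

theorem exists_smooth_step : ∃ h : ℝ → ℝ, ContDiff ℝ ∞ h ∧ (∀ s, 0 ≤ h s) ∧ (∀ s, h s ≤ 1) ∧
    (∀ s ≤ 1, h s = 0) ∧ (∀ s, 2 ≤ s → h s = 1) ∧ LipschitzWith 2 h := by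
  let b : ContDiffBump (3 / 2 : ℝ) := ⟨1 / 4, 1 / 2, by norm_num, by norm_num⟩
  let β : ℝ → ℝ := b.normed volume
  have hβc : Continuous β := b.continuous_normed
  have hβ0 : ∀ s, 0 ≤ β s := fun s => b.nonneg_normed s
  have hβ2 : ∀ s, β s ≤ 2 := by
    intro s
    refine (b.normed_le_div_measure_closedBall_rIn volume s).trans ?_
    simp [b, Measure.real, Real.volume_closedBall]
    norm_num
  have hsupp : ∀ s, s ∉ Set.Ioo (1 : ℝ) 2 → β s = 0 := by
    intro s hs
    by_contra hne
    have : s ∈ Function.support β := hne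
    rw [b.support_normed_eq, Real.ball_eq_Ioo] at this
    norm_num [b] at this
    exact hs this
  have hint : ∀ a c, IntervalIntegrable β volume a c := fun a c => hβc.intervalIntegrable a c
  let h : ℝ → ℝ := fun s => ∫ x in (1 : ℝ)..s, β x
  have hd : ∀ s, HasDerivAt h (β s) s := fun s =>
    intervalIntegral.integral_hasDerivAt_right (hint _ _)
      (hβc.stronglyMeasurableAtFilter _ _) hβc.continuousAt
  have hderiv : deriv h = β := funext fun s => (hd s).deriv
  have hmono : Monotone h := monotone_of_deriv_nonneg (fun s => (hd s).differentiableAt)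
    (fun s => by rw [hderiv]; exact hβ0 s)
  have h0 : ∀ s ≤ 1, h s = 0 := by
    intro s hs
    refine intervalIntegral.integral_zero_ae (Filter.Eventually.of_forall fun x hx => ?_)
    rw [Set.uIoc_of_ge hs] at hx
    exact hsupp x fun hx' => by linarith [hx.2, hx'.1]
  have h1 : ∀ s, 2 ≤ s → h s = 1 := by
    intro s hs
    change ∫ x in (1 : ℝ)..s, β x = 1
    rw [intervalIntegral.integral_of_le (by linarith),
      setIntegral_eq_integral_of_forall_compl_eq_zero]
    · exact b.integral_normed
    · intro x hx
      exact hsupp x fun hx' => hx ⟨hx'.1, by linarith [hx'.2]⟩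
  refine ⟨h, ?_, ?_, ?_, h0, h1, ?_⟩
  · rw [contDiff_infty_iff_deriv, hderiv]
    exact ⟨fun s => (hd s).differentiableAt, b.contDiff_normed⟩
  · intro s
    rw [← h0 (min s 1) (min_le_right _ _)]
    exact hmono (min_le_left _ _)
  · intro s
    rw [← h1 (max s 2) (le_max_right _ _)]
    exact hmono (le_max_left _ _)
  · refine lipschitzWith_of_nnnorm_deriv_le (fun s => (hd s).differentiableAt) fun s => ?_
    rw [hderiv, ← NNReal.coe_le_coe, coe_nnnorm, Real.norm_of_nonneg (hβ0 s)]
    exact hβ2 s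

theorem exists_radial_cutoff {F : Type*} [NormedAddCommGroup F] [InnerProductSpace ℝ F]
    {R : ℝ} (hR : 0 < R) : ∃ χ : F → ℝ, ContDiff ℝ ∞ χ ∧ (∀ x, 0 ≤ χ x) ∧ (∀ x, χ x ≤ 1) ∧
    (∀ x, ‖x‖ ≤ R → χ x = 0) ∧ (∀ x, 2 * R ≤ ‖x‖ → χ x = 1) ∧
    ∀ x v, |fderiv ℝ χ x v| ≤ 2 / R * ‖v‖ := by
  obtain ⟨h, hs, hnn, hle, h0, h1, hL⟩ := exists_smooth_step
  have hz : ∀ x : F, ‖x‖ ≤ R → h (‖x‖ / R) = 0 := fun x hx => h0 _ ((div_le_one hR).2 hx)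
  refine ⟨fun x => h (‖x‖ / R), ?_, fun x => hnn _, fun x => hle _, hz,
    fun x hx => h1 _ ((le_div_iff₀ hR).2 hx), ?_⟩
  · rw [contDiff_iff_contDiffAt]
    intro x
    by_cases hx : x = 0
    · refine (contDiffAt_const (c := (0 : ℝ))).congr_of_eventuallyEq ?_
      filter_upwards [Metric.ball_mem_nhds x hR] with y hy
      refine hz y ?_
      simpa [hx] using (Metric.mem_ball.1 hy).le
    · exact (hs.contDiffAt (x := ‖x‖ / R)).comp x ((contDiffAt_norm ℝ hx).div_const R)
  · intro x v
    have hLip : LipschitzWith (2 * R⁻¹.toNNReal) fun x : F => h (‖x‖ / R) := by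
      refine hL.comp (LipschitzWith.of_dist_le_mul fun a b => ?_)
      rw [Real.dist_eq, ← sub_div, abs_div, abs_of_pos hR, dist_eq_norm,
        Real.coe_toNNReal _ (inv_nonneg.2 hR.le), div_eq_inv_mul]
      gcongr
      exact abs_norm_sub_norm_le a b
    rw [← Real.norm_eq_abs]
    refine (ContinuousLinearMap.le_opNorm _ v).trans ?_
    gcongr
    refine (norm_fderiv_le_of_lipschitz ℝ hLip).trans ?_
    simp [hR.le, div_eq_mul_inv]

open Filter Topology in
theorem integral_mul_cutoff_le {n : ℕ} {f G : ℝ → En n × En n → ℝ}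
    (hfnonneg : ∀ t p, 0 ≤ f t p)
    (hGmeas : Measurable (Function.uncurry G))
    (hGL1 : ∃ B : ℝ, ∀ t : ℝ, 0 ≤ t → Integrable (G t) ∧ (∫ p : En n × En n, |G t p|) ≤ B)
    (hweak : ∀ φ : En n × En n → ℝ, ContDiff ℝ ∞ φ → HasCompactSupport φ →
      ∀ t : ℝ, 0 ≤ t →
        (∫ p : En n × En n, f t p * φ p) =
          (∫ p : En n × En n, f 0 p * φ p) +
          (∫ s in (0:ℝ)..t, ∫ p : En n × En n, f s p * fderiv ℝ φ p (p.2, 0)) +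
          (∫ s in (0:ℝ)..t, ∫ p : En n × En n, G s p * φ p))
    (hGsign : ∀ᵐ q : ℝ × En n, 0 ≤ q.1 → (∫ v : En n, G q.1 (q.2, v)) ≤ 0)
    {E : ℝ}
    (hE : ∀ t : ℝ, 0 ≤ t →
      Integrable (fun p : En n × En n => (1 + ‖p.2‖ ^ 2) * f t p) ∧
      (∫ p : En n × En n, (1 + ‖p.2‖ ^ 2) * f t p) ≤ E)
    (hfi : ∀ t : ℝ, 0 ≤ t → Integrable (f t))
    {R : ℝ} (hR : 0 < R) {χ : En n → ℝ} (hχs : ContDiff ℝ ∞ χ) (hχ0 : ∀ x, 0 ≤ χ x)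
    (hχ1 : ∀ x, χ x ≤ 1) (hχd : ∀ x v, |fderiv ℝ χ x v| ≤ 2 / R * ‖v‖)
    {t : ℝ} (ht : 0 ≤ t) :
    (∫ p, f t p * χ p.1) ≤ (∫ p, f 0 p * χ p.1) + 2 * E * t / R := by
  obtain ⟨B, hB⟩ := hGL1
  have hE0 : 0 ≤ E := le_trans (integral_nonneg fun p => mul_nonneg (by positivity)
    (hfnonneg 0 p)) (hE 0 le_rfl).2
  choose θ hθs hθ0 hθ1 hθz hθo hθd using fun k : ℕ =>
    exists_radial_cutoff (F := En n) (R := (k : ℝ) + 1) (by positivity)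
  let φ : ℕ → En n × En n → ℝ := fun k p => χ p.1 * (1 - θ k p.1) * (1 - θ k p.2)
  have hφs : ∀ k, ContDiff ℝ ∞ (φ k) := fun k =>
    ((hχs.comp contDiff_fst).mul (contDiff_const.sub ((hθs k).comp contDiff_fst))).mul
      (contDiff_const.sub ((hθs k).comp contDiff_snd))
  have hφ0 : ∀ k p, 0 ≤ φ k p := fun k p =>
    mul_nonneg (mul_nonneg (hχ0 _) (sub_nonneg.2 (hθ1 _ _))) (sub_nonneg.2 (hθ1 _ _))
  have hφ1 : ∀ k p, φ k p ≤ 1 := fun k p =>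
    mul_le_one₀ (mul_le_one₀ (hχ1 _) (sub_nonneg.2 (hθ1 _ _)) (by linarith [hθ0 k p.1]))
      (sub_nonneg.2 (hθ1 _ _)) (by linarith [hθ0 k p.2])
  have hφabs : ∀ k p, |φ k p| ≤ 1 := fun k p => by
    rw [abs_of_nonneg (hφ0 k p)]; exact hφ1 k p
  have hφc : ∀ k, HasCompactSupport (φ k) := by
    intro k
    refine HasCompactSupport.intro (isCompact_closedBall 0 (2 * ((k : ℝ) + 1))) fun p hp => ?_
    rw [mem_closedBall_zero_iff, not_le, Prod.norm_def, lt_max_iff] at hp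
    rcases hp with hp | hp
    · simp [φ, hθo k _ hp.le]
    · simp [φ, hθo k _ hp.le]
  have hφlim : ∀ p, Tendsto (fun k => φ k p) atTop (𝓝 (χ p.1)) := by
    intro p
    refine tendsto_const_nhds.congr' ?_
    filter_upwards [eventually_ge_atTop ⌈‖p‖⌉₊] with k hk
    have hk' : ‖p‖ ≤ k + 1 := by linarith [(Nat.le_ceil ‖p‖).trans (Nat.cast_le.2 hk)]
    simp [φ, hθz k p.1 ((norm_fst_le p).trans hk'), hθz k p.2 ((norm_snd_le p).trans hk')]
  have hφd : ∀ k p, |fderiv ℝ (φ k) p (p.2, 0)| ≤ (2 / R + 2 / ((k : ℝ) + 1)) * ‖p.2‖ := by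
    intro k p
    have d1 : HasFDerivAt (fun q : En n × En n => χ q.1)
        ((fderiv ℝ χ p.1).comp (ContinuousLinearMap.fst ℝ _ _)) p :=
      ((hχs.differentiable (by simp)) p.1).hasFDerivAt.comp p hasFDerivAt_fst
    have d2 : HasFDerivAt (fun q : En n × En n => θ k q.1)
        ((fderiv ℝ (θ k) p.1).comp (ContinuousLinearMap.fst ℝ _ _)) p :=
      (((hθs k).differentiable (by simp)) p.1).hasFDerivAt.comp p hasFDerivAt_fst
    have d3 : HasFDerivAt (fun q : En n × En n => θ k q.2)
        ((fderiv ℝ (θ k) p.2).comp (ContinuousLinearMap.snd ℝ _ _)) p :=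
      (((hθs k).differentiable (by simp)) p.2).hasFDerivAt.comp p hasFDerivAt_snd
    have d := (d1.mul (d2.const_sub 1)).mul (d3.const_sub 1)
    have key : fderiv ℝ (φ k) p (p.2, 0) = (1 - θ k p.2) *
        ((1 - θ k p.1) * fderiv ℝ χ p.1 p.2 - χ p.1 * fderiv ℝ (θ k) p.1 p.2) := by
      have : fderiv ℝ (φ k) p = _ := d.fderiv
      rw [this]
      simp
      ring
    have b1 : |1 - θ k p.1| ≤ 1 := abs_le.2 ⟨by linarith [hθ1 k p.1], by linarith [hθ0 k p.1]⟩
    have b2 : |1 - θ k p.2| ≤ 1 := abs_le.2 ⟨by linarith [hθ1 k p.2], by linarith [hθ0 k p.2]⟩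
    have b3 : |χ p.1| ≤ 1 := abs_le.2 ⟨by linarith [hχ0 p.1], hχ1 p.1⟩
    rw [key, abs_mul]
    calc _ ≤ 1 * |(1 - θ k p.1) * fderiv ℝ χ p.1 p.2 - χ p.1 * fderiv ℝ (θ k) p.1 p.2| := by
          gcongr
      _ ≤ |1 - θ k p.1| * |fderiv ℝ χ p.1 p.2| + |χ p.1| * |fderiv ℝ (θ k) p.1 p.2| := by
          rw [one_mul, ← abs_mul, ← abs_mul]
          exact abs_sub _ _
      _ ≤ 1 * (2 / R * ‖p.2‖) + 1 * (2 / ((k : ℝ) + 1) * ‖p.2‖) := by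
          gcongr
          · exact hχd _ _
          · exact hθd k _ _
      _ = _ := by ring
  have hlim : ∀ F : En n × En n → ℝ, Integrable F →
      Tendsto (fun k => ∫ p, F p * φ k p) atTop (𝓝 (∫ p, F p * χ p.1)) := by
    intro F hF
    refine tendsto_integral_of_dominated_convergence (fun p => ‖F p‖)
      (fun k => hF.1.mul (hφs k).continuous.aestronglyMeasurable) hF.norm
      (fun k => Eventually.of_forall fun p => ?_)
      (Eventually.of_forall fun p => (hφlim p).const_mul _)
    rw [norm_mul]
    exact mul_le_of_le_one_right (norm_nonneg _) (hφabs k p)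
  have hGlim : Tendsto (fun k => ∫ s in (0:ℝ)..t, ∫ p, G s p * φ k p) atTop
      (𝓝 (∫ s in (0:ℝ)..t, ∫ p, G s p * χ p.1)) := by
    refine intervalIntegral.tendsto_integral_filter_of_dominated_convergence (fun _ => B)
      (Eventually.of_forall fun k => ?_)
      (Eventually.of_forall fun k => Eventually.of_forall fun s hs => ?_)
      intervalIntegrable_const
      (Eventually.of_forall fun s hs => ?_)
    · have : Measurable fun z : ℝ × (En n × En n) => G z.1 z.2 * φ k z.2 :=
        hGmeas.mul ((hφs k).continuous.measurable.comp measurable_snd)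
      exact (this.stronglyMeasurable.integral_prod_right).aestronglyMeasurable
    · rw [Set.uIoc_of_le ht] at hs
      obtain ⟨hi, hb⟩ := hB s hs.1.le
      refine (norm_integral_le_of_norm_le hi.abs (Eventually.of_forall fun p => ?_)).trans hb
      rw [norm_mul]
      exact mul_le_of_le_one_right (norm_nonneg _) (hφabs k p)
    · rw [Set.uIoc_of_le ht] at hs
      exact hlim _ (hB s hs.1.le).1
  have hGneg : ∫ s in (0:ℝ)..t, ∫ p, G s p * χ p.1 ≤ 0 := by
    rw [intervalIntegral.integral_of_le ht]
    refine integral_nonpos_of_ae ?_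
    filter_upwards [ae_restrict_of_ae (Measure.ae_ae_of_ae_prod hGsign),
      ae_restrict_mem measurableSet_Ioc] with s hs hs'
    have hi : Integrable (fun p : En n × En n => G s p * χ p.1) :=
      (hB s hs'.1.le).1.mul_bdd (c := 1)
        (hχs.continuous.comp continuous_fst).aestronglyMeasurable
        (Eventually.of_forall fun p => abs_le.2 ⟨by linarith [hχ0 p.1], hχ1 p.1⟩)
    change ∫ p, G s p * χ p.1 ≤ 0
    rw [Measure.volume_eq_prod, integral_prod _ hi]
    refine integral_nonpos_of_ae ?_
    filter_upwards [hs] with x hx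
    rw [integral_mul_const (χ x)]
    exact mul_nonpos_of_nonpos_of_nonneg (hx hs'.1.le) (hχ0 x)
  have hflux : ∀ k, (∫ s in (0:ℝ)..t, ∫ p, f s p * fderiv ℝ (φ k) p (p.2, 0)) ≤
      (2 / R + 2 / ((k : ℝ) + 1)) * E * t := by
    intro k
    refine (le_abs_self _).trans ?_
    have : t = |t - 0| := by rw [sub_zero, abs_of_nonneg ht]
    conv_rhs => rw [this]
    rw [← Real.norm_eq_abs]
    refine intervalIntegral.norm_integral_le_of_norm_le_const fun s hs => ?_
    rw [Set.uIoc_of_le ht] at hs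
    obtain ⟨hi, hb⟩ := hE s hs.1.le
    refine (norm_integral_le_of_norm_le (hi.const_mul (2 / R + 2 / ((k : ℝ) + 1)))
      (Eventually.of_forall fun p => ?_)).trans ?_
    · have h2 : ‖p.2‖ ≤ 1 + ‖p.2‖ ^ 2 := by nlinarith [sq_nonneg (‖p.2‖ - 1)]
      have hc : 0 ≤ 2 / R + 2 / ((k : ℝ) + 1) := by positivity
      rw [norm_mul, Real.norm_of_nonneg (hfnonneg s p), Real.norm_eq_abs]
      calc f s p * |fderiv ℝ (φ k) p (p.2, 0)|
          ≤ f s p * ((2 / R + 2 / ((k : ℝ) + 1)) * (1 + ‖p.2‖ ^ 2)) :=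
            mul_le_mul_of_nonneg_left ((hφd k p).trans (mul_le_mul_of_nonneg_left h2 hc))
              (hfnonneg s p)
        _ = _ := by ring
    · rw [integral_const_mul]
      gcongr
  have hrate : Tendsto (fun k : ℕ => (2 / R + 2 / ((k : ℝ) + 1)) * E * t) atTop
      (𝓝 ((2 / R + 0) * E * t)) := by
    refine ((tendsto_const_nhds.add ?_).mul_const E).mul_const t
    simpa [div_eq_mul_inv] using (tendsto_one_div_add_atTop_nhds_zero_nat (𝕜 := ℝ)).const_mul 2
  have := le_of_tendsto_of_tendsto' (hlim _ (hfi t ht))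
    (((hlim _ (hfi 0 le_rfl)).add hrate).add hGlim) fun k => by
      rw [hweak (φ k) (hφs k) (hφc k) t ht]
      gcongr
      exact hflux k
  calc _ ≤ _ := this
    _ ≤ (∫ p, f 0 p * χ p.1) + (2 / R + 0) * E * t := by linarith
    _ = _ := by ring

open Filter Topology in
/-- A function with the same pairings as `g` against all test functions, the pairings being `0`
wherever they diverge, is a.e. equal to `g`, unless it is not locally integrable, and then `g`
vanishes a.e. -/
theorem ae_eq_or_ae_eq_zero_of_integral_mul_eq {F : Type*} [NormedAddCommGroup F]
    [NormedSpace ℝ F] [FiniteDimensional ℝ F] [MeasurableSpace F] [BorelSpace F]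
    {μ : Measure F} {f₀ g : F → ℝ} (hg0 : ∀ p, 0 ≤ g p)
    (hg : Integrable g μ)
    (h : ∀ φ : F → ℝ, ContDiff ℝ ∞ φ → HasCompactSupport φ →
      ∫ p, g p * φ p ∂μ = ∫ p, f₀ p * φ p ∂μ) :
    g =ᵐ[μ] f₀ ∨ g =ᵐ[μ] 0 := by
  by_cases hloc : LocallyIntegrable f₀ μ
  · left
    refine ae_eq_of_integral_contDiff_smul_eq hg.locallyIntegrable hloc fun φ hφ hφc => ?_
    simpa only [smul_eq_mul, mul_comm] using h φ hφ hφc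
  · right
    obtain ⟨a, ha⟩ : ∃ a, ¬ IntegrableAtFilter f₀ (𝓝 a) μ := by
      simpa [LocallyIntegrable] using hloc
    have hball : ∀ k : ℕ, ∀ᵐ p ∂μ, p ∈ Metric.ball a ((k : ℝ) + 1) → g p = 0 := by
      intro k
      let b : ContDiffBump a := ⟨(k : ℝ) + 1, (k : ℝ) + 2, by positivity, by linarith⟩
      have hb1 : ∀ p ∈ Metric.ball a ((k : ℝ) + 1), b p = 1 := fun p hp =>
        b.one_of_mem_closedBall (Metric.ball_subset_closedBall hp)
      have hni : ¬ Integrable (fun p => f₀ p * b p) μ := by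
        intro hi
        refine ha ⟨Metric.ball a ((k : ℝ) + 1), Metric.ball_mem_nhds _ (by positivity), ?_⟩
        refine hi.integrableOn.congr_fun (fun p hp => ?_) measurableSet_ball
        simp [hb1 p hp]
      have hz := h b b.contDiff b.hasCompactSupport
      rw [integral_undef hni, integral_eq_zero_iff_of_nonneg
        (fun p => mul_nonneg (hg0 p) b.nonneg)] at hz
      · filter_upwards [hz] with p hp hpb
        simpa [hb1 p hpb] using hp
      · exact hg.mul_bdd (c := 1) b.continuous.aestronglyMeasurable
          (Eventually.of_forall fun p => by
            rw [Real.norm_of_nonneg b.nonneg]; exact b.le_one)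
    filter_upwards [ae_all_iff.2 hball] with p hp
    refine hp ⌈dist p a⌉₊ ?_
    rw [Metric.mem_ball]
    linarith [Nat.le_ceil (dist p a)]

theorem integral_mul_rpow_le {α : Type*} [MeasurableSpace α] {μ : Measure α} {w g : α → ℝ}
    (hw : ∀ a, 0 ≤ w a) (hg : ∀ a, 0 ≤ g a) (hwg : Integrable (fun a => w a * g a) μ)
    (hgi : Integrable g μ) {s : ℝ} (hs0 : 0 ≤ s) (hs1 : s < 1) :
    ∫ a, w a ^ s * g a ∂μ ≤ (∫ a, w a * g a ∂μ) ^ s * (∫ a, g a ∂μ) ^ (1 - s) := by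
  have key := ENNReal.lintegral_mul_norm_pow_le (μ := μ)
    hwg.aemeasurable.ennreal_ofReal hgi.aemeasurable.ennreal_ofReal hs0
    (sub_nonneg.2 hs1.le) (by ring)
  have hwg0 : ∀ a, 0 ≤ w a * g a := fun a => mul_nonneg (hw a) (hg a)
  have hpt : ∀ a, ENNReal.ofReal (w a * g a) ^ s * ENNReal.ofReal (g a) ^ (1 - s) =
      ENNReal.ofReal (w a ^ s * g a) := by
    intro a
    rw [ENNReal.ofReal_rpow_of_nonneg (hwg0 a) hs0,
      ENNReal.ofReal_rpow_of_nonneg (hg a) (sub_nonneg.2 hs1.le),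
      ← ENNReal.ofReal_mul (rpow_nonneg (hwg0 a) _), mul_rpow (hw a) (hg a), mul_assoc,
      ← rpow_add_of_nonneg (hg a) hs0 (sub_nonneg.2 hs1.le)]
    simp
  have hI0 : 0 ≤ ∫ a, w a * g a ∂μ := integral_nonneg hwg0
  have hJ0 : 0 ≤ ∫ a, g a ∂μ := integral_nonneg hg
  simp only [hpt] at key
  rw [← ofReal_integral_eq_lintegral_ofReal hwg (Filter.Eventually.of_forall hwg0),
    ← ofReal_integral_eq_lintegral_ofReal hgi (Filter.Eventually.of_forall hg),
    ENNReal.ofReal_rpow_of_nonneg hI0 hs0,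
    ENNReal.ofReal_rpow_of_nonneg hJ0 (sub_nonneg.2 hs1.le),
    ← ENNReal.ofReal_mul (rpow_nonneg hI0 _)] at key
  have hR0 := mul_nonneg (rpow_nonneg hI0 s) (rpow_nonneg hJ0 (1 - s))
  by_cases hm : Integrable (fun a => w a ^ s * g a) μ
  · rw [← ofReal_integral_eq_lintegral_ofReal hm (Filter.Eventually.of_forall fun a =>
      mul_nonneg (rpow_nonneg (hw a) _) (hg a))] at key
    exact (ENNReal.ofReal_le_ofReal_iff hR0).1 key
  · rw [integral_undef hm]
    exact hR0

/-- Lemma 3.5 (tightness lemma): for weak solutions `f^m` of the transport equation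
`∂_t f^m + v·∇ₓ f^m = G^m` with `∫ G^m dv ≤ 0` and uniformly bounded second moments `ℰ`,
the velocity averages against `ψ` with `|ψ(v)| ≤ (1+|v|²)^{σ/2}`, `σ ∈ [0,2)`, satisfy
a uniform far-field bound. -/
theorem stmt7 (n : ℕ) (hn : 1 ≤ n)
    (f₀ : En n × En n → ℝ) (hf₀meas : Measurable f₀) (hf₀nonneg : ∀ p, 0 ≤ f₀ p)
    (f G : ℕ → ℝ → En n × En n → ℝ)
    (hfmeas : ∀ m, Measurable (Function.uncurry (f m)))
    (hfnonneg : ∀ m t p, 0 ≤ f m t p)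
    (hGmeas : ∀ m, Measurable (Function.uncurry (G m)))
    -- G^m ∈ L^∞([0,∞); L¹(ℝ²ⁿ))
    (hGL1 : ∀ m, ∃ B : ℝ, ∀ t : ℝ, 0 ≤ t →
      Integrable (G m t) ∧ (∫ p : En n × En n, |G m t p|) ≤ B)
    -- weak solution with initial data f₀
    (hweak : ∀ m, ∀ φ : En n × En n → ℝ, ContDiff ℝ (⊤ : ℕ∞) φ → HasCompactSupport φ →
      ∀ t : ℝ, 0 ≤ t →
        (∫ p : En n × En n, f m t p * φ p) =
          (∫ p : En n × En n, f₀ p * φ p) +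
          (∫ s in (0:ℝ)..t, ∫ p : En n × En n, f m s p * fderiv ℝ φ p (p.2, 0)) +
          (∫ s in (0:ℝ)..t, ∫ p : En n × En n, G m s p * φ p))
    -- sign condition ∫ G^m dv ≤ 0 a.e.
    (hGsign : ∀ m, ∀ᵐ q : ℝ × En n, 0 ≤ q.1 → (∫ v : En n, G m q.1 (q.2, v)) ≤ 0)
    (E : ℝ)
    (hE : ∀ m, ∀ t : ℝ, 0 ≤ t →
      Integrable (fun p : En n × En n => (1 + ‖p.2‖ ^ 2) * f m t p) ∧
      (∫ p : En n × En n, (1 + ‖p.2‖ ^ 2) * f m t p) ≤ E)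
    (σ : ℝ) (hσ : σ ∈ Set.Ico (0:ℝ) 2)
    (ψ : En n → ℝ) (hψc : Continuous ψ)
    (hψb : ∀ v : En n, |ψ v| ≤ (1 + ‖v‖ ^ 2) ^ (σ / 2)) :
    ∀ T R : ℝ, 0 < T → 0 < R → ∀ m, ∀ t ∈ Set.Icc (0:ℝ) T,
      (∫ x in {x : En n | 2 * R ≤ ‖x‖}, |∫ v : En n, f m t (x, v) * ψ v|) ≤
        E ^ (σ / 2) *
          ((∫ x in {x : En n | R ≤ ‖x‖}, ∫ v : En n, f₀ (x, v)) + 2 * E * T / R) ^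
            (1 - σ / 2) := by
  intro T R hT hR m t ht
  have hf0 := hfnonneg m
  have hw1 : ∀ v : En n, 1 ≤ 1 + ‖v‖ ^ 2 := fun v => by linarith [sq_nonneg ‖v‖]
  have hsm : ∀ s : ℝ, Measurable (f m s) := fun s => (hfmeas m).comp measurable_prodMk_left
  have hfi : ∀ s : ℝ, 0 ≤ s → Integrable (f m s) := fun s hs =>
    (hE m s hs).1.mono' (hsm s).aestronglyMeasurable (Filter.Eventually.of_forall fun p => by
      rw [Real.norm_of_nonneg (hf0 s p)]
      exact le_mul_of_one_le_left (hf0 s p) (hw1 p.2))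
  have hE0 : 0 ≤ E := le_trans (integral_nonneg fun p => mul_nonneg (by positivity)
    (hf0 0 p)) (hE m 0 le_rfl).2
  have hs0 : 0 ≤ σ / 2 := by linarith [hσ.1]
  have hs1 : σ / 2 < 1 := by linarith [hσ.2]
  have hS : ∀ r : ℝ, MeasurableSet {x : En n | r ≤ ‖x‖} := fun r =>
    measurableSet_le measurable_const measurable_norm
  have hprod : ∀ (r : ℝ) (F : En n × En n → ℝ), Integrable F →
      ∫ x in {x : En n | r ≤ ‖x‖}, ∫ v, F (x, v) =
        ∫ p in {x : En n | r ≤ ‖x‖} ×ˢ Set.univ, F p := by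
    intro r F hF
    rw [Measure.volume_eq_prod, setIntegral_prod _ hF.integrableOn, Measure.restrict_univ]
  have hinit : ∫ x in {x : En n | R ≤ ‖x‖}, ∫ v : En n, f m 0 (x, v) ≤
      ∫ x in {x : En n | R ≤ ‖x‖}, ∫ v : En n, f₀ (x, v) := by
    rcases ae_eq_or_ae_eq_zero_of_integral_mul_eq (f₀ := f₀) (hf0 0) (hfi 0 le_rfl)
      (fun φ hφ hφc => by simpa using hweak m φ hφ hφc 0 le_rfl) with h | h
    · refine (integral_congr_ae (ae_restrict_of_ae ?_)).le
      filter_upwards [Measure.ae_ae_of_ae_prod h] with x hx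
      exact integral_congr_ae hx
    · rw [integral_eq_zero_of_ae]
      · exact integral_nonneg fun x => integral_nonneg fun v => hf₀nonneg _
      · refine ae_restrict_of_ae ?_
        filter_upwards [Measure.ae_ae_of_ae_prod h] with x hx
        exact integral_eq_zero_of_ae hx
  have htest : ∀ φ : En n × En n → ℝ, ContDiff ℝ (⊤ : ℕ∞) φ → HasCompactSupport φ →
      ∫ p, f₀ p * φ p = ∫ p, f m 0 p * φ p := fun φ hφ hφc => by
    simpa using (hweak m φ hφ hφc 0 le_rfl).symm
  obtain ⟨χ, hχs, hχ0, hχ1, hχz, hχo, hχd⟩ := exists_radial_cutoff (F := En n) hR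
  have hχint : ∀ s : ℝ, 0 ≤ s → Integrable (fun p : En n × En n => f m s p * χ p.1) :=
    fun s hs => (hfi s hs).mul_bdd (c := 1)
      (hχs.continuous.comp continuous_fst).aestronglyMeasurable
      (Filter.Eventually.of_forall fun p => abs_le.2 ⟨by linarith [hχ0 p.1], hχ1 p.1⟩)
  have hmass : ∫ p in {x : En n | 2 * R ≤ ‖x‖} ×ˢ Set.univ, f m t p ≤
      (∫ x in {x : En n | R ≤ ‖x‖}, ∫ v : En n, f₀ (x, v)) + 2 * E * T / R := by
    calc _ = ∫ p in {x : En n | 2 * R ≤ ‖x‖} ×ˢ Set.univ, f m t p * χ p.1 := by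
          refine setIntegral_congr_fun ((hS _).prod MeasurableSet.univ) fun p hp => ?_
          simp [hχo p.1 hp.1]
      _ ≤ ∫ p, f m t p * χ p.1 := setIntegral_le_integral (hχint t ht.1)
          (Filter.Eventually.of_forall fun p => mul_nonneg (hf0 t p) (hχ0 p.1))
      _ ≤ (∫ p, f m 0 p * χ p.1) + 2 * E * t / R :=
          integral_mul_cutoff_le hf0 (hGmeas m) (hGL1 m) (fun φ hφ hφc s hs => by
            rw [hweak m φ hφ hφc s hs, htest φ hφ hφc]) (hGsign m) (hE m) hfi hR
            hχs hχ0 hχ1 hχd ht.1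
      _ = (∫ p in {x : En n | R ≤ ‖x‖} ×ˢ Set.univ, f m 0 p * χ p.1) + 2 * E * t / R := by
          rw [setIntegral_eq_integral_of_forall_compl_eq_zero fun p hp => ?_]
          have hp' : ¬ R ≤ ‖p.1‖ := fun h => hp ⟨h, trivial⟩
          rw [hχz p.1 (not_le.1 hp').le, mul_zero]
      _ ≤ (∫ p in {x : En n | R ≤ ‖x‖} ×ˢ Set.univ, f m 0 p) + 2 * E * T / R := by
          gcongr ?_ + 2 * E * ?_ / R
          · exact setIntegral_mono (hχint 0 le_rfl).integrableOn (hfi 0 le_rfl).integrableOn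
              fun p => mul_le_of_le_one_right (hf0 0 p) (hχ1 p.1)
          · exact ht.2
      _ ≤ _ := by
          rw [← hprod R _ (hfi 0 le_rfl)]
          gcongr
  have hpow : Integrable (fun p : En n × En n => (1 + ‖p.2‖ ^ 2) ^ (σ / 2) * f m t p) := by
    refine (hE m t ht.1).1.mono' ?_ (Filter.Eventually.of_forall fun p => ?_)
    · have : Measurable fun p : En n × En n => (1 + ‖p.2‖ ^ 2) ^ (σ / 2) := by fun_prop
      exact (this.mul (hsm t)).aestronglyMeasurable
    · rw [Real.norm_of_nonneg (mul_nonneg (by positivity) (hf0 t p))]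
      exact mul_le_mul_of_nonneg_right
        (rpow_le_self_of_one_le (hw1 p.2) hs1.le) (hf0 t p)
  have hpow' := hpow
  rw [Measure.volume_eq_prod] at hpow'
  calc _ ≤ ∫ x in {x : En n | 2 * R ≤ ‖x‖}, ∫ v : En n,
        (1 + ‖v‖ ^ 2) ^ (σ / 2) * f m t (x, v) := by
        refine integral_mono_of_nonneg (Filter.Eventually.of_forall fun x => abs_nonneg _)
          hpow'.integral_prod_left.integrableOn (ae_restrict_of_ae ?_)
        filter_upwards [hpow'.prod_right_ae] with x hx
        rw [← Real.norm_eq_abs]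
        refine norm_integral_le_of_norm_le hx (Filter.Eventually.of_forall fun v => ?_)
        rw [norm_mul, Real.norm_of_nonneg (hf0 t _), mul_comm]
        exact mul_le_mul_of_nonneg_right (hψb v) (hf0 t _)
    _ = ∫ p in {x : En n | 2 * R ≤ ‖x‖} ×ˢ Set.univ,
        (1 + ‖p.2‖ ^ 2) ^ (σ / 2) * f m t p := hprod _ _ hpow
    _ ≤ (∫ p in {x : En n | 2 * R ≤ ‖x‖} ×ˢ Set.univ, (1 + ‖p.2‖ ^ 2) * f m t p) ^ (σ / 2) *
        (∫ p in {x : En n | 2 * R ≤ ‖x‖} ×ˢ Set.univ, f m t p) ^ (1 - σ / 2) :=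
        integral_mul_rpow_le (fun p => by positivity) (hf0 t) (hE m t ht.1).1.integrableOn
          (hfi t ht.1).integrableOn hs0 hs1
    _ ≤ _ := by
        have hn1 : 0 ≤ ∫ p in {x : En n | 2 * R ≤ ‖x‖} ×ˢ Set.univ, f m t p :=
          integral_nonneg (hf0 t)
        have hn2 : 0 ≤ ∫ p in {x : En n | 2 * R ≤ ‖x‖} ×ˢ Set.univ,
            (1 + ‖p.2‖ ^ 2) * f m t p :=
          integral_nonneg fun p => mul_nonneg (by positivity) (hf0 t p)
        refine mul_le_mul (rpow_le_rpow hn2 ?_ hs0)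
          (rpow_le_rpow hn1 hmass (by linarith)) (rpow_nonneg hn1 _) (rpow_nonneg hE0 _)
        exact (setIntegral_le_integral (hE m t ht.1).1
          (Filter.Eventually.of_forall fun p => mul_nonneg (by positivity) (hf0 t p))).trans
          (hE m t ht.1).2
end
end

section
/- Let n ≥ 1 be an integer, γ ∈ (1,(n+2)/n) and κ = 1. Let f₀ : ℝ²ⁿ → [0,∞) be measurable with ∬(1+|v|²) f₀ dx dv < ∞ and ∬ f₀^{1+2/d} dx dv < ∞. For ε ∈ (0,1) define, for a velocity profile f with ρ_f, u_f as usual, ρ_f^{(ε)} = ρ_f/(1+ε ρ_f), u_f^{(ε)} = ρ_f u_f / (ρ_f + ε(1+|ρ_f u_f|)), and the modified Maxwellian M^{(ε)}[f] = M[ρ_f^{(ε)}, u_f^{(ε)}]. Then for each ε ∈ (0,1) there exists a measurable f^ε : [0,∞)×ℝⁿ×ℝⁿ → [0,∞) such that: (i) for every t ≥ 0 and a.e. (x,v), f^ε(t,x,v) = e^{−t} f₀(x−vt,v) + ∫₀^t e^{s−t} M^{(ε)}[f^ε(s,x−v(t−s),·)](v) ds; (ii) there is a constant C(f₀), independent of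 ε, with sup_{t≥0} ∬(1+|v|²) f^ε(t,x,v) dx dv ≤ C(f₀) and sup_{t≥0} ∬ f^ε(t,x,v)^{1+2/d} dx dv ≤ C(f₀); and (iii) for every T > 0, lim_{R→∞} sup_{t∈[0,T]} sup_{ε∈(0,1)} ∫_{|x|>R} ∫_{ℝⁿ} f^ε(t,x,v) dv dx = 0. -/
open MeasureTheory Real

noncomputable section

/-- degree of freedom `d = 2/(γ-1) - n`. -/
def dof (n : ℕ) (γ : ℝ) : ℝ := 2 / (γ - 1) - n

/-- the constant `c₁ = 2γ/(γ-1)` (here `κ = 1`). -/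
def cc1 (γ : ℝ) : ℝ := 2 * γ / (γ - 1)

/-- the constant `c₂ = (2γ/(γ-1))^{-1/(γ-1)} Γ(γ/(γ-1)) / (π^{n/2} Γ(d/2+1))` (here `κ = 1`). -/
def cc2 (n : ℕ) (γ : ℝ) : ℝ :=
  (2 * γ / (γ - 1)) ^ (-(1 / (γ - 1))) * Real.Gamma (γ / (γ - 1)) /
    (Real.pi ^ ((n : ℝ) / 2) * Real.Gamma (dof n γ / 2 + 1))

/-- the Maxwellian `M[ρ,u](v) = c₂ (c₁ ρ^{γ-1} - |v-u|²)₊^{d/2}` (case `γ < (n+2)/n`, `κ = 1`). -/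
def Maxw (n : ℕ) (γ ρ : ℝ) (u v : En n) : ℝ :=
  cc2 n γ * (max (cc1 γ * ρ ^ (γ - 1) - ‖v - u‖ ^ 2) 0) ^ (dof n γ / 2)

/-- macroscopic density `ρ_f = ∫ f dv`. -/
def densF (n : ℕ) (f : En n → ℝ) : ℝ := ∫ v, f v

/-- bulk velocity `u_f = ρ_f⁻¹ ∫ v f dv` if `ρ_f ≠ 0`, else `0`. -/
def bulkF (n : ℕ) (f : En n → ℝ) : En n :=
  if densF n f = 0 then 0 else (densF n f)⁻¹ • ∫ v, f v • v

/-- regularized density `ρ_f^{(ε)} = ρ_f / (1 + ε ρ_f)`. -/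
def densEps (n : ℕ) (ε : ℝ) (f : En n → ℝ) : ℝ := densF n f / (1 + ε * densF n f)

/-- regularized bulk velocity `u_f^{(ε)} = ρ_f u_f / (ρ_f + ε(1 + |ρ_f u_f|))`. -/
def bulkEps (n : ℕ) (ε : ℝ) (f : En n → ℝ) : En n :=
  (densF n f + ε * (1 + ‖densF n f • bulkF n f‖))⁻¹ • (densF n f • bulkF n f)

/-- the modified Maxwellian `M^{(ε)}[f] = M[ρ_f^{(ε)}, u_f^{(ε)}]`. -/
def MaxwEps (n : ℕ) (γ ε : ℝ) (f : En n → ℝ) (v : En n) : ℝ :=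
  Maxw n γ (densEps n ε f) (bulkEps n ε f) v

lemma dof_pos {n : ℕ} {γ : ℝ} (hn : 1 ≤ n) (hγ1 : 1 < γ) (hγ2 : γ < ((n : ℝ) + 2) / n) :
    0 < dof n γ := by
  have hn' : (0 : ℝ) < n := by exact_mod_cast hn
  rw [lt_div_iff₀ hn'] at hγ2
  unfold dof
  rw [sub_pos, lt_div_iff₀ (by linarith)]
  nlinarith

lemma cc1_pos {γ : ℝ} (hγ1 : 1 < γ) : 0 < cc1 γ := by
  unfold cc1
  have : 0 < γ - 1 := by linarith
  positivity

lemma cc2_pos {n : ℕ} {γ : ℝ} (hγ1 : 1 < γ) (hd : 0 < dof n γ) : 0 < cc2 n γ := by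
  unfold cc2
  have : 0 < γ - 1 := by linarith
  have h1 : 0 < Real.Gamma (γ / (γ - 1)) := Real.Gamma_pos_of_pos (by positivity)
  have h2 : 0 < Real.Gamma (dof n γ / 2 + 1) := Real.Gamma_pos_of_pos (by positivity)
  positivity

/-- The centred Maxwellian, parametrised by the radius of its support. -/
def prof (n : ℕ) (γ r : ℝ) (w : En n) : ℝ :=
  cc2 n γ * (max (r ^ 2 - ‖w‖ ^ 2) 0) ^ (dof n γ / 2)

/-- The radius of the support of the Maxwellian of density `ρ`. -/
def rad (γ ρ : ℝ) : ℝ := √(cc1 γ * ρ ^ (γ - 1))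

lemma Maxw_eq_prof {n : ℕ} {γ : ℝ} (hγ1 : 1 < γ) {ρ : ℝ} (hρ : 0 ≤ ρ) (u v : En n) :
    Maxw n γ ρ u v = prof n γ (rad γ ρ) (v - u) := by
  unfold Maxw prof rad
  rw [Real.sq_sqrt (mul_nonneg (cc1_pos hγ1).le (Real.rpow_nonneg hρ _))]

lemma continuous_prof {n : ℕ} {γ : ℝ} (hd : 0 < dof n γ) :
    Continuous (fun p : ℝ × En n => prof n γ p.1 p.2) := by
  unfold prof
  refine continuous_const.mul (Continuous.rpow_const (by fun_prop) fun _ => Or.inr (by positivity))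

lemma prof_nonneg {n : ℕ} {γ : ℝ} (hγ1 : 1 < γ) (hd : 0 < dof n γ) (r : ℝ) (w : En n) :
    0 ≤ prof n γ r w :=
  mul_nonneg (cc2_pos hγ1 hd).le (Real.rpow_nonneg (le_max_right _ _) _)

lemma prof_eq_zero {n : ℕ} {γ : ℝ} (hd : 0 < dof n γ) {r : ℝ} {w : En n} (hr : 0 ≤ r)
    (h : r ≤ ‖w‖) : prof n γ r w = 0 := by
  unfold prof
  rw [max_eq_right (by nlinarith), Real.zero_rpow (by positivity), mul_zero]

lemma prof_mono {n : ℕ} {γ : ℝ} (hγ1 : 1 < γ) (hd : 0 < dof n γ) {r r' : ℝ} (h0 : 0 ≤ r)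
    (h : r ≤ r') (w : En n) : prof n γ r w ≤ prof n γ r' w := by
  unfold prof
  have := cc2_pos hγ1 hd
  gcongr

lemma prof_le {n : ℕ} {γ : ℝ} (hγ1 : 1 < γ) (hd : 0 < dof n γ) {r R : ℝ} (h0 : 0 ≤ r)
    (h : r ≤ R) (w : En n) : prof n γ r w ≤ cc2 n γ * (R ^ 2) ^ (dof n γ / 2) := by
  unfold prof
  have := cc2_pos hγ1 hd
  gcongr
  exact max_le (by nlinarith [sq_nonneg ‖w‖]) (by positivity)

lemma hasCompactSupport_prof {n : ℕ} {γ : ℝ} (hd : 0 < dof n γ) {r : ℝ} (hr : 0 ≤ r) :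
    HasCompactSupport (prof n γ r) := by
  refine HasCompactSupport.intro (isCompact_closedBall (0 : En n) r) fun w hw => ?_
  rw [mem_closedBall_zero_iff, not_le] at hw
  exact prof_eq_zero hd hr hw.le

lemma integrable_prof {n : ℕ} {γ : ℝ} (hd : 0 < dof n γ) {r : ℝ} (hr : 0 ≤ r) :
    Integrable (prof n γ r) :=
  ((continuous_prof hd).comp (by fun_prop : Continuous fun w : En n => (r, w)))
    |>.integrable_of_hasCompactSupport (hasCompactSupport_prof hd hr)

lemma integral_Ioi_rpow_mul_one_sub_rpow {a s : ℝ} (ha : 0 < a) (hs : 0 < s) :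
    ∫ x in Set.Ioi (0 : ℝ), x ^ (a - 1) * (max (1 - x) 0) ^ s =
      ProbabilityTheory.beta a (s + 1) := by
  have hb := ProbabilityTheory.beta_pos ha (by positivity : 0 < s + 1)
  have h1 := ProbabilityTheory.lintegral_betaPDF_eq_one ha (by positivity : 0 < s + 1)
  have h2 : ∫ x, ProbabilityTheory.betaPDFReal a (s + 1) x = 1 := by
    rw [integral_eq_lintegral_of_nonneg_ae]
    · simp only [ProbabilityTheory.betaPDF] at h1
      rw [h1]; simp
    · filter_upwards with x
      simp only [Pi.zero_apply]
      by_cases hx : 0 < x ∧ x < 1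
      · exact (ProbabilityTheory.betaPDFReal_pos hx.1 hx.2 ha (by positivity)).le
      · rw [ProbabilityTheory.betaPDFReal, if_neg hx]
    · exact (ProbabilityTheory.measurable_betaPDFReal a (s + 1)).aestronglyMeasurable
  have h3 : ∀ x, (Set.Ioi (0 : ℝ)).indicator (fun x => x ^ (a - 1) * (max (1 - x) 0) ^ s) x =
      ProbabilityTheory.beta a (s + 1) * ProbabilityTheory.betaPDFReal a (s + 1) x := by
    intro x
    rw [ProbabilityTheory.betaPDFReal]
    by_cases hx0 : 0 < x
    · rw [Set.indicator_of_mem (Set.mem_Ioi.2 hx0)]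
      by_cases hx1 : x < 1
      · rw [if_pos ⟨hx0, hx1⟩, max_eq_left (by linarith), add_sub_cancel_right]
        field_simp
      · rw [if_neg (by tauto), max_eq_right (by linarith), Real.zero_rpow hs.ne', mul_zero,
          mul_zero]
    · rw [Set.indicator_of_notMem (by simpa using hx0), if_neg (by tauto), mul_zero]
  rw [← integral_indicator measurableSet_Ioi, funext h3, integral_const_mul, h2, mul_one]

lemma integral_prof_one {n : ℕ} {γ : ℝ} (hn : 1 ≤ n) (hγ1 : 1 < γ) (hd : 0 < dof n γ) :
    ∫ w : En n, prof n γ 1 w = (1 / cc1 γ) ^ (1 / (γ - 1)) := by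
  have hγ : 0 < γ - 1 := by linarith
  have hn' : (0 : ℝ) < n := by exact_mod_cast hn
  have : Nonempty (Fin n) := ⟨⟨0, hn⟩⟩
  have : Nontrivial (En n) := by
    rw [← Module.finrank_pos_iff (R := ℝ)]; simp; omega
  have h1 : ∀ w : En n, prof n γ 1 w =
      (fun r : ℝ => cc2 n γ * (max (1 - r ^ 2) 0) ^ (dof n γ / 2)) ‖w‖ := by
    intro w; simp [prof]
  have h2 : ∫ y in Set.Ioi (0 : ℝ), y ^ (n - 1) • (cc2 n γ * (max (1 - y ^ 2) 0) ^ (dof n γ / 2)) =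
      cc2 n γ * (ProbabilityTheory.beta (n / 2) (dof n γ / 2 + 1) / 2) := by
    rw [← integral_Ioi_rpow_mul_one_sub_rpow (by positivity) (by positivity),
      ← integral_comp_rpow_Ioi_of_pos (p := 2)
        (g := fun x : ℝ => x ^ ((n : ℝ) / 2 - 1) * (max (1 - x) 0) ^ (dof n γ / 2)) (by norm_num),
      ← integral_div, ← integral_const_mul]
    refine setIntegral_congr_fun measurableSet_Ioi fun y hy => ?_
    have hy : 0 < y := hy
    simp only [smul_eq_mul]
    have e1 : y ^ (n - 1) = y * (y ^ (2 : ℝ)) ^ ((n : ℝ) / 2 - 1) := by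
      rw [← Real.rpow_mul hy.le, ← Real.rpow_natCast, Nat.cast_sub hn]
      nth_rw 2 [← Real.rpow_one y]
      rw [← Real.rpow_add hy]
      congr 1; push_cast; ring
    have e2 : y ^ ((2 : ℝ) - 1) = y := by norm_num
    rw [e1, e2, show y ^ 2 = y ^ (2 : ℝ) by norm_cast]
    ring
  rw [funext h1, integral_fun_norm_addHaar]
  simp only [finrank_euclideanSpace, Fintype.card_fin]
  rw [h2, Measure.real, EuclideanSpace.volume_ball]
  simp only [Fintype.card_fin, ENNReal.ofReal_one, one_pow, one_mul]
  have g1 : 0 < Real.Gamma ((n : ℝ) / 2 + 1) := Real.Gamma_pos_of_pos (by positivity)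
  have g2 : 0 < Real.Gamma ((n : ℝ) / 2) := Real.Gamma_pos_of_pos (by positivity)
  have g3 : 0 < Real.Gamma (dof n γ / 2 + 1) := Real.Gamma_pos_of_pos (by positivity)
  have g4 : 0 < Real.Gamma (γ / (γ - 1)) := Real.Gamma_pos_of_pos (by positivity)
  have e3 : (n : ℝ) / 2 + (dof n γ / 2 + 1) = γ / (γ - 1) := by
    unfold dof; field_simp; ring
  have e4 : √π ^ n = π ^ ((n : ℝ) / 2) := by
    rw [Real.sqrt_eq_rpow, ← Real.rpow_natCast, ← Real.rpow_mul Real.pi_pos.le]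
    congr 1; ring
  rw [ENNReal.toReal_ofReal (by positivity), e4, ProbabilityTheory.beta, e3, cc2,
    Real.Gamma_add_one (by positivity : (n : ℝ) / 2 ≠ 0), ← cc1, one_div (cc1 γ),
    Real.inv_rpow (cc1_pos hγ1).le, ← Real.rpow_neg (cc1_pos hγ1).le]
  have : 0 < π ^ ((n : ℝ) / 2) := by positivity
  simp only [smul_eq_mul, nsmul_eq_mul]
  field_simp

lemma integral_prof {n : ℕ} {γ : ℝ} (hn : 1 ≤ n) (hγ1 : 1 < γ) (hd : 0 < dof n γ) {r : ℝ}
    (hr : 0 ≤ r) :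
    ∫ w : En n, prof n γ r w = (1 / cc1 γ) ^ (1 / (γ - 1)) * r ^ (2 / (γ - 1)) := by
  have hγ : 0 < γ - 1 := by linarith
  rcases hr.eq_or_lt with rfl | hr
  · rw [Real.zero_rpow (by positivity), mul_zero]
    simp [fun w : En n => prof_eq_zero hd le_rfl (norm_nonneg w)]
  have h := Measure.integral_comp_smul_of_nonneg (volume : Measure (En n)) (prof n γ r) r
    (hR := hr.le)
  have h1 : ∀ w : En n, prof n γ r (r • w) = r ^ dof n γ * prof n γ 1 w := by
    intro w
    unfold prof
    rw [norm_smul, Real.norm_of_nonneg hr.le,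
      show max (r ^ 2 - (r * ‖w‖) ^ 2) 0 = r ^ 2 * max (1 ^ 2 - ‖w‖ ^ 2) 0 by
        rw [mul_max_of_nonneg _ _ (by positivity)]; ring_nf,
      Real.mul_rpow (by positivity) (le_max_right _ _), ← Real.rpow_natCast, ← Real.rpow_mul hr.le]
    push_cast
    rw [mul_div_cancel₀ _ (two_ne_zero)]
    ring
  simp only [h1, integral_const_mul, integral_prof_one hn hγ1 hd, finrank_euclideanSpace,
    Fintype.card_fin, smul_eq_mul] at h
  have h2 : r ^ (2 / (γ - 1)) = r ^ n * r ^ dof n γ := by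
    rw [← Real.rpow_natCast, ← Real.rpow_add hr]; congr 1; unfold dof; ring
  have : 0 < r ^ n := by positivity
  rw [h2]
  field_simp at h
  linarith

lemma rad_nonneg (γ ρ : ℝ) : 0 ≤ rad γ ρ := Real.sqrt_nonneg _

lemma rad_sq {γ : ℝ} (hγ1 : 1 < γ) {ρ : ℝ} (hρ : 0 ≤ ρ) :
    rad γ ρ ^ 2 = cc1 γ * ρ ^ (γ - 1) :=
  Real.sq_sqrt (mul_nonneg (cc1_pos hγ1).le (Real.rpow_nonneg hρ _))

lemma rad_mono {γ : ℝ} (hγ1 : 1 < γ) {ρ ρ' : ℝ} (hρ : 0 ≤ ρ) (h : ρ ≤ ρ') :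
    rad γ ρ ≤ rad γ ρ' := by
  have := cc1_pos hγ1
  have : 0 ≤ γ - 1 := by linarith
  unfold rad
  gcongr

lemma integral_prof_rad {n : ℕ} {γ : ℝ} (hn : 1 ≤ n) (hγ1 : 1 < γ) (hd : 0 < dof n γ) {ρ : ℝ}
    (hρ : 0 ≤ ρ) : ∫ w : En n, prof n γ (rad γ ρ) w = ρ := by
  have hγ : 0 < γ - 1 := by linarith
  have hc := cc1_pos hγ1
  rw [integral_prof hn hγ1 hd (rad_nonneg _ _), show 2 / (γ - 1) = 2 * (1 / (γ - 1)) by ring,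
    Real.rpow_mul (rad_nonneg _ _), Real.rpow_two, rad_sq hγ1 hρ,
    ← Real.mul_rpow (by positivity) (by positivity), ← mul_assoc, one_div_mul_cancel hc.ne',
    one_mul,
    ← Real.rpow_mul hρ, mul_one_div_cancel hγ.ne', Real.rpow_one]

lemma integral_prof_sub_le {n : ℕ} {γ : ℝ} (hn : 1 ≤ n) (hγ1 : 1 < γ) (hd : 0 < dof n γ)
    {r δ R : ℝ} (hr : 0 ≤ r) (hrR : r ≤ R) (hδ : 0 ≤ δ) :
    (∫ w : En n, prof n γ r w) - ∫ w : En n, prof n γ (max (r - δ) 0) w ≤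
      (1 / cc1 γ) ^ (1 / (γ - 1)) * (2 / (γ - 1)) * R ^ (2 / (γ - 1) - 1) * δ := by
  have hγ : 0 < γ - 1 := by linarith
  have hc := cc1_pos hγ1
  have hn' : (1 : ℝ) ≤ n := by exact_mod_cast hn
  have hq : 1 < 2 / (γ - 1) := by unfold dof at hd; linarith
  have hR : 0 ≤ R := hr.trans hrR
  rw [integral_prof hn hγ1 hd hr, integral_prof hn hγ1 hd (le_max_right _ _), ← mul_sub, mul_assoc,
    mul_assoc]
  refine mul_le_mul_of_nonneg_left ?_ (by positivity)
  set q := 2 / (γ - 1)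
  rcases hr.eq_or_lt with rfl | hr
  · rw [Real.zero_rpow (by positivity), max_eq_right (by linarith), Real.zero_rpow (by positivity)]
    have : 0 ≤ R ^ (q - 1) := by positivity
    simp only [sub_zero]; positivity
  have hb := one_add_mul_self_le_rpow_one_add (s := max (r - δ) 0 / r - 1)
    (by have : 0 ≤ max (r - δ) 0 / r := by positivity
        linarith) hq.le
  rw [add_sub_cancel, Real.div_rpow (by positivity) hr.le, le_div_iff₀ (by positivity)] at hb
  have h1 : r ^ q = r ^ (q - 1) * r := by
    rw [← Real.rpow_add_one hr.ne', sub_add_cancel]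
  have h2 : r - δ ≤ max (r - δ) 0 := le_max_left _ _
  have h3 : (1 + q * (max (r - δ) 0 / r - 1)) * r ^ q =
      r ^ q + q * r ^ (q - 1) * (max (r - δ) 0 - r) := by
    rw [h1]; field_simp
  have h4 : r ^ (q - 1) ≤ R ^ (q - 1) := by gcongr
  have h5 : 0 ≤ r ^ (q - 1) := by positivity
  have h6 : q * r ^ (q - 1) * (r - max (r - δ) 0) ≤ q * r ^ (q - 1) * δ := by
    gcongr; linarith
  have h7 : q * r ^ (q - 1) * δ ≤ q * R ^ (q - 1) * δ := by gcongr
  rw [h3] at hb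
  nlinarith
lemma densF_nonneg {n : ℕ} {g : En n → ℝ} (hg : ∀ v, 0 ≤ g v) : 0 ≤ densF n g :=
  integral_nonneg hg

lemma densEps_nonneg {n : ℕ} {ε : ℝ} (hε : 0 < ε) {g : En n → ℝ} (hg : ∀ v, 0 ≤ g v) :
    0 ≤ densEps n ε g := by
  have := densF_nonneg hg
  unfold densEps; positivity

lemma densEps_le_densF {n : ℕ} {ε : ℝ} (hε : 0 < ε) {g : En n → ℝ} (hg : ∀ v, 0 ≤ g v) :
    densEps n ε g ≤ densF n g := by
  have := densF_nonneg hg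
  unfold densEps
  exact div_le_self this (by nlinarith)

lemma densEps_le_inv {n : ℕ} {ε : ℝ} (hε : 0 < ε) {g : En n → ℝ} (hg : ∀ v, 0 ≤ g v) :
    densEps n ε g ≤ ε⁻¹ := by
  have := densF_nonneg hg
  unfold densEps
  rw [div_le_iff₀ (by positivity)]
  field_simp
  linarith

lemma norm_inv_smul_le {E : Type*} [NormedAddCommGroup E] [NormedSpace ℝ E] {ε ρ : ℝ} (hε : 0 < ε)
    (hρ : 0 ≤ ρ) (m : E) : ‖(ρ + ε * (1 + ‖m‖))⁻¹ • m‖ ≤ ε⁻¹ := by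
  have hD : 0 < ρ + ε * (1 + ‖m‖) := by positivity
  rw [norm_smul, norm_inv, Real.norm_of_nonneg hD.le, inv_mul_le_iff₀ hD, ← div_eq_mul_inv,
    le_div_iff₀ hε]
  nlinarith

lemma norm_bulkEps_le {n : ℕ} {ε : ℝ} (hε : 0 < ε) {g : En n → ℝ} (hg : ∀ v, 0 ≤ g v) :
    ‖bulkEps n ε g‖ ≤ ε⁻¹ :=
  norm_inv_smul_le hε (densF_nonneg hg) _

lemma MaxwEps_eq_prof {n : ℕ} {γ ε : ℝ} (hγ1 : 1 < γ) (hε : 0 < ε) {g : En n → ℝ}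
    (hg : ∀ v, 0 ≤ g v) (v : En n) :
    MaxwEps n γ ε g v = prof n γ (rad γ (densEps n ε g)) (v - bulkEps n ε g) :=
  Maxw_eq_prof hγ1 (densEps_nonneg hε hg) _ _

lemma MaxwEps_nonneg {n : ℕ} {γ ε : ℝ} (hγ1 : 1 < γ) (hd : 0 < dof n γ)
    (g : En n → ℝ) (v : En n) : 0 ≤ MaxwEps n γ ε g v :=
  mul_nonneg (cc2_pos hγ1 hd).le (Real.rpow_nonneg (le_max_right _ _) _)

lemma MaxwEps_le {n : ℕ} {γ ε : ℝ} (hγ1 : 1 < γ) (hd : 0 < dof n γ) (hε : 0 < ε) {g : En n → ℝ}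
    (hg : ∀ v, 0 ≤ g v) (v : En n) :
    MaxwEps n γ ε g v ≤ cc2 n γ * (rad γ ε⁻¹ ^ 2) ^ (dof n γ / 2) := by
  rw [MaxwEps_eq_prof hγ1 hε hg]
  exact prof_le hγ1 hd (rad_nonneg _ _)
      (rad_mono hγ1 (densEps_nonneg hε hg) (densEps_le_inv hε hg)) _

lemma MaxwEps_eq_zero {n : ℕ} {γ ε : ℝ} (hγ1 : 1 < γ) (hd : 0 < dof n γ) (hε : 0 < ε)
    {g : En n → ℝ} (hg : ∀ v, 0 ≤ g v) {v : En n} (hv : rad γ ε⁻¹ + ε⁻¹ ≤ ‖v‖) :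
    MaxwEps n γ ε g v = 0 := by
  rw [MaxwEps_eq_prof hγ1 hε hg]
  refine prof_eq_zero hd (rad_nonneg _ _) ?_
  have h1 := rad_mono hγ1 (densEps_nonneg hε hg) (densEps_le_inv hε hg)
  have h2 := norm_bulkEps_le hε hg
  have h3 := norm_sub_norm_le v (bulkEps n ε g)
  linarith

lemma MaxwEps_of_densF_eq_zero {n : ℕ} {γ ε : ℝ} (hγ1 : 1 < γ) (hd : 0 < dof n γ)
    {g : En n → ℝ} (hg : densF n g = 0) (v : En n) : MaxwEps n γ ε g v = 0 := by
  have : γ - 1 ≠ 0 := by linarith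
  unfold MaxwEps Maxw densEps
  rw [hg, zero_div, Real.zero_rpow this, mul_zero,
      max_eq_right (by nlinarith [sq_nonneg ‖v - bulkEps n ε g‖]),
    Real.zero_rpow (by positivity), mul_zero]

lemma integrable_MaxwEps {n : ℕ} {γ ε : ℝ} (hγ1 : 1 < γ) (hd : 0 < dof n γ) (hε : 0 < ε)
    {g : En n → ℝ} (hg : ∀ v, 0 ≤ g v) : Integrable (MaxwEps n γ ε g) := by
  rw [funext (MaxwEps_eq_prof hγ1 hε hg)]
  exact (integrable_prof hd (rad_nonneg _ _)).comp_sub_right _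

lemma integral_MaxwEps {n : ℕ} {γ ε : ℝ} (hn : 1 ≤ n) (hγ1 : 1 < γ) (hd : 0 < dof n γ) (hε : 0 < ε)
    {g : En n → ℝ} (hg : ∀ v, 0 ≤ g v) : ∫ v, MaxwEps n γ ε g v = densEps n ε g := by
  rw [funext (MaxwEps_eq_prof hγ1 hε hg), integral_sub_right_eq_self (prof n γ _),
    integral_prof_rad hn hγ1 hd (densEps_nonneg hε hg)]

lemma lintegral_MaxwEps_le {n : ℕ} {γ ε : ℝ} (hn : 1 ≤ n) (hγ1 : 1 < γ) (hd : 0 < dof n γ)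
    (hε : 0 < ε) {g : En n → ℝ} (hg : ∀ v, 0 ≤ g v) :
    ∫⁻ v, ENNReal.ofReal (MaxwEps n γ ε g v) ≤ ∫⁻ v, ENNReal.ofReal (g v) := by
  by_cases hi : Integrable g
  · rw [← ofReal_integral_eq_lintegral_ofReal (integrable_MaxwEps hγ1 hd hε hg)
      (ae_of_all _ fun v => MaxwEps_nonneg hγ1 hd g v),
      ← ofReal_integral_eq_lintegral_ofReal hi (ae_of_all _ hg), integral_MaxwEps hn hγ1 hd hε hg]
    exact ENNReal.ofReal_le_ofReal (densEps_le_densF hε hg)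
  · simp [MaxwEps_of_densF_eq_zero hγ1 hd (show densF n g = 0 from integral_undef hi)]

lemma densF_smul_bulkF {n : ℕ} {g : En n → ℝ} (hg : ∀ v, 0 ≤ g v) (hi : Integrable g) :
    densF n g • bulkF n g = ∫ v, g v • v := by
  unfold bulkF
  split_ifs with h
  · rw [smul_zero]
    have h0 : g =ᵐ[volume] 0 := (integral_eq_zero_iff_of_nonneg hg hi).1 h
    symm
    refine integral_eq_zero_of_ae ?_
    filter_upwards [h0] with v hv
    simp [hv]
  · rw [smul_smul, mul_inv_cancel₀ h, one_smul]

/-! ### Lipschitz continuity of the modified Maxwellian -/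

lemma integral_abs_prof_sub_radius_le {n : ℕ} {γ : ℝ} (hγ1 : 1 < γ) (hd : 0 < dof n γ)
    {r r' : ℝ} (hr : 0 ≤ r) (hr' : 0 ≤ r') :
    ∫ w : En n, |prof n γ r w - prof n γ r' w| =
      |(∫ w : En n, prof n γ r w) - ∫ w : En n, prof n γ r' w| := by
  wlog h : r ≤ r' generalizing r r'
  · rw [abs_sub_comm, ← this hr' hr (by linarith)]
    simp_rw [abs_sub_comm]
  have hi := integrable_prof hd hr
  have hi' := integrable_prof hd hr'
  have h1 : ∀ w, |prof n γ r w - prof n γ r' w| = prof n γ r' w - prof n γ r w := fun w => by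
    rw [abs_sub_comm, abs_of_nonneg (sub_nonneg.2 (prof_mono hγ1 hd hr h w))]
  simp_rw [h1]
  rw [integral_sub hi' hi, abs_sub_comm, abs_of_nonneg]
  exact sub_nonneg.2 (integral_mono hi hi' fun w => prof_mono hγ1 hd hr h w)

lemma prof_radius_sub_le {n : ℕ} {γ : ℝ} (hγ1 : 1 < γ) (hd : 0 < dof n γ) {r δ : ℝ}
    (hδ : 0 ≤ δ) {w w' : En n} (h : ‖w'‖ ≤ ‖w‖ + δ) : prof n γ (max (r - δ) 0) w ≤
        prof n γ r w' := by
  by_cases hw : max (r - δ) 0 ≤ ‖w‖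
  · rw [prof_eq_zero hd (le_max_right _ _) hw]
    exact prof_nonneg hγ1 hd _ _
  rw [not_le, lt_max_iff] at hw
  have hw : ‖w‖ < r - δ := hw.resolve_right (by simp)
  have := cc2_pos hγ1 hd
  have h0 := norm_nonneg w
  unfold prof
  rw [max_eq_left (by linarith : 0 ≤ r - δ)]
  have : (r - δ) ^ 2 - ‖w‖ ^ 2 ≤ r ^ 2 - ‖w'‖ ^ 2 := by
    nlinarith [pow_le_pow_left₀ (norm_nonneg w') h 2, mul_nonneg hδ (sub_nonneg.2 hw.le)]
  gcongr

lemma integral_abs_prof_sub_shift_le {n : ℕ} {γ : ℝ} (hn : 1 ≤ n) (hγ1 : 1 < γ)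
    (hd : 0 < dof n γ) {r R : ℝ} (hr : 0 ≤ r) (hrR : r ≤ R) (u₁ u₂ : En n) :
    ∫ v : En n, |prof n γ r (v - u₁) - prof n γ r (v - u₂)| ≤
      2 * ((1 / cc1 γ) ^ (1 / (γ - 1)) * (2 / (γ - 1)) * R ^ (2 / (γ - 1) - 1)) * ‖u₁ - u₂‖ := by
  set r' := max (r - ‖u₁ - u₂‖) 0
  have hi := integrable_prof (n := n) (γ := γ) hd hr
  have hi' := integrable_prof (n := n) (γ := γ) hd (le_max_right _ _ : 0 ≤ r')
  have key := integral_prof_sub_le hn hγ1 hd hr hrR (norm_nonneg (u₁ - u₂))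
  have hpt : ∀ v : En n, |prof n γ r (v - u₁) - prof n γ r (v - u₂)| ≤
      (prof n γ r (v - u₁) - prof n γ r' (v - u₁)) +
        (prof n γ r (v - u₂) - prof n γ r' (v - u₂)) := by
    intro v
    have h1 : prof n γ r' (v - u₁) ≤ prof n γ r (v - u₂) :=
        prof_radius_sub_le hγ1 hd (norm_nonneg _) (by
      calc ‖v - u₂‖ = ‖(v - u₁) + (u₁ - u₂)‖ := by congr 1; abel
        _ ≤ _ := norm_add_le _ _)
    have h2 : prof n γ r' (v - u₂) ≤ prof n γ r (v - u₁) :=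
        prof_radius_sub_le hγ1 hd (norm_nonneg _) (by
      calc ‖v - u₁‖ = ‖(v - u₂) - (u₁ - u₂)‖ := by congr 1; abel
        _ ≤ _ := norm_sub_le _ _)
    have h3 : prof n γ r' (v - u₁) ≤ prof n γ r (v - u₁) :=
      prof_mono hγ1 hd (le_max_right _ _) (max_le (by linarith [norm_nonneg (u₁ - u₂)]) hr) _
    have h4 : prof n γ r' (v - u₂) ≤ prof n γ r (v - u₂) :=
      prof_mono hγ1 hd (le_max_right _ _) (max_le (by linarith [norm_nonneg (u₁ - u₂)]) hr) _
    rw [abs_le]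
    constructor <;> linarith
  have a₁ : Integrable fun v : En n => prof n γ r (v - u₁) - prof n γ r' (v - u₁) :=
    (hi.comp_sub_right u₁).sub (hi'.comp_sub_right u₁)
  have a₂ : Integrable fun v : En n => prof n γ r (v - u₂) - prof n γ r' (v - u₂) :=
    (hi.comp_sub_right u₂).sub (hi'.comp_sub_right u₂)
  calc _ ≤ ∫ v : En n, ((prof n γ r (v - u₁) - prof n γ r' (v - u₁)) +
        (prof n γ r (v - u₂) - prof n γ r' (v - u₂))) :=
        integral_mono (((hi.comp_sub_right u₁).sub (hi.comp_sub_right u₂)).abs) (a₁.add a₂) hpt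
    _ = 2 * ((∫ w : En n, prof n γ r w) - ∫ w : En n, prof n γ r' w) := by
        rw [integral_add a₁ a₂,
          integral_sub (hi.comp_sub_right u₁) (hi'.comp_sub_right u₁),
          integral_sub (hi.comp_sub_right u₂) (hi'.comp_sub_right u₂),
          integral_sub_right_eq_self (prof n γ r), integral_sub_right_eq_self (prof n γ r'),
          integral_sub_right_eq_self (prof n γ r), integral_sub_right_eq_self (prof n γ r')]
        ring
    _ ≤ _ := by linarith

lemma abs_div_one_add_sub_le {ε a b : ℝ} (hε : 0 < ε) (ha : 0 ≤ a) (hb : 0 ≤ b) :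
    |a / (1 + ε * a) - b / (1 + ε * b)| ≤ |a - b| := by
  have h1 : 1 ≤ (1 + ε * a) * (1 + ε * b) := by
    nlinarith [mul_nonneg hε.le ha, mul_nonneg hε.le hb,
      mul_nonneg (mul_nonneg hε.le ha) (mul_nonneg hε.le hb)]
  have h2 : a / (1 + ε * a) - b / (1 + ε * b) = (a - b) / ((1 + ε * a) * (1 + ε * b)) := by
    have : 0 < 1 + ε * a := by positivity
    have : 0 < 1 + ε * b := by positivity
    field_simp; ring
  rw [h2, abs_div, abs_of_pos (a := (1 + ε * a) * (1 + ε * b)) (by linarith)]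
  exact div_le_self (abs_nonneg _) h1

lemma norm_inv_smul_sub_le {E : Type*} [NormedAddCommGroup E] [NormedSpace ℝ E] {ε a b : ℝ}
    (hε : 0 < ε) (ha : 0 ≤ a) (hb : 0 ≤ b) (x y : E) :
    ‖(a + ε * (1 + ‖x‖))⁻¹ • x - (b + ε * (1 + ‖y‖))⁻¹ • y‖ ≤
      ε⁻¹ * ‖x - y‖ + ε⁻¹ * ε⁻¹ * (|a - b| + ε * ‖x - y‖) := by
  have hA : 0 < a + ε * (1 + ‖x‖) := by positivity
  have hB : 0 < b + ε * (1 + ‖y‖) := by positivity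
  have hεA : ε ≤ a + ε * (1 + ‖x‖) := by nlinarith [norm_nonneg x]
  have hy := norm_inv_smul_le hε hb y
  have hAi : (a + ε * (1 + ‖x‖))⁻¹ ≤ ε⁻¹ := inv_anti₀ hε hεA
  set A := a + ε * (1 + ‖x‖)
  set B := b + ε * (1 + ‖y‖)
  have h1 : A⁻¹ • x - B⁻¹ • y = A⁻¹ • (x - y) + (A⁻¹ * (B - A)) • (B⁻¹ • y) := by
    rw [smul_sub, smul_smul, show A⁻¹ * (B - A) * B⁻¹ = A⁻¹ - B⁻¹ by field_simp, sub_smul]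
    abel
  have h2 : |B - A| ≤ |a - b| + ε * ‖x - y‖ := by
    have : B - A = (b - a) + ε * (‖y‖ - ‖x‖) := by ring
    rw [this]
    refine (abs_add_le _ _).trans ?_
    rw [abs_sub_comm b a, abs_mul, abs_of_pos hε, abs_sub_comm ‖y‖]
    gcongr
    exact abs_norm_sub_norm_le x y
  rw [h1]
  refine (norm_add_le _ _).trans ?_
  rw [norm_smul, norm_smul, norm_mul, norm_inv, Real.norm_of_nonneg hA.le, Real.norm_eq_abs]
  have h3 : A⁻¹ * |B - A| * ‖B⁻¹ • y‖ ≤ ε⁻¹ * (|a - b| + ε * ‖x - y‖) * ε⁻¹ := by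
    gcongr
  have h4 : A⁻¹ * ‖x - y‖ ≤ ε⁻¹ * ‖x - y‖ := by gcongr
  linarith

lemma exists_integral_abs_MaxwEps_sub_le {n : ℕ} {γ ε : ℝ} (hn : 1 ≤ n) (hγ1 : 1 < γ)
    (hd : 0 < dof n γ) (hε : 0 < ε) :
    ∃ K : ℝ, 0 ≤ K ∧ ∀ g₁ g₂ : En n → ℝ, (∀ v, 0 ≤ g₁ v) → (∀ v, 0 ≤ g₂ v) →
      Integrable (fun v => (1 + ‖v‖) * g₁ v) → Integrable (fun v => (1 + ‖v‖) * g₂ v) →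
      Measurable g₁ → Measurable g₂ →
      ∫ v, |MaxwEps n γ ε g₁ v - MaxwEps n γ ε g₂ v| ≤ K * ∫ v, (1 + ‖v‖) * |g₁ v - g₂ v| := by
  set L := 2 * ((1 / cc1 γ) ^ (1 / (γ - 1)) * (2 / (γ - 1)) * (rad γ ε⁻¹) ^ (2 / (γ - 1) - 1))
  have hL : 0 ≤ L := by
    have := cc1_pos hγ1
    have := rad_nonneg γ ε⁻¹
    have : 0 < γ - 1 := by linarith
    positivity
  refine ⟨1 + L * (ε⁻¹ + ε⁻¹ * ε⁻¹ * (1 + ε)), by positivity, fun g₁ g₂ h₁ h₂ i₁ i₂ m₁ m₂ => ?_⟩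
  have dom : ∀ {g : En n → ℝ}, (∀ v, 0 ≤ g v) → Integrable (fun v => (1 + ‖v‖) * g v) →
      Measurable g →
      Integrable g ∧ Integrable (fun v => g v • v) := by
    intro g h i m
    constructor
    · refine i.mono' m.aestronglyMeasurable (ae_of_all _ fun v => ?_)
      rw [Real.norm_of_nonneg (h v)]
      nlinarith [norm_nonneg v, h v, mul_nonneg (norm_nonneg v) (h v)]
    · refine i.mono' (m.smul measurable_id).aestronglyMeasurable (ae_of_all _ fun v => ?_)
      rw [norm_smul, Real.norm_of_nonneg (h v)]
      nlinarith [norm_nonneg v, h v, mul_nonneg (norm_nonneg v) (h v)]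
  obtain ⟨j₁, k₁⟩ := dom h₁ i₁ m₁
  obtain ⟨j₂, k₂⟩ := dom h₂ i₂ m₂
  have iD : Integrable (fun v => (1 + ‖v‖) * |g₁ v - g₂ v|) := by
    refine (i₁.sub i₂).abs.congr (ae_of_all _ fun v => ?_)
    simp only [Pi.sub_apply]
    rw [← mul_sub, abs_mul, abs_of_nonneg (by positivity : 0 ≤ 1 + ‖v‖)]
  set I := ∫ v, (1 + ‖v‖) * |g₁ v - g₂ v|
  have hρ : |densF n g₁ - densF n g₂| ≤ I := by
    unfold densF
    rw [← integral_sub j₁ j₂]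
    refine (abs_integral_le_integral_abs).trans (integral_mono (j₁.sub j₂).abs iD fun v => ?_)
    simp only
    nlinarith [norm_nonneg v, abs_nonneg (g₁ v - g₂ v),
      mul_nonneg (norm_nonneg v) (abs_nonneg (g₁ v - g₂ v))]
  have hm : ‖densF n g₁ • bulkF n g₁ - densF n g₂ • bulkF n g₂‖ ≤ I := by
    rw [densF_smul_bulkF h₁ j₁, densF_smul_bulkF h₂ j₂, ← integral_sub k₁ k₂]
    refine (norm_integral_le_integral_norm _).trans (integral_mono (k₁.sub k₂).norm iD fun v => ?_)
    simp only
    rw [← sub_smul, norm_smul, Real.norm_eq_abs]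
    nlinarith [norm_nonneg v, abs_nonneg (g₁ v - g₂ v),
      mul_nonneg (norm_nonneg v) (abs_nonneg (g₁ v - g₂ v))]
  have hρε : |densEps n ε g₁ - densEps n ε g₂| ≤ I :=
    (abs_div_one_add_sub_le hε (densF_nonneg h₁) (densF_nonneg h₂)).trans hρ
  have hu : ‖bulkEps n ε g₁ - bulkEps n ε g₂‖ ≤ (ε⁻¹ + ε⁻¹ * ε⁻¹ * (1 + ε)) * I := by
    refine (norm_inv_smul_sub_le hε (densF_nonneg h₁) (densF_nonneg h₂) _ _).trans ?_
    calc _ ≤ ε⁻¹ * I + ε⁻¹ * ε⁻¹ * (I + ε * I) := by gcongr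
      _ = _ := by ring
  have hr₁ := rad_nonneg γ (densEps n ε g₁)
  have hr₂ := rad_nonneg γ (densEps n ε g₂)
  have p₁ := integrable_prof (n := n) (γ := γ) hd hr₁
  have p₂ := integrable_prof (n := n) (γ := γ) hd hr₂
  have hfirst := integral_abs_prof_sub_radius_le (n := n) hγ1 hd hr₁ hr₂
  rw [integral_prof_rad hn hγ1 hd (densEps_nonneg hε h₁),
    integral_prof_rad hn hγ1 hd (densEps_nonneg hε h₂)] at hfirst
  have hsecond := integral_abs_prof_sub_shift_le hn hγ1 hd hr₂
    (rad_mono hγ1 (densEps_nonneg hε h₂) (densEps_le_inv hε h₂)) (bulkEps n ε g₁) (bulkEps n ε g₂)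
  simp_rw [MaxwEps_eq_prof hγ1 hε h₁, MaxwEps_eq_prof hγ1 hε h₂]
  set r₁ := rad γ (densEps n ε g₁)
  set r₂ := rad γ (densEps n ε g₂)
  set u₁ := bulkEps n ε g₁
  set u₂ := bulkEps n ε g₂
  have q₁ : Integrable fun v : En n => |prof n γ r₁ (v - u₁) - prof n γ r₂ (v - u₁)| :=
      ((p₁.comp_sub_right u₁).sub (p₂.comp_sub_right u₁)).abs
  have q₂ : Integrable fun v : En n => |prof n γ r₂ (v - u₁) - prof n γ r₂ (v - u₂)| :=
      ((p₂.comp_sub_right u₁).sub (p₂.comp_sub_right u₂)).abs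
  calc ∫ v, |prof n γ r₁ (v - u₁) - prof n γ r₂ (v - u₂)|
      ≤ ∫ v, (|prof n γ r₁ (v - u₁) - prof n γ r₂ (v - u₁)| +
          |prof n γ r₂ (v - u₁) - prof n γ r₂ (v - u₂)|) :=
        integral_mono ((p₁.comp_sub_right u₁).sub (p₂.comp_sub_right u₂)).abs (q₁.add q₂)
          fun v => abs_sub_le _ _ _
    _ = (∫ w, |prof n γ r₁ w - prof n γ r₂ w|) +
          ∫ v, |prof n γ r₂ (v - u₁) - prof n γ r₂ (v - u₂)| := by
        rw [integral_add q₁ q₂,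
            integral_sub_right_eq_self (fun w => |prof n γ r₁ w - prof n γ r₂ w|)]
    _ ≤ I + L * ((ε⁻¹ + ε⁻¹ * ε⁻¹ * (1 + ε)) * I) := by
        gcongr
        · rw [hfirst]; exact hρε
        · refine hsecond.trans ?_
          gcongr
    _ = _ := by ring

lemma exists_lintegral_MaxwEps_sub_le {n : ℕ} {γ ε : ℝ} (hn : 1 ≤ n) (hγ1 : 1 < γ)
    (hd : 0 < dof n γ) (hε : 0 < ε) :
    ∃ K : ℝ, 0 ≤ K ∧ ∀ g₁ g₂ : En n → ℝ, (∀ v, 0 ≤ g₁ v) → (∀ v, 0 ≤ g₂ v) →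
      Measurable g₁ → Measurable g₂ →
      ∫⁻ v, ENNReal.ofReal (1 + ‖v‖) * ‖g₁ v‖ₑ ≠ ⊤ → ∫⁻ v, ENNReal.ofReal (1 + ‖v‖) * ‖g₂ v‖ₑ ≠ ⊤ →
      ∫⁻ v, ENNReal.ofReal (1 + ‖v‖) * ‖MaxwEps n γ ε g₁ v - MaxwEps n γ ε g₂ v‖ₑ ≤
        ENNReal.ofReal K * ∫⁻ v, ENNReal.ofReal (1 + ‖v‖) * ‖g₁ v - g₂ v‖ₑ := by
  obtain ⟨K, hK, h⟩ := exists_integral_abs_MaxwEps_sub_le hn hγ1 hd hε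
  set R := rad γ ε⁻¹ + ε⁻¹
  have hR : 0 ≤ R := add_nonneg (rad_nonneg _ _) (by positivity)
  refine ⟨(1 + R) * K, by positivity, fun g₁ g₂ h₁ h₂ m₁ m₂ f₁ f₂ => ?_⟩
  have enn : ∀ (g : En n → ℝ) (v : En n), ENNReal.ofReal (1 + ‖v‖) * ‖g v‖ₑ =
      ‖(1 + ‖v‖) * g v‖ₑ := by
    intro g v
    rw [enorm_mul, Real.enorm_of_nonneg (by positivity : 0 ≤ 1 + ‖v‖)]
  have int : ∀ {g : En n → ℝ}, Measurable g → ∫⁻ v, ENNReal.ofReal (1 + ‖v‖) * ‖g v‖ₑ ≠ ⊤ →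
      Integrable (fun v => (1 + ‖v‖) * g v) := by
    intro g m f
    simp_rw [enn g] at f
    exact ⟨by fun_prop, lt_top_iff_ne_top.2 f⟩
  have i₁ := int m₁ f₁
  have i₂ := int m₂ f₂
  have iM : Integrable fun v => MaxwEps n γ ε g₁ v - MaxwEps n γ ε g₂ v :=
      (integrable_MaxwEps (g := g₁) hγ1 hd hε h₁).sub (integrable_MaxwEps (g := g₂) hγ1 hd hε h₂)
  have iD : Integrable (fun v => (1 + ‖v‖) * |g₁ v - g₂ v|) := by
    refine (i₁.sub i₂).abs.congr (ae_of_all _ fun v => ?_)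
    simp only [Pi.sub_apply]
    rw [← mul_sub, abs_mul, abs_of_nonneg (by positivity : 0 ≤ 1 + ‖v‖)]
  calc _ ≤ ∫⁻ v,
      ENNReal.ofReal (1 + R) * ENNReal.ofReal |MaxwEps n γ ε g₁ v - MaxwEps n γ ε g₂ v| := by
        refine lintegral_mono fun v => ?_
        by_cases hv : ‖v‖ ≤ R
        · rw [← Real.norm_eq_abs, ofReal_norm]; gcongr
        · rw [MaxwEps_eq_zero hγ1 hd hε h₁ (le_of_not_ge hv),
              MaxwEps_eq_zero hγ1 hd hε h₂ (le_of_not_ge hv)]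
          simp
    _ = ENNReal.ofReal (1 + R) *
        ENNReal.ofReal (∫ v, |MaxwEps n γ ε g₁ v - MaxwEps n γ ε g₂ v|) := by
        rw [lintegral_const_mul' _ _ ENNReal.ofReal_ne_top,
          ofReal_integral_eq_lintegral_ofReal iM.abs (ae_of_all _ fun v => abs_nonneg _)]
    _ ≤ ENNReal.ofReal (1 + R) * ENNReal.ofReal (K * ∫ v, (1 + ‖v‖) * |g₁ v - g₂ v|) := by
        gcongr
        exact h g₁ g₂ h₁ h₂ i₁ i₂ m₁ m₂
    _ = _ := by
        rw [ENNReal.ofReal_mul hK, ← mul_assoc, ← ENNReal.ofReal_mul (by positivity),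
          ofReal_integral_eq_lintegral_ofReal iD (ae_of_all _ fun v => by positivity)]
        congr 1
        refine lintegral_congr fun v => ?_
        rw [ENNReal.ofReal_mul (by positivity), ← Real.norm_eq_abs, ofReal_norm]
/-! ### Entropy -/

/-- The coefficient of the power term in the kinetic entropy. -/
def entCoeff (n : ℕ) (γ : ℝ) : ℝ :=
  1 / (2 * (1 + 2 / dof n γ) * cc2 n γ ^ (2 / dof n γ))

/-- The kinetic entropy density, which is minimised by the Maxwellians. -/
def kinEnt (n : ℕ) (γ : ℝ) (v : En n) (z : ℝ) : ℝ :=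
  ‖v‖ ^ 2 / 2 * z + entCoeff n γ * z ^ (1 + 2 / dof n γ)

lemma entCoeff_pos {n : ℕ} {γ : ℝ} (hγ1 : 1 < γ) (hd : 0 < dof n γ) : 0 < entCoeff n γ := by
  have := cc2_pos hγ1 hd
  unfold entCoeff; positivity

lemma kinEnt_nonneg {n : ℕ} {γ : ℝ} (hγ1 : 1 < γ) (hd : 0 < dof n γ) (v : En n) {z : ℝ}
    (hz : 0 ≤ z) : 0 ≤ kinEnt n γ v z := by
  have := entCoeff_pos hγ1 hd
  unfold kinEnt; positivity

lemma kinEnt_zero {n : ℕ} {γ : ℝ} (hd : 0 < dof n γ) (v : En n) : kinEnt n γ v 0 = 0 := by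
  unfold kinEnt
  rw [Real.zero_rpow (by positivity)]; simp

lemma continuous_kinEnt {n : ℕ} {γ : ℝ} (hd : 0 < dof n γ) :
    Continuous (fun p : En n × ℝ => kinEnt n γ p.1 p.2) := by
  unfold kinEnt
  refine Continuous.add (by fun_prop) (continuous_const.mul
    (Continuous.rpow_const (by fun_prop) fun _ => Or.inr (by positivity)))

lemma measurable_kinEnt {n : ℕ} {γ : ℝ} (hd : 0 < dof n γ) {α : Type*} [MeasurableSpace α]
    {u : α → En n} {g : α → ℝ} (hu : Measurable u) (hg : Measurable g) :
    Measurable fun a => kinEnt n γ (u a) (g a) := by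
  have h := (continuous_kinEnt (γ := γ) hd).measurable.comp (hu.prodMk hg)
  simpa only [Function.comp_def] using h

lemma rpow_tangent_le {p y z : ℝ} (hp : 1 < p) (hy : 0 ≤ y) (hz : 0 ≤ z) :
    y ^ p + p * y ^ (p - 1) * (z - y) ≤ z ^ p := by
  rcases hy.eq_or_lt with rfl | hy
  · rw [Real.zero_rpow (by linarith), Real.zero_rpow (by linarith)]
    have := Real.rpow_nonneg hz p
    simpa
  have hb := one_add_mul_self_le_rpow_one_add (s := z / y - 1)
    (by have : 0 ≤ z / y := by positivity
        linarith) hp.le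
  rw [add_sub_cancel, Real.div_rpow hz hy.le, le_div_iff₀ (by positivity)] at hb
  have h1 : y ^ p = y ^ (p - 1) * y := by
    rw [← Real.rpow_add_one hy.ne', sub_add_cancel]
  have h3 : (1 + p * (z / y - 1)) * y ^ p = y ^ p + p * y ^ (p - 1) * (z - y) := by
    rw [h1]; field_simp
  linarith

lemma entCoeff_mul_prof_tangent_le {n : ℕ} {γ : ℝ} (hγ1 : 1 < γ) (hd : 0 < dof n γ) (r : ℝ)
    (w : En n) {z : ℝ} (hz : 0 ≤ z) :
    entCoeff n γ * prof n γ r w ^ (1 + 2 / dof n γ) +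
      (r ^ 2 - ‖w‖ ^ 2) / 2 * (z - prof n γ r w) ≤ entCoeff n γ * z ^ (1 + 2 / dof n γ) := by
  have hc := entCoeff_pos hγ1 hd
  have hc2 := cc2_pos hγ1 hd
  have ht := mul_le_mul_of_nonneg_left (rpow_tangent_le (p := 1 + 2 / dof n γ) (by
    have : 0 < 2 / dof n γ := by positivity
    linarith) (prof_nonneg hγ1 hd r w) hz) hc.le
  refine le_trans ?_ ht
  rw [mul_add]
  refine add_le_add_right ?_ _
  rcases le_total (r ^ 2 - ‖w‖ ^ 2) 0 with h | h
  · have h0 : prof n γ r w = 0 := by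
      unfold prof
      rw [max_eq_right h, Real.zero_rpow (by positivity), mul_zero]
    rw [h0, Real.zero_rpow (by rw [add_sub_cancel_left]; positivity)]
    simp only [sub_zero, mul_zero, zero_mul]
    nlinarith
  · apply le_of_eq
    have h0 : prof n γ r w ^ (1 + 2 / dof n γ - 1) =
        cc2 n γ ^ (2 / dof n γ) * (r ^ 2 - ‖w‖ ^ 2) := by
      unfold prof
      rw [max_eq_left h, add_sub_cancel_left, Real.mul_rpow hc2.le (by positivity),
          ← Real.rpow_mul h,
        show dof n γ / 2 * (2 / dof n γ) = 1 by field_simp, Real.rpow_one]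
    rw [h0]
    unfold entCoeff
    have : 0 < cc2 n γ ^ (2 / dof n γ) := by positivity
    have : 0 < 1 + 2 / dof n γ := by positivity
    field_simp

lemma integral_inner_prof {n : ℕ} {γ : ℝ} (r : ℝ) (u : En n) :
    ∫ w : En n, inner ℝ w u * prof n γ r w = 0 := by
  have h := integral_neg_eq_self (fun w : En n => inner ℝ w u * prof n γ r w) volume
  have h1 : ∀ w : En n, inner ℝ (-w) u * prof n γ r (-w) = -(inner ℝ w u * prof n γ r w) := by
    intro w; simp [prof]
  simp_rw [h1, integral_neg] at h
  linarith

lemma integrable_inner_prof {n : ℕ} {γ : ℝ} (hd : 0 < dof n γ) {r : ℝ} (hr : 0 ≤ r) (u : En n) :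
    Integrable fun w : En n => inner ℝ w u * prof n γ r w := by
  refine Continuous.integrable_of_hasCompactSupport (Continuous.mul (by fun_prop)
    ((continuous_prof hd).comp (by fun_prop : Continuous fun w : En n => (r, w)))) ?_
  exact (hasCompactSupport_prof hd hr).mul_left

lemma integrable_kinEnt_MaxwEps {n : ℕ} {γ ε : ℝ} (hγ1 : 1 < γ) (hd : 0 < dof n γ) (hε : 0 < ε)
    {g : En n → ℝ} (hg : ∀ v, 0 ≤ g v) :
    Integrable fun v => kinEnt n γ v (MaxwEps n γ ε g v) := by
  refine Continuous.integrable_of_hasCompactSupport ?_ ?_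
  · simp_rw [MaxwEps_eq_prof hγ1 hε hg]
    have h1 : Continuous fun v : En n =>
        prof n γ (rad γ (densEps n ε g)) (v - bulkEps n ε g) :=
      (continuous_prof hd).comp (continuous_const.prodMk (continuous_id.sub continuous_const))
    have h2 := (continuous_kinEnt (γ := γ) hd).comp (continuous_id.prodMk h1)
    simpa only [Function.comp_def, id] using h2
  · refine HasCompactSupport.intro (isCompact_closedBall (0 : En n)
        (rad γ ε⁻¹ + ε⁻¹)) fun w hw => ?_
    rw [mem_closedBall_zero_iff, not_le] at hw
    rw [MaxwEps_eq_zero hγ1 hd hε hg hw.le, kinEnt_zero hd]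

/-- The modified Maxwellian of `g` has smaller kinetic entropy than `g`. -/
lemma lintegral_kinEnt_MaxwEps_le {n : ℕ} {γ ε : ℝ} (hn : 1 ≤ n) (hγ1 : 1 < γ) (hd : 0 < dof n γ)
    (hε : 0 < ε) {g : En n → ℝ} (hgm : Measurable g) (hg : ∀ v, 0 ≤ g v) :
    ∫⁻ v, ENNReal.ofReal (kinEnt n γ v (MaxwEps n γ ε g v)) ≤
      ∫⁻ v, ENNReal.ofReal (kinEnt n γ v (g v)) := by
  have hc := entCoeff_pos hγ1 hd
  by_cases h0 : densF n g = 0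
  · simp [MaxwEps_of_densF_eq_zero hγ1 hd h0, kinEnt_zero hd]
  have hi : Integrable g := by
    by_contra hi; exact h0 (integral_undef hi)
  have hρ : 0 < densF n g := lt_of_le_of_ne (densF_nonneg hg) (Ne.symm h0)
  by_cases htop : ∫⁻ v, ENNReal.ofReal (kinEnt n γ v (g v)) = ⊤
  · rw [htop]; exact le_top
  have hkm : Measurable fun v => kinEnt n γ v (g v) :=
    measurable_kinEnt hd measurable_id hgm
  have hk : Integrable fun v => kinEnt n γ v (g v) := by
    refine ⟨hkm.aestronglyMeasurable, ?_⟩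
    rw [hasFiniteIntegral_iff_ofReal (ae_of_all _ fun v => kinEnt_nonneg hγ1 hd v (hg v))]
    exact lt_top_iff_ne_top.2 htop
  have hvg : Integrable fun v => g v • v := by
    refine (hi.add hk).mono' (hgm.smul measurable_id).aestronglyMeasurable (ae_of_all _ fun v => ?_)
    rw [norm_smul, Real.norm_of_nonneg (hg v)]
    have h1 : ‖v‖ ≤ 1 + ‖v‖ ^ 2 / 2 := by nlinarith [sq_nonneg (‖v‖ - 1)]
    have h2 : 0 ≤ entCoeff n γ * g v ^ (1 + 2 / dof n γ) := by have := hg v; positivity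
    simp only [Pi.add_apply, kinEnt]
    nlinarith [mul_le_mul_of_nonneg_left h1 (hg v)]
  rw [← ofReal_integral_eq_lintegral_ofReal (integrable_kinEnt_MaxwEps hγ1 hd hε hg)
      (ae_of_all _ fun v => kinEnt_nonneg hγ1 hd v (MaxwEps_nonneg hγ1 hd g v)),
    ← ofReal_integral_eq_lintegral_ofReal hk (ae_of_all _ fun v => kinEnt_nonneg hγ1 hd v (hg v))]
  refine ENNReal.ofReal_le_ofReal ?_
  have hM := integrable_MaxwEps (g := g) hγ1 hd hε hg
  have hIM := integral_MaxwEps hn hγ1 hd hε hg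
  have hρ' := densEps_nonneg hε hg
  have hρρ' := densEps_le_densF hε hg
  set ρ := densF n g with hρdef
  set ρ' := densEps n ε g
  set u := bulkEps n ε g with hu
  set r := rad γ ρ'
  set m := ∫ v, g v • v with hm
  have hum : u = (ρ + ε * (1 + ‖m‖))⁻¹ • m := by
    rw [hu, bulkEps, densF_smul_bulkF hg hi]
  have hgu : Integrable fun v => inner ℝ v u * g v := by
    have := hvg.inner_const (𝕜 := ℝ) u
    refine this.congr (ae_of_all _ fun v => ?_)
    simp [inner_smul_left, mul_comm]
  have hIgu : ∫ v, inner ℝ v u * g v = inner ℝ m u := by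
    rw [hm, real_inner_comm, ← integral_inner (𝕜 := ℝ) hvg]
    refine integral_congr_ae (ae_of_all _ fun v => ?_)
    simp only [inner_smul_right, real_inner_comm u, mul_comm]
  have hp := integrable_prof (n := n) (γ := γ) hd (rad_nonneg γ ρ')
  have hsplit : ∀ v : En n, inner ℝ v u * MaxwEps n γ ε g v =
      inner ℝ (v - u) u * prof n γ r (v - u) + ‖u‖ ^ 2 * MaxwEps n γ ε g v := by
    intro v
    rw [MaxwEps_eq_prof hγ1 hε hg, inner_sub_left, real_inner_self_eq_norm_sq]
    ring
  have hq : Integrable fun v : En n => inner ℝ (v - u) u * prof n γ r (v - u) :=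
    (integrable_inner_prof hd (rad_nonneg γ ρ') u).comp_sub_right u
  have hMu : Integrable fun v => inner ℝ v u * MaxwEps n γ ε g v := by
    simp_rw [hsplit]
    exact hq.add (hM.const_mul _)
  have hIMu : ∫ v, inner ℝ v u * MaxwEps n γ ε g v = ‖u‖ ^ 2 * ρ' := by
    simp_rw [hsplit]
    rw [integral_add hq (hM.const_mul _), integral_const_mul, hIM,
      integral_sub_right_eq_self (fun w : En n => inner ℝ w u * prof n γ r w), integral_inner_prof,
      zero_add]
  have hpt : ∀ v, (r ^ 2 - ‖u‖ ^ 2) / 2 * (g v - MaxwEps n γ ε g v) +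
      (inner ℝ v u * g v - inner ℝ v u * MaxwEps n γ ε g v) ≤
      kinEnt n γ v (g v) - kinEnt n γ v (MaxwEps n γ ε g v) := by
    intro v
    have := entCoeff_mul_prof_tangent_le hγ1 hd r (v - u) (hg v)
    rw [← MaxwEps_eq_prof hγ1 hε hg, norm_sub_sq_real] at this
    unfold kinEnt
    linarith
  have hint1 : Integrable fun v => (r ^ 2 - ‖u‖ ^ 2) / 2 * (g v - MaxwEps n γ ε g v) :=
    (hi.sub hM).const_mul _
  have hint2 : Integrable fun v => inner ℝ v u * g v - inner ℝ v u * MaxwEps n γ ε g v :=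
      hgu.sub hMu
  have hmono := integral_mono (hint1.add hint2)
    (hk.sub (integrable_kinEnt_MaxwEps hγ1 hd hε hg)) hpt
  simp only [Pi.add_apply, Pi.sub_apply] at hmono
  rw [integral_add hint1 hint2, integral_const_mul, integral_sub hi hM, integral_sub hgu hMu,
    integral_sub hk (integrable_kinEnt_MaxwEps hγ1 hd hε hg), hIgu, hIMu, hIM] at hmono
  suffices h : 0 ≤ (r ^ 2 - ‖u‖ ^ 2) / 2 * (ρ - ρ') + (inner ℝ m u - ‖u‖ ^ 2 * ρ') by
    have e : ∫ v, g v = ρ := rfl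
    rw [e] at hmono
    linarith
  have hD : 0 < ρ + ε * (1 + ‖m‖) := by positivity
  have hinner : inner ℝ m u = (ρ + ε * (1 + ‖m‖)) * ‖u‖ ^ 2 := by
    rw [hum, inner_smul_right, real_inner_self_eq_norm_sq, norm_smul, norm_inv,
      Real.norm_of_nonneg hD.le]
    field_simp
  rw [hinner]
  have h1 : 0 ≤ r ^ 2 * (ρ - ρ') := mul_nonneg (sq_nonneg _) (by linarith)
  have h2 : 0 ≤ ε * (1 + ‖m‖) * ‖u‖ ^ 2 := by positivity
  have h3 : 0 ≤ ‖u‖ ^ 2 * (ρ - ρ') := mul_nonneg (sq_nonneg _) (by linarith)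
  nlinarith

lemma exists_kinEnt_MaxwEps_le {n : ℕ} {γ ε : ℝ} (hγ1 : 1 < γ) (hd : 0 < dof n γ) (hε : 0 < ε) :
    ∃ K : ℝ, 0 ≤ K ∧ ∀ g : En n → ℝ, (∀ v, 0 ≤ g v) → ∀ v,
      kinEnt n γ v (MaxwEps n γ ε g v) ≤ K * MaxwEps n γ ε g v := by
  have hc := entCoeff_pos hγ1 hd
  have hc2 := cc2_pos hγ1 hd
  have hr := rad_nonneg γ ε⁻¹
  set B := cc2 n γ * (rad γ ε⁻¹ ^ 2) ^ (dof n γ / 2) with hB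
  set R := rad γ ε⁻¹ + ε⁻¹ with hR
  refine ⟨R ^ 2 / 2 + entCoeff n γ * B ^ (2 / dof n γ), by positivity, fun g hg v => ?_⟩
  by_cases hv : R ≤ ‖v‖
  · rw [MaxwEps_eq_zero hγ1 hd hε hg hv, kinEnt_zero hd, mul_zero]
  have h0 := MaxwEps_nonneg (ε := ε) hγ1 hd g v
  have h1 := MaxwEps_le hγ1 hd hε hg v
  unfold kinEnt
  rw [Real.rpow_add' h0 (by positivity), Real.rpow_one, add_mul]
  have h2 : ‖v‖ ≤ R := by linarith
  have h3 : MaxwEps n γ ε g v ^ (2 / dof n γ) ≤ B ^ (2 / dof n γ) := by gcongr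
  have h4 : MaxwEps n γ ε g v * MaxwEps n γ ε g v ^ (2 / dof n γ) ≤
    MaxwEps n γ ε g v * B ^ (2 / dof n γ) := by gcongr
  have h5 : ‖v‖ ^ 2 / 2 * MaxwEps n γ ε g v ≤ R ^ 2 / 2 * MaxwEps n γ ε g v := by gcongr
  nlinarith [mul_le_mul_of_nonneg_left h4 hc.le]

/-! ### Measurability of the collision term and free transport -/

lemma measurable_densF {n : ℕ} {α : Type*} [MeasurableSpace α] {g : α → En n → ℝ}
    (hg : Measurable (Function.uncurry g)) : Measurable fun a => densF n (g a) :=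
  (hg.stronglyMeasurable.integral_prod_right (ν := volume)).measurable

lemma measurable_bulkF {n : ℕ} {α : Type*} [MeasurableSpace α] {g : α → En n → ℝ}
    (hg : Measurable (Function.uncurry g)) : Measurable fun a => bulkF n (g a) := by
  have h1 : Measurable (Function.uncurry fun (a : α) (v : En n) => g a v • v) :=
    hg.smul measurable_snd
  have h2 : Measurable fun a => ∫ v, g a v • v :=
    (h1.stronglyMeasurable.integral_prod_right (ν := volume)).measurable
  have h3 := measurable_densF hg
  exact Measurable.ite (h3 (measurableSet_singleton 0)) measurable_const (h3.inv.smul h2)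

lemma measurable_MaxwEps {n : ℕ} {γ ε : ℝ} {α : Type*} [MeasurableSpace α] {g : α → En n → ℝ}
    (hg : Measurable (Function.uncurry g)) {u : α → En n} (hu : Measurable u) :
    Measurable fun a => MaxwEps n γ ε (g a) (u a) := by
  have h1 := measurable_densF hg
  have h2 := measurable_bulkF hg
  have h3 : Measurable fun a => densEps n ε (g a) := by unfold densEps; fun_prop
  have h4 : Measurable fun a => bulkEps n ε (g a) := by unfold bulkEps; fun_prop
  unfold MaxwEps Maxw
  fun_prop

/-- Backward free transport on phase space. -/
def freeFlow {n : ℕ} (t : ℝ) (p : En n × En n) : En n × En n := (p.1 - t • p.2, p.2)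

lemma measurable_freeFlow {n : ℕ} {α : Type*} [MeasurableSpace α] {t : α → ℝ}
    {p : α → En n × En n} (ht : Measurable t) (hp : Measurable p) :
    Measurable fun a => freeFlow (t a) (p a) := by
  unfold freeFlow; fun_prop

lemma freeFlow_freeFlow {n : ℕ} (s t : ℝ) (p : En n × En n) :
    freeFlow s (freeFlow t p) = freeFlow (s + t) p := by
  simp only [freeFlow, add_smul, Prod.mk.injEq, and_true]
  abel

lemma freeFlow_zero {n : ℕ} (p : En n × En n) : freeFlow 0 p = p := by simp [freeFlow]

lemma measurePreserving_freeFlow {n : ℕ} (t : ℝ) :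
    MeasurePreserving (freeFlow (n := n) t) := by
  have h : MeasurePreserving (fun p : En n × En n => (p.1, p.2 - t • p.1)) := by
    refine (MeasurePreserving.id volume).skew_product (g := fun v x : En n => x - t • v)
      (by fun_prop) (ae_of_all _ fun v => ?_)
    exact (measurePreserving_sub_right volume (t • v)).map_eq
  exact (Measure.measurePreserving_swap.comp h).comp Measure.measurePreserving_swap

lemma lintegral_comp_freeFlow {n : ℕ} (t : ℝ) {a : En n × En n → ENNReal} (ha : Measurable a) :
    ∫⁻ p, a (freeFlow t p) = ∫⁻ p, a p :=
  (measurePreserving_freeFlow t).lintegral_comp ha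

lemma lintegral_mul_comp_freeFlow {n : ℕ} (t : ℝ) {ψ a : En n × En n → ENNReal}
    (hψ : Measurable ψ) (ha : Measurable a) :
    ∫⁻ p, ψ p * a (freeFlow t p) = ∫⁻ p, ψ (freeFlow (-t) p) * a p := by
  have h := lintegral_comp_freeFlow t (a := fun p => ψ (freeFlow (-t) p) * a p)
    ((hψ.comp (measurable_freeFlow measurable_const measurable_id)).mul ha)
  simp only [freeFlow_freeFlow, neg_add_cancel, freeFlow_zero] at h
  exact h

/-- Tonelli's theorem for Duhamel's formula. -/
lemma lintegral_mul_lintegral_freeFlow {n : ℕ} (μ : Measure ℝ) [SFinite μ] (t : ℝ)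
    {ψ : En n × En n → ENNReal} (hψ : Measurable ψ) {c : ℝ → ENNReal} (hc : Measurable c)
    {b : ℝ → En n × En n → ENNReal} (hb : Measurable (Function.uncurry b)) :
    ∫⁻ p, ψ p * ∫⁻ s, c s * b s (freeFlow (t - s) p) ∂μ =
      ∫⁻ s, c s * (∫⁻ p, ψ (freeFlow (s - t) p) * b s p) ∂μ := by
  have hb' : ∀ s, Measurable (b s) := fun s => hb.comp measurable_prodMk_left
  have h1 : Measurable fun q : (En n × En n) × ℝ => c q.2 * b q.2 (freeFlow (t - q.2) q.1) :=
    (hc.comp measurable_snd).mul (hb.comp (measurable_snd.prodMk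
      (measurable_freeFlow (measurable_const.sub measurable_snd) measurable_fst)))
  calc ∫⁻ p, ψ p * ∫⁻ s, c s * b s (freeFlow (t - s) p) ∂μ
      = ∫⁻ p, ∫⁻ s, ψ p * (c s * b s (freeFlow (t - s) p)) ∂μ :=
        lintegral_congr fun p => (lintegral_const_mul _ (h1.comp measurable_prodMk_left)).symm
    _ = ∫⁻ s, (∫⁻ p, ψ p * (c s * b s (freeFlow (t - s) p))) ∂μ :=
        lintegral_lintegral_swap ((hψ.comp measurable_fst).mul h1).aemeasurable
    _ = _ := by
        refine lintegral_congr fun s => ?_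
        simp_rw [mul_left_comm (ψ _) (c s)]
        have h2 : Measurable fun p => ψ p * b s (freeFlow (t - s) p) :=
          hψ.mul ((hb' s).comp (measurable_freeFlow measurable_const measurable_id))
        rw [lintegral_const_mul _ h2, lintegral_mul_comp_freeFlow _ hψ (hb' s), neg_sub]

/-! ### Duhamel's formula -/

/-- The right-hand side of the mild formulation, with initial datum `a` and source `G`. -/
def duhamel {n : ℕ} (a : En n × En n → ℝ) (G : ℝ → En n × En n → ℝ) (t : ℝ)
    (p : En n × En n) : ℝ :=
  Real.exp (-t) * a (freeFlow t p) +
    ∫ s in Set.Ioc 0 t, Real.exp (s - t) * G s (freeFlow (t - s) p)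

/-- The gain term `M^{(ε)}[g]` as a function on phase space. -/
def gain (n : ℕ) (γ ε : ℝ) (g : ℝ → En n × En n → ℝ) (s : ℝ) (p : En n × En n) : ℝ :=
  MaxwEps n γ ε (fun w => g s (p.1, w)) p.2

lemma measurable_gain {n : ℕ} {γ ε : ℝ} {g : ℝ → En n × En n → ℝ}
    (hg : Measurable (Function.uncurry g)) : Measurable (Function.uncurry (gain n γ ε g)) :=
  measurable_MaxwEps (α := ℝ × (En n × En n)) (g := fun q w => g q.1 (q.2.1, w))
    (u := fun q => q.2.2)
    (hg.comp (by fun_prop : Measurable fun r : (ℝ × (En n × En n)) × En n =>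
      (r.1.1, (r.1.2.1, r.2)))) (by fun_prop)

lemma measurable_duhamel_integrand {n : ℕ} {G : ℝ → En n × En n → ℝ}
    (hG : Measurable (Function.uncurry G)) :
    Measurable fun r : (ℝ × (En n × En n)) × ℝ =>
      Real.exp (r.2 - r.1.1) * G r.2 (freeFlow (r.1.1 - r.2) r.1.2) := by
  have h : Measurable fun r : (ℝ × (En n × En n)) × ℝ =>
      (r.2, freeFlow (r.1.1 - r.2) r.1.2) :=
    measurable_snd.prodMk (measurable_freeFlow (by fun_prop) (by fun_prop))
  exact (by fun_prop : Measurable fun r : (ℝ × (En n × En n)) × ℝ =>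
    Real.exp (r.2 - r.1.1)).mul (hG.comp h)

lemma measurable_duhamel {n : ℕ} {a : En n × En n → ℝ} {G : ℝ → En n × En n → ℝ}
    (ha : Measurable a) (hG : Measurable (Function.uncurry G)) :
    Measurable (Function.uncurry (duhamel a G)) := by
  have h1 : Measurable fun q : ℝ × (En n × En n) => Real.exp (-q.1) * a (freeFlow q.1 q.2) :=
    (by fun_prop : Measurable fun q : ℝ × (En n × En n) => Real.exp (-q.1)).mul
      (ha.comp (measurable_freeFlow measurable_fst measurable_snd))
  have h2 : Measurable (Function.uncurry fun (q : ℝ × (En n × En n)) (s : ℝ) =>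
      (Set.Ioc 0 q.1).indicator
        (fun s => Real.exp (s - q.1) * G s (freeFlow (q.1 - s) q.2)) s) := by
    have hs : MeasurableSet {r : (ℝ × (En n × En n)) × ℝ | 0 < r.2 ∧ r.2 ≤ r.1.1} :=
      (measurableSet_lt measurable_const measurable_snd).inter
        (measurableSet_le measurable_snd (by fun_prop))
    exact (measurable_duhamel_integrand hG).indicator hs
  have h3 := (h2.stronglyMeasurable.integral_prod_right (ν := volume)).measurable
  simp only [integral_indicator measurableSet_Ioc] at h3
  exact h1.add h3

lemma duhamel_nonneg {n : ℕ} {a : En n × En n → ℝ} {G : ℝ → En n × En n → ℝ}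
    (ha : ∀ p, 0 ≤ a p) (hG : ∀ s p, 0 ≤ G s p) (t : ℝ) (p : En n × En n) :
    0 ≤ duhamel a G t p :=
  add_nonneg (mul_nonneg (Real.exp_nonneg _) (ha _))
    (integral_nonneg fun _ => mul_nonneg (Real.exp_nonneg _) (hG _ _))

lemma measurable_duhamel_integrand_right {n : ℕ} {G : ℝ → En n × En n → ℝ}
    (hG : Measurable (Function.uncurry G)) (t : ℝ) (p : En n × En n) :
    Measurable fun s => Real.exp (s - t) * G s (freeFlow (t - s) p) :=
  (measurable_duhamel_integrand hG).comp (measurable_prodMk_left (x := (t, p)))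

lemma integrableOn_duhamel {n : ℕ} {G : ℝ → En n × En n → ℝ} {B : ℝ}
    (hG : Measurable (Function.uncurry G)) (hG0 : ∀ s p, 0 ≤ G s p) (hGB : ∀ s p, G s p ≤ B)
    (t : ℝ) (p : En n × En n) :
    IntegrableOn (fun s => Real.exp (s - t) * G s (freeFlow (t - s) p)) (Set.Ioc 0 t) := by
  refine Measure.integrableOn_of_bounded (M := B) measure_Ioc_lt_top.ne
    (measurable_duhamel_integrand_right hG t p).aestronglyMeasurable
    ((ae_restrict_iff' measurableSet_Ioc).2 (ae_of_all _ fun s hs => ?_))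
  rw [Real.norm_of_nonneg (mul_nonneg (Real.exp_nonneg _) (hG0 _ _))]
  have h1 : Real.exp (s - t) ≤ 1 := Real.exp_le_one_iff.2 (by linarith [hs.2])
  calc _ ≤ 1 * G s (freeFlow (t - s) p) := mul_le_mul_of_nonneg_right h1 (hG0 _ _)
    _ ≤ B := by rw [one_mul]; exact hGB _ _

lemma ofReal_duhamel {n : ℕ} {a : En n × En n → ℝ} {G : ℝ → En n × En n → ℝ} {B : ℝ}
    (ha : ∀ p, 0 ≤ a p) (hG : Measurable (Function.uncurry G)) (hG0 : ∀ s p, 0 ≤ G s p)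
    (hGB : ∀ s p, G s p ≤ B) (t : ℝ) (p : En n × En n) :
    ENNReal.ofReal (duhamel a G t p) =
      ENNReal.ofReal (Real.exp (-t)) * ENNReal.ofReal (a (freeFlow t p)) +
      ∫⁻ s in Set.Ioc 0 t,
        ENNReal.ofReal (Real.exp (s - t)) * ENNReal.ofReal (G s (freeFlow (t - s) p)) := by
  have h0 : ∀ s, 0 ≤ Real.exp (s - t) * G s (freeFlow (t - s) p) := fun s =>
    mul_nonneg (Real.exp_nonneg _) (hG0 _ _)
  unfold duhamel
  rw [ENNReal.ofReal_add (mul_nonneg (Real.exp_nonneg _) (ha _)) (integral_nonneg h0),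
    ofReal_integral_eq_lintegral_ofReal (integrableOn_duhamel hG hG0 hGB t p) (ae_of_all _ h0)]
  simp_rw [ENNReal.ofReal_mul (Real.exp_nonneg _)]

lemma enorm_duhamel_sub_le {n : ℕ} {a : En n × En n → ℝ} {G₁ G₂ : ℝ → En n × En n → ℝ} {B : ℝ}
    (hG₁ : Measurable (Function.uncurry G₁)) (hG₁0 : ∀ s p, 0 ≤ G₁ s p) (hG₁B : ∀ s p, G₁ s p ≤ B)
    (hG₂ : Measurable (Function.uncurry G₂)) (hG₂0 : ∀ s p, 0 ≤ G₂ s p) (hG₂B : ∀ s p, G₂ s p ≤ B)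
    (t : ℝ) (p : En n × En n) :
    ‖duhamel a G₁ t p - duhamel a G₂ t p‖ₑ ≤
      ∫⁻ s in Set.Ioc 0 t, ENNReal.ofReal (Real.exp (s - t)) *
        ‖G₁ s (freeFlow (t - s) p) - G₂ s (freeFlow (t - s) p)‖ₑ := by
  unfold duhamel
  rw [add_sub_add_left_eq_sub, ← integral_sub (integrableOn_duhamel hG₁ hG₁0 hG₁B t p)
    (integrableOn_duhamel hG₂ hG₂0 hG₂B t p)]
  refine (enorm_integral_le_lintegral_enorm _).trans (le_of_eq (lintegral_congr fun s => ?_))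
  rw [← mul_sub, enorm_mul, Real.enorm_of_nonneg (Real.exp_nonneg _)]

/-! ### The fixed point -/

/-- The measure `e^{-lt} (1 + |v|) dt dx dv` on `(0, ∞) × ℝⁿ × ℝⁿ`. -/
def phaseMeasure (n : ℕ) (l : ℝ) : Measure (ℝ × (En n × En n)) :=
  ((volume.restrict (Set.Ioi (0 : ℝ))).prod volume).withDensity fun q =>
    ENNReal.ofReal (Real.exp (-l * q.1)) * ENNReal.ofReal (1 + ‖q.2.2‖)

lemma lintegral_phaseMeasure {n : ℕ} (l : ℝ) {h : ℝ × (En n × En n) → ENNReal}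
    (hh : Measurable h) :
    ∫⁻ q, h q ∂(phaseMeasure n l) = ∫⁻ t in Set.Ioi (0 : ℝ), ENNReal.ofReal (Real.exp (-l * t)) *
      ∫⁻ p : En n × En n, ENNReal.ofReal (1 + ‖p.2‖) * h (t, p) := by
  have hw : Measurable fun q : ℝ × (En n × En n) =>
    ENNReal.ofReal (Real.exp (-l * q.1)) * ENNReal.ofReal (1 + ‖q.2.2‖) := by fun_prop
  unfold phaseMeasure
  rw [lintegral_withDensity_eq_lintegral_mul _ hw hh, lintegral_prod _ (hw.mul hh).aemeasurable]
  refine lintegral_congr fun t => ?_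
  simp only [Pi.mul_apply, mul_assoc]
  exact lintegral_const_mul _ ((by fun_prop : Measurable fun p : En n × En n =>
    ENNReal.ofReal (1 + ‖p.2‖)).mul (hh.comp measurable_prodMk_left))

lemma ae_phaseMeasure_iff {n : ℕ} (l : ℝ) {P : ℝ × (En n × En n) → Prop} :
    (∀ᵐ q ∂(phaseMeasure n l), P q) ↔
      ∀ᵐ q ∂((volume.restrict (Set.Ioi (0 : ℝ))).prod (volume : Measure (En n × En n))), P q := by
  unfold phaseMeasure
  rw [ae_withDensity_iff (by fun_prop)]
  refine Filter.eventually_congr (ae_of_all _ fun q => ⟨fun h => h ?_, fun h _ => h⟩)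
  exact mul_ne_zero (ENNReal.ofReal_pos.2 (Real.exp_pos _)).ne'
    (ENNReal.ofReal_pos.2 (by positivity)).ne'

lemma lintegral_discount {l : ℝ} (hl : 0 ≤ l) {N : ℝ → ENNReal} (hN : Measurable N) :
    ∫⁻ t in Set.Ioi (0 : ℝ), ENNReal.ofReal (Real.exp (-l * t)) *
        ∫⁻ s in Set.Ioc 0 t, ENNReal.ofReal (Real.exp (s - t)) * N s =
      ENNReal.ofReal (1 / (l + 1)) *
        ∫⁻ s in Set.Ioi (0 : ℝ), ENNReal.ofReal (Real.exp (-l * s)) * N s := by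
  have hm : Measurable fun q : ℝ × ℝ => ENNReal.ofReal (Real.exp (-l * q.1)) *
      ((Set.Iic q.1).indicator
        (fun s => ENNReal.ofReal (Real.exp (s - q.1)) * N s) q.2) := by
    refine Measurable.mul (by fun_prop) ?_
    exact (Measurable.mul (by fun_prop) (hN.comp measurable_snd)).indicator
      (measurableSet_le measurable_snd measurable_fst)
  calc _ = ∫⁻ t in Set.Ioi (0 : ℝ), ∫⁻ s in Set.Ioi (0 : ℝ),
        ENNReal.ofReal (Real.exp (-l * t)) * ((Set.Iic t).indicator
        (fun s => ENNReal.ofReal (Real.exp (s - t)) * N s) s) := by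
        refine lintegral_congr fun t => ?_
        rw [lintegral_const_mul' _ _ ENNReal.ofReal_ne_top, lintegral_indicator measurableSet_Iic,
          Measure.restrict_restrict measurableSet_Iic, Set.Iic_inter_Ioi]
    _ = ∫⁻ s in Set.Ioi (0 : ℝ), ∫⁻ t in Set.Ioi (0 : ℝ),
        ENNReal.ofReal (Real.exp (-l * t)) * ((Set.Iic t).indicator
        (fun s => ENNReal.ofReal (Real.exp (s - t)) * N s) s) :=
        lintegral_lintegral_swap hm.aemeasurable
    _ = ∫⁻ s in Set.Ioi (0 : ℝ),
        ENNReal.ofReal (1 / (l + 1)) * (ENNReal.ofReal (Real.exp (-l * s)) * N s) := by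
        refine setLIntegral_congr_fun measurableSet_Ioi fun s hs => ?_
        have h1 : ∀ t, ENNReal.ofReal (Real.exp (-l * t)) * ((Set.Iic t).indicator
            (fun s => ENNReal.ofReal (Real.exp (s - t)) * N s) s) =
            (Set.Ici s).indicator
              (fun t => ENNReal.ofReal (Real.exp (-(l + 1) * t)) *
                (ENNReal.ofReal (Real.exp s) * N s)) t := by
          intro t
          by_cases h : s ≤ t
          · rw [Set.indicator_of_mem (show s ∈ Set.Iic t from h),
              Set.indicator_of_mem (show t ∈ Set.Ici s from h), ← mul_assoc, ← mul_assoc,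
              ← ENNReal.ofReal_mul (Real.exp_nonneg _), ← ENNReal.ofReal_mul (Real.exp_nonneg _),
              ← Real.exp_add, ← Real.exp_add]
            ring_nf
          · rw [Set.indicator_of_notMem (show s ∉ Set.Iic t from h),
              Set.indicator_of_notMem (show t ∉ Set.Ici s from h), mul_zero]
        simp_rw [h1]
        have hneg : -(l + 1) < 0 := by linarith
        rw [lintegral_indicator measurableSet_Ici, Measure.restrict_restrict measurableSet_Ici,
          Set.inter_eq_left.2 (Set.Ici_subset_Ioi.2 hs),
          lintegral_mul_const _ (by fun_prop), setLIntegral_congr Ioi_ae_eq_Ici.symm,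
          ← ofReal_integral_eq_lintegral_ofReal (integrableOn_exp_mul_Ioi hneg s)
            (ae_of_all _ fun _ => Real.exp_nonneg _), integral_exp_mul_Ioi hneg, ← mul_assoc,
          ← mul_assoc, ← ENNReal.ofReal_mul' (Real.exp_nonneg _),
          ← ENNReal.ofReal_mul' (Real.exp_nonneg _)]
        congr 2
        have : 0 < l + 1 := by linarith
        rw [neg_div_neg_eq, div_mul_eq_mul_div, ← Real.exp_add, one_div_mul_eq_div]
        ring_nf
    _ = _ := lintegral_const_mul _ (Measurable.mul (by fun_prop) hN)

lemma gain_nonneg {n : ℕ} {γ ε : ℝ} (hγ1 : 1 < γ) (hd : 0 < dof n γ)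
    (g : ℝ → En n × En n → ℝ) (s : ℝ) (p : En n × En n) : 0 ≤ gain n γ ε g s p :=
  MaxwEps_nonneg hγ1 hd _ _

lemma gain_le {n : ℕ} {γ ε : ℝ} (hγ1 : 1 < γ) (hd : 0 < dof n γ) (hε : 0 < ε)
    {g : ℝ → En n × En n → ℝ} (hg : ∀ t p, 0 ≤ g t p) (s : ℝ) (p : En n × En n) :
    gain n γ ε g s p ≤ cc2 n γ * (rad γ ε⁻¹ ^ 2) ^ (dof n γ / 2) :=
  MaxwEps_le hγ1 hd hε (fun _ => hg _ _) _

lemma MaxwEps_congr_ae {n : ℕ} {γ ε : ℝ} {g₁ g₂ : En n → ℝ} (h : g₁ =ᵐ[volume] g₂) :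
    MaxwEps n γ ε g₁ = MaxwEps n γ ε g₂ := by
  have h1 : densF n g₁ = densF n g₂ := integral_congr_ae h
  have h2 : bulkF n g₁ = bulkF n g₂ := by
    have : ∫ v, g₁ v • v = ∫ v, g₂ v • v := integral_congr_ae (h.mono fun v hv => by simp only [hv])
    unfold bulkF
    rw [h1, this]
  funext v
  unfold MaxwEps densEps bulkEps
  rw [h1, h2]

lemma measurable_slice {α β : Type*} [MeasurableSpace α] [MeasurableSpace β] {G : ℝ → α → β}
    (hG : Measurable (Function.uncurry G)) (s : ℝ) : Measurable (G s) :=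
  hG.comp measurable_prodMk_left

lemma measurable_enorm_sub {n : ℕ} {G₁ G₂ : ℝ → En n × En n → ℝ}
    (hG₁ : Measurable (Function.uncurry G₁)) (hG₂ : Measurable (Function.uncurry G₂)) :
    Measurable (Function.uncurry fun s p => ‖G₁ s p - G₂ s p‖ₑ) :=
  (hG₁.sub hG₂).enorm

lemma lintegral_enorm_duhamel_sub_le {n : ℕ} {a : En n × En n → ℝ}
    {G₁ G₂ : ℝ → En n × En n → ℝ} {B : ℝ}
    (hG₁ : Measurable (Function.uncurry G₁)) (hG₁0 : ∀ s p, 0 ≤ G₁ s p) (hG₁B : ∀ s p, G₁ s p ≤ B)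
    (hG₂ : Measurable (Function.uncurry G₂)) (hG₂0 : ∀ s p, 0 ≤ G₂ s p) (hG₂B : ∀ s p, G₂ s p ≤ B)
    {ψ : En n → ENNReal} (hψ : Measurable ψ) (t : ℝ) :
    ∫⁻ p, ψ p.2 * ‖duhamel a G₁ t p - duhamel a G₂ t p‖ₑ ≤
      ∫⁻ s in Set.Ioc 0 t, ENNReal.ofReal (Real.exp (s - t)) *
        ∫⁻ p, ψ p.2 * ‖G₁ s p - G₂ s p‖ₑ := by
  refine (lintegral_mono fun p => mul_le_mul_right
    (enorm_duhamel_sub_le hG₁ hG₁0 hG₁B hG₂ hG₂0 hG₂B t p) (ψ p.2)).trans (le_of_eq ?_)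
  exact lintegral_mul_lintegral_freeFlow (volume.restrict (Set.Ioc 0 t)) t
    (ψ := fun p => ψ p.2) (hψ.comp measurable_snd)
    (c := fun s => ENNReal.ofReal (Real.exp (s - t))) (by fun_prop) (measurable_enorm_sub hG₁ hG₂)

lemma measurable_lintegral_one_add_norm_mul {n : ℕ} {h : En n × En n → ℝ} (hh : Measurable h) :
    Measurable fun y => ∫⁻ v, ENNReal.ofReal (1 + ‖v‖) * ‖h (y, v)‖ₑ :=
  ((by fun_prop : Measurable fun p : En n × En n => ENNReal.ofReal (1 + ‖p.2‖)).mul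
    hh.enorm).lintegral_prod_right'

lemma lintegral_one_add_norm_snd_mul {n : ℕ} {h : En n × En n → ℝ} (hh : Measurable h) :
    ∫⁻ p, ENNReal.ofReal (1 + ‖p.2‖) * ‖h p‖ₑ =
      ∫⁻ y, ∫⁻ v, ENNReal.ofReal (1 + ‖v‖) * ‖h (y, v)‖ₑ :=
  lintegral_prod _ ((by fun_prop : Measurable fun p : En n × En n =>
    ENNReal.ofReal (1 + ‖p.2‖)).mul hh.enorm).aemeasurable

lemma lintegral_gain_sub_le {n : ℕ} {γ ε K : ℝ}
    (hK : ∀ g₁ g₂ : En n → ℝ, (∀ v, 0 ≤ g₁ v) → (∀ v, 0 ≤ g₂ v) →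
      Measurable g₁ → Measurable g₂ →
      ∫⁻ v, ENNReal.ofReal (1 + ‖v‖) * ‖g₁ v‖ₑ ≠ ⊤ → ∫⁻ v, ENNReal.ofReal (1 + ‖v‖) * ‖g₂ v‖ₑ ≠ ⊤ →
      ∫⁻ v, ENNReal.ofReal (1 + ‖v‖) * ‖MaxwEps n γ ε g₁ v - MaxwEps n γ ε g₂ v‖ₑ ≤
        ENNReal.ofReal K * ∫⁻ v, ENNReal.ofReal (1 + ‖v‖) * ‖g₁ v - g₂ v‖ₑ)
    {g₁ g₂ : ℝ → En n × En n → ℝ}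
    (hg₁ : Measurable (Function.uncurry g₁)) (hg₁0 : ∀ t p, 0 ≤ g₁ t p)
    (hg₂ : Measurable (Function.uncurry g₂)) (hg₂0 : ∀ t p, 0 ≤ g₂ t p) {s : ℝ}
    (h₁ : ∫⁻ p, ENNReal.ofReal (1 + ‖p.2‖) * ‖g₁ s p‖ₑ ≠ ⊤)
    (h₂ : ∫⁻ p, ENNReal.ofReal (1 + ‖p.2‖) * ‖g₂ s p‖ₑ ≠ ⊤) :
    ∫⁻ p, ENNReal.ofReal (1 + ‖p.2‖) * ‖gain n γ ε g₁ s p - gain n γ ε g₂ s p‖ₑ ≤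
      ENNReal.ofReal K * ∫⁻ p, ENNReal.ofReal (1 + ‖p.2‖) * ‖g₁ s p - g₂ s p‖ₑ := by
  have hm₁ := measurable_slice hg₁ s
  have hm₂ := measurable_slice hg₂ s
  have hmM : Measurable fun p => gain n γ ε g₁ s p - gain n γ ε g₂ s p :=
    (measurable_slice (measurable_gain hg₁) s).sub (measurable_slice (measurable_gain hg₂) s)
  rw [lintegral_one_add_norm_snd_mul hm₁] at h₁
  rw [lintegral_one_add_norm_snd_mul hm₂] at h₂
  have hm : Measurable fun p => g₁ s p - g₂ s p := hm₁.sub hm₂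
  rw [lintegral_one_add_norm_snd_mul hmM, lintegral_one_add_norm_snd_mul hm,
    ← lintegral_const_mul' _ _ ENNReal.ofReal_ne_top]
  refine lintegral_mono_ae ?_
  filter_upwards [ae_lt_top (measurable_lintegral_one_add_norm_mul hm₁) h₁,
    ae_lt_top (measurable_lintegral_one_add_norm_mul hm₂) h₂] with y hy₁ hy₂
  exact hK (fun v => g₁ s (y, v)) (fun v => g₂ s (y, v)) (fun _ => hg₁0 _ _)
    (fun _ => hg₂0 _ _) (hm₁.comp measurable_prodMk_left) (hm₂.comp measurable_prodMk_left)
    hy₁.ne hy₂.ne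

lemma ae_lintegral_ne_top_of_phaseMeasure {n : ℕ} {l : ℝ} {g : ℝ → En n × En n → ℝ}
    (hg : Measurable (Function.uncurry g))
    (h : ∫⁻ q, ‖g q.1 q.2‖ₑ ∂(phaseMeasure n l) ≠ ⊤) :
    ∀ᵐ t ∂(volume.restrict (Set.Ioi (0 : ℝ))),
      ∫⁻ p, ENNReal.ofReal (1 + ‖p.2‖) * ‖g t p‖ₑ ≠ ⊤ := by
  have hm : Measurable fun q : ℝ × (En n × En n) => ‖g q.1 q.2‖ₑ := hg.enorm
  have hw : Measurable fun q : ℝ × (En n × En n) => ENNReal.ofReal (1 + ‖q.2.2‖) := by fun_prop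
  rw [lintegral_phaseMeasure l hm] at h
  have hN : Measurable fun t => ENNReal.ofReal (Real.exp (-l * t)) *
      ∫⁻ p : En n × En n, ENNReal.ofReal (1 + ‖p.2‖) * ‖g t p‖ₑ :=
    Measurable.mul (by fun_prop) (hw.mul hm).lintegral_prod_right'
  refine (ae_lt_top hN h).mono fun t ht htop => ?_
  rw [htop, ENNReal.mul_top (ENNReal.ofReal_pos.2 (Real.exp_pos _)).ne'] at ht
  exact ht.ne rfl

lemma lintegral_duhamel_gain_sub_le {n : ℕ} {γ ε K l : ℝ} (hγ1 : 1 < γ) (hd : 0 < dof n γ)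
    (hε : 0 < ε) (hl : 0 ≤ l)
    (hK : ∀ g₁ g₂ : En n → ℝ, (∀ v, 0 ≤ g₁ v) → (∀ v, 0 ≤ g₂ v) →
      Measurable g₁ → Measurable g₂ →
      ∫⁻ v, ENNReal.ofReal (1 + ‖v‖) * ‖g₁ v‖ₑ ≠ ⊤ → ∫⁻ v, ENNReal.ofReal (1 + ‖v‖) * ‖g₂ v‖ₑ ≠ ⊤ →
      ∫⁻ v, ENNReal.ofReal (1 + ‖v‖) * ‖MaxwEps n γ ε g₁ v - MaxwEps n γ ε g₂ v‖ₑ ≤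
        ENNReal.ofReal K * ∫⁻ v, ENNReal.ofReal (1 + ‖v‖) * ‖g₁ v - g₂ v‖ₑ)
    {a : En n × En n → ℝ} (ha : Measurable a) {g₁ g₂ : ℝ → En n × En n → ℝ}
    (hg₁ : Measurable (Function.uncurry g₁)) (hg₁0 : ∀ t p, 0 ≤ g₁ t p)
    (hg₂ : Measurable (Function.uncurry g₂)) (hg₂0 : ∀ t p, 0 ≤ g₂ t p)
    (h₁ : ∫⁻ q, ‖g₁ q.1 q.2‖ₑ ∂(phaseMeasure n l) ≠ ⊤)
    (h₂ : ∫⁻ q, ‖g₂ q.1 q.2‖ₑ ∂(phaseMeasure n l) ≠ ⊤) :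
    ∫⁻ q, ‖duhamel a (gain n γ ε g₁) q.1 q.2 - duhamel a (gain n γ ε g₂) q.1 q.2‖ₑ
        ∂(phaseMeasure n l) ≤
      ENNReal.ofReal (1 / (l + 1)) * (ENNReal.ofReal K *
        ∫⁻ q, ‖g₁ q.1 q.2 - g₂ q.1 q.2‖ₑ ∂(phaseMeasure n l)) := by
  have hG₁ := measurable_gain (γ := γ) (ε := ε) hg₁
  have hG₂ := measurable_gain (γ := γ) (ε := ε) hg₂
  have hw : Measurable fun q : ℝ × (En n × En n) => ENNReal.ofReal (1 + ‖q.2.2‖) := by fun_prop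
  have hN : Measurable fun s => ∫⁻ p : En n × En n, ENNReal.ofReal (1 + ‖p.2‖) *
      ‖gain n γ ε g₁ s p - gain n γ ε g₂ s p‖ₑ :=
    (hw.mul (measurable_enorm_sub hG₁ hG₂)).lintegral_prod_right'
  rw [lintegral_phaseMeasure l (h := fun q => ‖duhamel a (gain n γ ε g₁) q.1 q.2 -
      duhamel a (gain n γ ε g₂) q.1 q.2‖ₑ)
      (measurable_enorm_sub (measurable_duhamel ha hG₁) (measurable_duhamel ha hG₂)),
    lintegral_phaseMeasure l (h := fun q => ‖g₁ q.1 q.2 - g₂ q.1 q.2‖ₑ)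
      (measurable_enorm_sub hg₁ hg₂)]
  calc _ ≤ _ := lintegral_mono fun t => mul_le_mul_right (lintegral_enorm_duhamel_sub_le
          hG₁ (gain_nonneg hγ1 hd g₁) (gain_le hγ1 hd hε hg₁0)
          hG₂ (gain_nonneg hγ1 hd g₂) (gain_le hγ1 hd hε hg₂0)
          (ψ := fun v => ENNReal.ofReal (1 + ‖v‖)) (by fun_prop) t) _
    _ = _ := lintegral_discount hl hN
    _ ≤ _ := by
      refine mul_le_mul_right ?_ _
      rw [← lintegral_const_mul' _ _ ENNReal.ofReal_ne_top]
      refine lintegral_mono_ae ?_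
      filter_upwards [ae_lintegral_ne_top_of_phaseMeasure hg₁ h₁,
        ae_lintegral_ne_top_of_phaseMeasure hg₂ h₂] with s hs₁ hs₂
      rw [mul_left_comm]
      exact mul_le_mul_right (lintegral_gain_sub_le hK hg₁ hg₁0 hg₂ hg₂0 hs₁ hs₂) _

lemma integrable_duhamel_zero {n : ℕ} {l : ℝ} (hl : 0 ≤ l) {a : En n × En n → ℝ}
    (ha : Measurable a) (hai : ∫⁻ p, ENNReal.ofReal (1 + ‖p.2‖) * ‖a p‖ₑ ≠ ⊤) :
    ∫⁻ q, ‖duhamel a (fun _ _ => 0) q.1 q.2‖ₑ ∂(phaseMeasure n l) ≠ ⊤ := by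
  have hm : Measurable fun q : ℝ × (En n × En n) => ‖duhamel a (fun _ _ => 0) q.1 q.2‖ₑ :=
    (measurable_duhamel ha (G := fun _ _ => 0) measurable_const).enorm
  have h1 : ∀ t, ∫⁻ p : En n × En n, ENNReal.ofReal (1 + ‖p.2‖) *
      ‖duhamel a (fun _ _ => 0) t p‖ₑ =
      ENNReal.ofReal (Real.exp (-t)) * ∫⁻ p, ENNReal.ofReal (1 + ‖p.2‖) * ‖a p‖ₑ := by
    intro t
    have h2 := lintegral_mul_comp_freeFlow t
      (ψ := fun p : En n × En n => ENNReal.ofReal (1 + ‖p.2‖)) (by fun_prop) ha.enorm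
    simp only [freeFlow] at h2
    rw [← h2, ← lintegral_const_mul' _ _ ENNReal.ofReal_ne_top]
    refine lintegral_congr fun p => ?_
    simp only [duhamel, mul_zero, integral_zero, add_zero, enorm_mul,
      Real.enorm_of_nonneg (Real.exp_nonneg _), freeFlow]
    rw [mul_left_comm]
  rw [lintegral_phaseMeasure l hm]
  simp only [h1]
  simp_rw [← mul_assoc]
  rw [lintegral_mul_const' _ _ hai]
  refine ENNReal.mul_ne_top ?_ hai
  have hneg : -(l + 1) < 0 := by linarith
  have h3 : ∀ t : ℝ, ENNReal.ofReal (Real.exp (-l * t)) * ENNReal.ofReal (Real.exp (-t)) =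
      ENNReal.ofReal (Real.exp (-(l + 1) * t)) := by
    intro t
    rw [← ENNReal.ofReal_mul (Real.exp_nonneg _), ← Real.exp_add]
    ring_nf
  simp_rw [h3]
  rw [← ofReal_integral_eq_lintegral_ofReal (integrableOn_exp_mul_Ioi hneg 0)
    (ae_of_all _ fun _ => Real.exp_nonneg _)]
  exact ENNReal.ofReal_ne_top

lemma gain_zero {n : ℕ} {γ ε : ℝ} (hγ1 : 1 < γ) (hd : 0 < dof n γ) :
    gain n γ ε (fun _ _ => 0) = fun _ _ => 0 := by
  funext s p
  exact MaxwEps_of_densF_eq_zero hγ1 hd (by simp [densF]) _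

lemma exists_fixedPoint {n : ℕ} {γ ε : ℝ} (hn : 1 ≤ n) (hγ1 : 1 < γ) (hd : 0 < dof n γ)
    (hε : 0 < ε) {a : En n × En n → ℝ} (ha : Measurable a) (ha0 : ∀ p, 0 ≤ a p)
    (hai : ∫⁻ p, ENNReal.ofReal (1 + ‖p.2‖) * ‖a p‖ₑ ≠ ⊤) :
    ∃ l : ℝ, 0 ≤ l ∧ ∃ g : ℝ → En n × En n → ℝ, Measurable (Function.uncurry g) ∧
      (∀ t p, 0 ≤ g t p) ∧ ∫⁻ q, ‖g q.1 q.2‖ₑ ∂(phaseMeasure n l) ≠ ⊤ ∧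
      ∀ᵐ q ∂(phaseMeasure n l), g q.1 q.2 = duhamel a (gain n γ ε g) q.1 q.2 := by
  obtain ⟨K, hK0, hK⟩ := exists_lintegral_MaxwEps_sub_le (ε := ε) hn hγ1 hd hε
  set l := 2 * K with hl_def
  have hl : 0 ≤ l := by positivity
  set μ := phaseMeasure n l
  let P : Lp ℝ 1 μ → ℝ → En n × En n → ℝ := fun f t p => max (f (t, p)) 0
  have hPm : ∀ f, Measurable (Function.uncurry (P f)) := fun f =>
    (Lp.stronglyMeasurable f).measurable.max measurable_const
  have hP0 : ∀ f t p, 0 ≤ P f t p := fun f t p => le_max_right _ _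
  have hPi : ∀ f, ∫⁻ q, ‖P f q.1 q.2‖ₑ ∂μ ≠ ⊤ := by
    intro f
    refine ne_top_of_le_ne_top (L1.integrable_coeFn f).2.ne (lintegral_mono fun q => ?_)
    rw [enorm_le_iff_norm_le, Real.norm_of_nonneg (hP0 f _ _)]
    exact max_le (le_abs_self _) (abs_nonneg _)
  have hPd : ∀ f h, ∫⁻ q, ‖P f q.1 q.2 - P h q.1 q.2‖ₑ ∂μ ≤ edist f h := by
    intro f h
    rw [L1.edist_def]
    refine lintegral_mono fun q => ?_
    rw [edist_eq_enorm_sub, enorm_le_iff_norm_le]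
    exact abs_max_sub_max_le_abs _ _ _
  have hzero : ∫⁻ q : ℝ × (En n × En n), ‖(0 : ℝ)‖ₑ ∂μ ≠ ⊤ := by simp
  have hc : ∀ g₁ g₂ : ℝ → En n × En n → ℝ, Measurable (Function.uncurry g₁) →
      (∀ t p, 0 ≤ g₁ t p) → ∫⁻ q, ‖g₁ q.1 q.2‖ₑ ∂μ ≠ ⊤ → Measurable (Function.uncurry g₂) →
      (∀ t p, 0 ≤ g₂ t p) → ∫⁻ q, ‖g₂ q.1 q.2‖ₑ ∂μ ≠ ⊤ →
      ∫⁻ q, ‖duhamel a (gain n γ ε g₁) q.1 q.2 - duhamel a (gain n γ ε g₂) q.1 q.2‖ₑ ∂μ ≤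
        ENNReal.ofReal (1 / 2) * ∫⁻ q, ‖g₁ q.1 q.2 - g₂ q.1 q.2‖ₑ ∂μ := by
    intro g₁ g₂ h₁ h₁' h₁'' h₂ h₂' h₂''
    refine (lintegral_duhamel_gain_sub_le hγ1 hd hε hl hK ha h₁ h₁' h₂ h₂' h₁'' h₂'').trans ?_
    rw [← mul_assoc, ← ENNReal.ofReal_mul (by positivity)]
    refine mul_le_mul_left (ENNReal.ofReal_le_ofReal ?_) _
    rw [hl_def, one_div_mul_eq_div, div_le_div_iff₀ (by positivity) (by positivity)]
    linarith
  have hDm : ∀ f, Measurable fun q : ℝ × (En n × En n) => duhamel a (gain n γ ε (P f)) q.1 q.2 :=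
    fun f => measurable_duhamel ha (measurable_gain (hPm f))
  have hD : ∀ f, Integrable (fun q : ℝ × (En n × En n) =>
      duhamel a (gain n γ ε (P f)) q.1 q.2) μ := by
    intro f
    refine ⟨(hDm f).aestronglyMeasurable, ?_⟩
    have h1 := hc (P f) (fun _ _ => 0) (hPm f) (hP0 f) (hPi f) measurable_const
      (fun _ _ => le_rfl) hzero
    have h2 := integrable_duhamel_zero hl ha hai
    have hm0 : Measurable fun q : ℝ × (En n × En n) => ‖duhamel a (fun _ _ => 0) q.1 q.2‖ₑ :=
      (measurable_duhamel ha (G := fun _ _ => 0) measurable_const).enorm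
    rw [gain_zero hγ1 hd] at h1
    simp only [sub_zero] at h1
    refine lt_of_le_of_lt (lintegral_mono (g := fun q =>
      ‖duhamel a (gain n γ ε (P f)) q.1 q.2 - duhamel a (fun _ _ => 0) q.1 q.2‖ₑ +
        ‖duhamel a (fun _ _ => 0) q.1 q.2‖ₑ) fun q => ?_) ?_
    · simpa using enorm_add_le (duhamel a (gain n γ ε (P f)) q.1 q.2 -
        duhamel a (fun _ _ => 0) q.1 q.2) (duhamel a (fun _ _ => 0) q.1 q.2)
    · rw [lintegral_add_right _ hm0]
      exact ENNReal.add_lt_top.2 ⟨lt_of_le_of_lt h1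
        (ENNReal.mul_lt_top ENNReal.ofReal_lt_top (hPi f).lt_top), h2.lt_top⟩
  let T : Lp ℝ 1 μ → Lp ℝ 1 μ := fun f => (hD f).toL1 _
  have hT : ContractingWith (1 / 2) T := by
    refine ⟨by rw [← NNReal.coe_lt_coe]; norm_num, fun f h => ?_⟩
    rw [Integrable.edist_toL1_toL1]
    simp only [edist_eq_enorm_sub]
    refine (hc _ _ (hPm f) (hP0 f) (hPi f) (hPm h) (hP0 h) (hPi h)).trans ?_
    rw [← edist_eq_enorm_sub f h]
    refine mul_le_mul' (le_of_eq ?_) (hPd f h)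
    rw [ENNReal.ofReal, Real.toNNReal_div zero_le_one]
    simp
  set f := hT.fixedPoint with hf
  have hfix : T f = f := hT.fixedPoint_isFixedPt
  refine ⟨l, hl, P f, hPm f, hP0 f, hPi f, ?_⟩
  have h1 : (T f : ℝ × (En n × En n) → ℝ) =ᵐ[μ] _ := (hD f).coeFn_toL1
  rw [hfix] at h1
  filter_upwards [h1] with q hq
  show max (f q) 0 = _
  rw [hq, max_eq_left (duhamel_nonneg ha0 (gain_nonneg hγ1 hd _) _ _)]

lemma lintegral_Ioc_ne_top_of_phaseMeasure {n : ℕ} {l : ℝ} (hl : 0 ≤ l)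
    {g : ℝ → En n × En n → ℝ} (hg : Measurable (Function.uncurry g)) (hg0 : ∀ t p, 0 ≤ g t p)
    (h : ∫⁻ q, ‖g q.1 q.2‖ₑ ∂(phaseMeasure n l) ≠ ⊤) (T : ℝ) :
    ∫⁻ s in Set.Ioc 0 T, ∫⁻ p, ENNReal.ofReal (g s p) ≠ ⊤ := by
  have hm : Measurable fun q : ℝ × (En n × En n) => ‖g q.1 q.2‖ₑ := hg.enorm
  rw [lintegral_phaseMeasure l hm] at h
  refine ne_top_of_le_ne_top (ENNReal.mul_ne_top (ENNReal.ofReal_ne_top (r := Real.exp (l * T))) h)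
    ?_
  rw [← lintegral_const_mul' _ _ ENNReal.ofReal_ne_top]
  refine (setLIntegral_mono' measurableSet_Ioc fun s hs => ?_).trans
    (lintegral_mono_set Set.Ioc_subset_Ioi_self)
  rw [← mul_assoc, ← ENNReal.ofReal_mul (Real.exp_nonneg _), ← Real.exp_add]
  have h1 : (1 : ENNReal) ≤ ENNReal.ofReal (Real.exp (l * T + -l * s)) := by
    rw [← ENNReal.ofReal_one]
    refine ENNReal.ofReal_le_ofReal (Real.one_le_exp ?_)
    nlinarith [hs.2]
  calc _ ≤ 1 * ∫⁻ p : En n × En n, ENNReal.ofReal (1 + ‖p.2‖) * ‖g s p‖ₑ := by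
        rw [one_mul]
        refine lintegral_mono fun p => ?_
        rw [← ofReal_norm, ← ENNReal.ofReal_mul (by positivity)]
        refine ENNReal.ofReal_le_ofReal ?_
        rw [Real.norm_of_nonneg (hg0 s p)]
        nlinarith [mul_nonneg (norm_nonneg p.2) (hg0 s p)]
    _ ≤ _ := mul_le_mul_left h1 _

lemma lintegral_gain_sub_eq_zero {n : ℕ} {γ ε : ℝ} {g₁ g₂ : En n × En n → ℝ}
    (hg : g₁ =ᵐ[volume] g₂) :
    ∫⁻ p : En n × En n, ‖MaxwEps n γ ε (fun w => g₁ (p.1, w)) p.2 -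
      MaxwEps n γ ε (fun w => g₂ (p.1, w)) p.2‖ₑ = 0 := by
  have h1 : ∀ᵐ y : En n, ∀ᵐ v : En n, g₁ (y, v) = g₂ (y, v) := Measure.ae_ae_of_ae_prod hg
  have h2 : ∀ᵐ y : En n, MaxwEps n γ ε (fun w => g₁ (y, w)) = MaxwEps n γ ε (fun w => g₂ (y, w)) :=
    h1.mono fun y hy => MaxwEps_congr_ae hy
  have h3 : ∀ᵐ p : En n × En n,
      MaxwEps n γ ε (fun w => g₁ (p.1, w)) = MaxwEps n γ ε (fun w => g₂ (p.1, w)) :=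
    Measure.quasiMeasurePreserving_fst.ae h2
  rw [lintegral_congr_ae (g := fun _ => 0) (h3.mono fun p hp => by simp only [hp, sub_self,
      enorm_zero]),
    lintegral_zero]

lemma exists_mildSolution {n : ℕ} {γ ε : ℝ} (hn : 1 ≤ n) (hγ1 : 1 < γ) (hd : 0 < dof n γ)
    (hε : 0 < ε) {a : En n × En n → ℝ} (ha : Measurable a) (ha0 : ∀ p, 0 ≤ a p)
    (hai : ∫⁻ p, ENNReal.ofReal (1 + ‖p.2‖) * ‖a p‖ₑ ≠ ⊤) :
    ∃ F : ℝ → En n × En n → ℝ, Measurable (Function.uncurry F) ∧ (∀ t p, 0 ≤ F t p) ∧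
      (∀ t, ∀ᵐ p, F t p = duhamel a (gain n γ ε F) t p) ∧
      ∀ T, ∫⁻ s in Set.Ioc 0 T, ∫⁻ p, ENNReal.ofReal (F s p) ≠ ⊤ := by
  obtain ⟨l, hl, g, hgm, hg0, hgi, hfix⟩ := exists_fixedPoint hn hγ1 hd hε ha ha0 hai
  have hGm := measurable_gain (γ := γ) (ε := ε) hgm
  set F := duhamel a (gain n γ ε g) with hF
  have hFm : Measurable (Function.uncurry F) := measurable_duhamel ha hGm
  have hF0 : ∀ t p, 0 ≤ F t p := duhamel_nonneg ha0 (gain_nonneg hγ1 hd _)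
  have hae : ∀ᵐ s ∂(volume.restrict (Set.Ioi (0 : ℝ))), g s =ᵐ[volume] F s :=
    Measure.ae_ae_of_ae_prod ((ae_phaseMeasure_iff l).1 hfix)
  refine ⟨F, hFm, hF0, fun t => ?_, lintegral_Ioc_ne_top_of_phaseMeasure hl hFm hF0 ?_⟩
  · have hGm' := measurable_gain (γ := γ) (ε := ε) hFm
    have h1 := lintegral_enorm_duhamel_sub_le (a := a) hGm (gain_nonneg hγ1 hd g)
      (gain_le hγ1 hd hε hg0) hGm' (gain_nonneg hγ1 hd F) (gain_le hγ1 hd hε hF0)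
      (ψ := fun _ => 1) measurable_const t
    simp only [one_mul] at h1
    have h2 : ∫⁻ s in Set.Ioc 0 t, ENNReal.ofReal (Real.exp (s - t)) *
        ∫⁻ p, ‖gain n γ ε g s p - gain n γ ε F s p‖ₑ = 0 := by
      have h3 :=
          ae_restrict_of_ae_restrict_of_subset (Set.Ioc_subset_Ioi_self : Set.Ioc 0 t ⊆ _) hae
      rw [lintegral_congr_ae (g := fun _ => 0) (h3.mono fun s hs => ?_), lintegral_zero]
      simp only [gain, lintegral_gain_sub_eq_zero hs, mul_zero]
    rw [h2, nonpos_iff_eq_zero] at h1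
    have hm : Measurable fun p => ‖duhamel a (gain n γ ε g) t p - duhamel a (gain n γ ε F) t p‖ₑ :=
      measurable_slice (measurable_enorm_sub hFm (measurable_duhamel ha hGm')) t
    filter_upwards [(lintegral_eq_zero_iff hm).1 h1] with p hp
    exact sub_eq_zero.1 (enorm_eq_zero.1 hp)
  · rw [lintegral_congr_ae (g := fun q => ‖g q.1 q.2‖ₑ) (hfix.mono fun q hq => by simp only [← hq])]
    exact hgi

/-! ### A priori estimates -/

lemma integral_Ioc_exp_sub {t : ℝ} (ht : 0 ≤ t) :
    ∫ s in Set.Ioc 0 t, Real.exp (s - t) = 1 - Real.exp (-t) := by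
  rw [← intervalIntegral.integral_of_le ht, intervalIntegral.integral_comp_sub_right Real.exp t,
    integral_exp]
  simp

lemma lintegral_Ioc_exp_sub {t : ℝ} (ht : 0 ≤ t) :
    ∫⁻ s in Set.Ioc 0 t, ENNReal.ofReal (Real.exp (s - t)) =
        ENNReal.ofReal (1 - Real.exp (-t)) := by
  rw [← integral_Ioc_exp_sub ht, ofReal_integral_eq_lintegral_ofReal
    ((Continuous.integrableOn_Icc (by fun_prop)).mono_set Set.Ioc_subset_Icc_self)
    (ae_of_all _ fun _ => Real.exp_nonneg _)]

/-- A Grönwall type bound for averaged inequalities. -/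
lemma le_of_le_average {T : ℝ} {a : ℝ → ENNReal} {a₀ B D : ENNReal} (hB : B ≠ ⊤)
    (haB : ∀ t ∈ Set.Icc 0 T, a t ≤ B)
    (ha : ∀ t ∈ Set.Icc 0 T, a t ≤ ENNReal.ofReal (Real.exp (-t)) * a₀ +
      ∫⁻ s in Set.Ioc 0 t, ENNReal.ofReal (Real.exp (s - t)) * (a s + D))
    {t : ℝ} (ht : t ∈ Set.Icc 0 T) : a t ≤ a₀ + ENNReal.ofReal (Real.exp T) * D := by
  have hT : 0 ≤ T := ht.1.trans ht.2
  by_cases hD : D = ⊤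
  · rw [hD, ENNReal.mul_top (ENNReal.ofReal_pos.2 (Real.exp_pos _)).ne', add_top]
    exact le_top
  by_cases ha₀ : a₀ = ⊤
  · rw [ha₀, top_add]; exact le_top
  set S : ENNReal := ⨆ t ∈ Set.Icc 0 T, a t with hS
  have haS : ∀ t ∈ Set.Icc 0 T, a t ≤ S := fun t ht => le_iSup₂ (f := fun t _ => a t) t ht
  have hSB : S ≤ B := iSup₂_le haB
  have hStop : S ≠ ⊤ := ne_top_of_le_ne_top hB hSB
  refine (haS t ht).trans ?_
  rcases le_total S a₀ with h | h
  · exact h.trans le_self_add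
  have key : S ≤ ENNReal.ofReal (Real.exp (-T) * a₀.toReal +
      (1 - Real.exp (-T)) * (S.toReal + D.toReal)) := by
    refine iSup₂_le fun r hr => (ha r hr).trans ?_
    have h1 : ∫⁻ s in Set.Ioc 0 r, ENNReal.ofReal (Real.exp (s - r)) * (a s + D) ≤
        ENNReal.ofReal (1 - Real.exp (-r)) * (S + D) := by
      rw [← lintegral_Ioc_exp_sub hr.1, ← lintegral_mul_const _ (by fun_prop)]
      refine setLIntegral_mono' measurableSet_Ioc fun s hs => ?_
      exact mul_le_mul_right (add_le_add_left (haS s ⟨hs.1.le, hs.2.trans hr.2⟩) _) _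
    refine (add_le_add_right h1 _).trans ?_
    have he : Real.exp (-r) ≤ 1 := Real.exp_le_one_iff.2 (by linarith [hr.1])
    have he' : Real.exp (-T) ≤ Real.exp (-r) := Real.exp_le_exp.2 (by linarith [hr.2])
    rw [← ENNReal.ofReal_toReal ha₀, ← ENNReal.ofReal_toReal hStop, ← ENNReal.ofReal_toReal hD,
      ← ENNReal.ofReal_add ENNReal.toReal_nonneg ENNReal.toReal_nonneg,
      ← ENNReal.ofReal_mul (Real.exp_nonneg _), ← ENNReal.ofReal_mul (by linarith),
      ← ENNReal.ofReal_add (by positivity) (mul_nonneg (by linarith) (by positivity))]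
    refine ENNReal.ofReal_le_ofReal ?_
    simp only [ENNReal.toReal_ofReal ENNReal.toReal_nonneg]
    have h2 : a₀.toReal ≤ S.toReal := ENNReal.toReal_mono hStop h
    have h3 : 0 ≤ D.toReal := ENNReal.toReal_nonneg
    nlinarith
  have heT : Real.exp (-T) ≤ 1 := Real.exp_le_one_iff.2 (by linarith)
  have h3 : 0 ≤ D.toReal := ENNReal.toReal_nonneg
  have key' : S.toReal ≤ Real.exp (-T) * a₀.toReal +
      (1 - Real.exp (-T)) * (S.toReal + D.toReal) := by
    refine ENNReal.toReal_le_of_le_ofReal ?_ key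
    have : 0 ≤ a₀.toReal := ENNReal.toReal_nonneg
    have : 0 ≤ S.toReal := ENNReal.toReal_nonneg
    exact add_nonneg (by positivity) (mul_nonneg (by linarith) (by positivity))
  rw [← ENNReal.ofReal_toReal hStop, ← ENNReal.ofReal_toReal ha₀, ← ENNReal.ofReal_toReal hD,
    ← ENNReal.ofReal_mul (Real.exp_nonneg _),
    ← ENNReal.ofReal_add ENNReal.toReal_nonneg (by positivity)]
  refine ENNReal.ofReal_le_ofReal ?_
  have hE : Real.exp T * Real.exp (-T) = 1 := by rw [← Real.exp_add]; simp
  have hpos := Real.exp_pos T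
  have h4 : Real.exp (-T) * S.toReal ≤ Real.exp (-T) * a₀.toReal + D.toReal := by
    nlinarith [mul_nonneg (Real.exp_nonneg (-T)) h3]
  have h5 := mul_le_mul_of_nonneg_left h4 hpos.le
  rw [mul_add, ← mul_assoc, ← mul_assoc, hE, one_mul, one_mul] at h5
  exact h5

lemma lintegral_mul_duhamel {n : ℕ} {a : En n × En n → ℝ} {G : ℝ → En n × En n → ℝ} {B : ℝ}
    (ham : Measurable a) (ha : ∀ p, 0 ≤ a p) (hG : Measurable (Function.uncurry G))
    (hG0 : ∀ s p, 0 ≤ G s p) (hGB : ∀ s p, G s p ≤ B) {ψ : En n × En n → ENNReal}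
    (hψ : Measurable ψ) (t : ℝ) :
    ∫⁻ p, ψ p * ENNReal.ofReal (duhamel a G t p) =
      ENNReal.ofReal (Real.exp (-t)) * (∫⁻ p, ψ (freeFlow (-t) p) * ENNReal.ofReal (a p)) +
      ∫⁻ s in Set.Ioc 0 t, ENNReal.ofReal (Real.exp (s - t)) *
        ∫⁻ p, ψ (freeFlow (s - t) p) * ENNReal.ofReal (G s p) := by
  have hm : Measurable fun p => ENNReal.ofReal (Real.exp (-t)) *
      (ψ p * ENNReal.ofReal (a (freeFlow t p))) :=
    measurable_const.mul (hψ.mul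
      (ham.comp (measurable_freeFlow measurable_const measurable_id)).ennreal_ofReal)
  simp_rw [ofReal_duhamel ha hG hG0 hGB, mul_add, mul_left_comm (ψ _)]
  rw [lintegral_add_left hm, lintegral_const_mul' _ _ ENNReal.ofReal_ne_top,
    lintegral_mul_comp_freeFlow t hψ ham.ennreal_ofReal]
  congr 1
  exact lintegral_mul_lintegral_freeFlow (volume.restrict (Set.Ioc 0 t)) t hψ
    (c := fun s => ENNReal.ofReal (Real.exp (s - t))) (by fun_prop)
    (b := fun s p => ENNReal.ofReal (G s p)) hG.ennreal_ofReal

lemma lintegral_fst_mul {n : ℕ} {φ : En n → ENNReal} (hφ : Measurable φ) {h : En n × En n → ℝ}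
    (hh : Measurable h) :
    ∫⁻ p, φ p.1 * ENNReal.ofReal (h p) = ∫⁻ y, φ y * ∫⁻ v, ENNReal.ofReal (h (y, v)) := by
  have h1 : Measurable fun p => ENNReal.ofReal (h p) := hh.ennreal_ofReal
  have h2 : Measurable fun p : En n × En n => φ p.1 * ENNReal.ofReal (h p) :=
    (hφ.comp measurable_fst).mul h1
  rw [Measure.volume_eq_prod, lintegral_prod _ h2.aemeasurable]
  refine lintegral_congr fun y => ?_
  have h3 : Measurable fun v => ENNReal.ofReal (h (y, v)) := h1.comp measurable_prodMk_left
  exact lintegral_const_mul (φ y) h3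

lemma lintegral_fst_mul_gain_le {n : ℕ} {γ ε : ℝ} (hn : 1 ≤ n) (hγ1 : 1 < γ) (hd : 0 < dof n γ)
    (hε : 0 < ε) {F : ℝ → En n × En n → ℝ} (hF : Measurable (Function.uncurry F))
    (hF0 : ∀ t p, 0 ≤ F t p) {φ : En n → ENNReal} (hφ : Measurable φ) (s : ℝ) :
    ∫⁻ p, φ p.1 * ENNReal.ofReal (gain n γ ε F s p) ≤ ∫⁻ p, φ p.1 * ENNReal.ofReal (F s p) := by
  rw [lintegral_fst_mul hφ (measurable_slice (measurable_gain (γ := γ) (ε := ε) hF) s),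
    lintegral_fst_mul hφ (measurable_slice hF s)]
  exact lintegral_mono fun y => mul_le_mul_right
    (lintegral_MaxwEps_le hn hγ1 hd hε (fun w => hF0 s (y, w))) _

/-- `F` is a mild solution of the approximate BGK equation with initial datum `a`. -/
structure IsMildSolution (n : ℕ) (γ ε : ℝ) (a : En n × En n → ℝ) (F : ℝ → En n × En n → ℝ) :
    Prop where
  measurable : Measurable (Function.uncurry F)
  nonneg : ∀ t p, 0 ≤ F t p
  ae_eq : ∀ t, ∀ᵐ p, F t p = duhamel a (gain n γ ε F) t p
  lintegral_ne_top : ∀ T, ∫⁻ s in Set.Ioc 0 T, ∫⁻ p, ENNReal.ofReal (F s p) ≠ ⊤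

lemma IsMildSolution.lintegral_mul {n : ℕ} {γ ε : ℝ} (hγ1 : 1 < γ) (hd : 0 < dof n γ)
    (hε : 0 < ε) {a : En n × En n → ℝ} (ham : Measurable a) (ha : ∀ p, 0 ≤ a p)
    {F : ℝ → En n × En n → ℝ} (hF : IsMildSolution n γ ε a F) {ψ : En n × En n → ENNReal}
    (hψ : Measurable ψ) (t : ℝ) :
    ∫⁻ p, ψ p * ENNReal.ofReal (F t p) =
      ENNReal.ofReal (Real.exp (-t)) * (∫⁻ p, ψ (freeFlow (-t) p) * ENNReal.ofReal (a p)) +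
      ∫⁻ s in Set.Ioc 0 t, ENNReal.ofReal (Real.exp (s - t)) *
        ∫⁻ p, ψ (freeFlow (s - t) p) * ENNReal.ofReal (gain n γ ε F s p) := by
  rw [← lintegral_mul_duhamel ham ha (measurable_gain hF.measurable) (gain_nonneg hγ1 hd F)
    (gain_le hγ1 hd hε hF.nonneg) hψ t]
  exact lintegral_congr_ae ((hF.ae_eq t).mono fun p hp => by simp only [← hp])

lemma IsMildSolution.mass_le {n : ℕ} {γ ε : ℝ} (hn : 1 ≤ n) (hγ1 : 1 < γ) (hd : 0 < dof n γ)
    (hε : 0 < ε) {a : En n × En n → ℝ} (ham : Measurable a) (ha : ∀ p, 0 ≤ a p)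
    (hai : ∫⁻ p, ENNReal.ofReal (a p) ≠ ⊤)
    {F : ℝ → En n × En n → ℝ} (hF : IsMildSolution n γ ε a F) {t : ℝ} (ht : 0 ≤ t) :
    ∫⁻ p, ENNReal.ofReal (F t p) ≤ ∫⁻ p, ENNReal.ofReal (a p) := by
  have h1 : ∀ r, ∫⁻ p, ENNReal.ofReal (F r p) ≤
      ENNReal.ofReal (Real.exp (-r)) * (∫⁻ p, ENNReal.ofReal (a p)) +
      ∫⁻ s in Set.Ioc 0 r, ENNReal.ofReal (Real.exp (s - r)) * ∫⁻ p, ENNReal.ofReal (F s p) := by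
    intro r
    have h2 := hF.lintegral_mul hγ1 hd hε ham ha (ψ := fun _ => 1) measurable_const r
    simp only [one_mul] at h2
    rw [h2]
    refine add_le_add_right (lintegral_mono fun s => mul_le_mul_right ?_ _) _
    have h3 := lintegral_fst_mul_gain_le hn hγ1 hd hε hF.measurable hF.nonneg
      (φ := fun _ => 1) measurable_const s
    simpa only [one_mul] using h3
  have h4 := le_of_le_average (T := t) (a := fun r => ∫⁻ p, ENNReal.ofReal (F r p))
    (a₀ := ∫⁻ p, ENNReal.ofReal (a p)) (D := 0)
    (ENNReal.add_ne_top.2 ⟨hai, hF.lintegral_ne_top t⟩) (fun r hr => ?_)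
    (fun r _ => by simpa only [add_zero] using h1 r) ⟨ht, le_rfl⟩
  · simpa using h4
  · refine (h1 r).trans (add_le_add ?_ ((setLIntegral_mono' measurableSet_Ioc fun s hs => ?_).trans
      (lintegral_mono_set (Set.Ioc_subset_Ioc_right hr.2))))
    · refine mul_le_of_le_one_left' (ENNReal.ofReal_le_one.2 (Real.exp_le_one_iff.2 ?_))
      linarith [hr.1]
    · refine mul_le_of_le_one_left' (ENNReal.ofReal_le_one.2 (Real.exp_le_one_iff.2 ?_))
      linarith [hs.2]

lemma kinEnt_tangent_le {n : ℕ} {γ : ℝ} (hγ1 : 1 < γ) (hd : 0 < dof n γ) (v : En n) {y : ℝ}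
    (hy : 0 ≤ y) : ∃ c : ℝ, ∀ z, 0 ≤ z → kinEnt n γ v y + c * (z - y) ≤ kinEnt n γ v z := by
  refine ⟨‖v‖ ^ 2 / 2 + entCoeff n γ * ((1 + 2 / dof n γ) * y ^ (1 + 2 / dof n γ - 1)),
    fun z hz => ?_⟩
  have h := mul_le_mul_of_nonneg_left (rpow_tangent_le (p := 1 + 2 / dof n γ) (by
    have : 0 < 2 / dof n γ := by positivity
    linarith) hy hz) (entCoeff_pos hγ1 hd).le
  unfold kinEnt
  linarith

lemma kinEnt_mono {n : ℕ} {γ : ℝ} (hγ1 : 1 < γ) (hd : 0 < dof n γ) (v : En n) {y z : ℝ}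
    (hy : 0 ≤ y) (hyz : y ≤ z) : kinEnt n γ v y ≤ kinEnt n γ v z := by
  have := (entCoeff_pos hγ1 hd).le
  unfold kinEnt
  gcongr

lemma measurable_kinEnt_const {n : ℕ} {γ : ℝ} (hd : 0 < dof n γ) (v : En n)
    {G : ℝ → En n × En n → ℝ} (hG : Measurable (Function.uncurry G)) :
    Measurable (Function.uncurry fun s q => kinEnt n γ v (G s q)) :=
  measurable_kinEnt hd (u := fun _ : ℝ × (En n × En n) => v) measurable_const hG

/-- Jensen's inequality along Duhamel's formula. -/
lemma kinEnt_duhamel_le {n : ℕ} {γ : ℝ} (hγ1 : 1 < γ) (hd : 0 < dof n γ) {a : En n × En n → ℝ}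
    {G : ℝ → En n × En n → ℝ} {B : ℝ} (ha : ∀ p, 0 ≤ a p)
    (hG : Measurable (Function.uncurry G)) (hG0 : ∀ s p, 0 ≤ G s p) (hGB : ∀ s p, G s p ≤ B)
    {t : ℝ} (ht : 0 ≤ t) (p : En n × En n) (v : En n) :
    kinEnt n γ v (duhamel a G t p) ≤
      duhamel (fun q => kinEnt n γ v (a q)) (fun s q => kinEnt n γ v (G s q)) t p := by
  obtain ⟨c, hc⟩ := kinEnt_tangent_le hγ1 hd v (duhamel_nonneg ha hG0 t p)
  set y := duhamel a G t p with hy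
  have hi1 := integrableOn_duhamel hG hG0 hGB t p
  have hi2 := integrableOn_duhamel (measurable_kinEnt_const (γ := γ) hd v hG)
    (fun s q => kinEnt_nonneg hγ1 hd v (hG0 s q))
    (fun s q => kinEnt_mono hγ1 hd v (hG0 s q) (hGB s q)) t p
  have hi3 : IntegrableOn (fun s => Real.exp (s - t)) (Set.Ioc 0 t) :=
    (Continuous.integrableOn_Icc (by fun_prop)).mono_set Set.Ioc_subset_Icc_self
  have hle : ∫ s in Set.Ioc 0 t, ((kinEnt n γ v y - c * y) * Real.exp (s - t) +
      c * (Real.exp (s - t) * G s (freeFlow (t - s) p))) ≤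
      ∫ s in Set.Ioc 0 t, Real.exp (s - t) * kinEnt n γ v (G s (freeFlow (t - s) p)) := by
    refine integral_mono ((hi3.const_mul _).add (hi1.const_mul _)) hi2 fun s => ?_
    have := mul_le_mul_of_nonneg_left (hc _ (hG0 s (freeFlow (t - s) p)))
      (Real.exp_nonneg (s - t))
    dsimp only
    linarith
  rw [integral_add (hi3.const_mul _) (hi1.const_mul _), integral_const_mul, integral_const_mul,
    integral_Ioc_exp_sub ht] at hle
  have h0 := mul_le_mul_of_nonneg_left (hc _ (ha (freeFlow t p))) (Real.exp_nonneg (-t))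
  have hy' : y = Real.exp (-t) * a (freeFlow t p) +
    ∫ s in Set.Ioc 0 t, Real.exp (s - t) * G s (freeFlow (t - s) p) := rfl
  have hint : ∫ s in Set.Ioc 0 t, Real.exp (s - t) * G s (freeFlow (t - s) p) =
    y - Real.exp (-t) * a (freeFlow t p) := by linarith
  rw [hint] at hle
  show _ ≤ Real.exp (-t) * kinEnt n γ v (a (freeFlow t p)) +
    ∫ s in Set.Ioc 0 t, Real.exp (s - t) * kinEnt n γ v (G s (freeFlow (t - s) p))
  linarith

lemma IsMildSolution.lintegral_kinEnt_le {n : ℕ} {γ ε : ℝ} (hγ1 : 1 < γ) (hd : 0 < dof n γ)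
    (hε : 0 < ε) {a : En n × En n → ℝ} (ham : Measurable a) (ha : ∀ p, 0 ≤ a p)
    {F : ℝ → En n × En n → ℝ} (hF : IsMildSolution n γ ε a F) {t : ℝ} (ht : 0 ≤ t) :
    ∫⁻ p, ENNReal.ofReal (kinEnt n γ p.2 (F t p)) ≤
      ENNReal.ofReal (Real.exp (-t)) * (∫⁻ p, ENNReal.ofReal (kinEnt n γ p.2 (a p))) +
      ∫⁻ s in Set.Ioc 0 t, ENNReal.ofReal (Real.exp (s - t)) *
        ∫⁻ p, ENNReal.ofReal (kinEnt n γ p.2 (gain n γ ε F s p)) := by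
  have hG := measurable_gain (γ := γ) (ε := ε) hF.measurable
  have hG0 := gain_nonneg (ε := ε) hγ1 hd F
  have hGB := gain_le hγ1 hd hε hF.nonneg
  have hka : Measurable fun p : En n × En n => ENNReal.ofReal (kinEnt n γ p.2 (a p)) :=
    (measurable_kinEnt hd measurable_snd ham).ennreal_ofReal
  have hkG : Measurable (Function.uncurry fun (s : ℝ) (p : En n × En n) =>
      ENNReal.ofReal (kinEnt n γ p.2 (gain n γ ε F s p))) :=
    (measurable_kinEnt hd (u := fun q : ℝ × (En n × En n) => q.2.2) (by fun_prop)
      hG).ennreal_ofReal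
  have hpt : ∀ᵐ p, ENNReal.ofReal (kinEnt n γ p.2 (F t p)) ≤
      ENNReal.ofReal (Real.exp (-t)) *
        ENNReal.ofReal (kinEnt n γ (freeFlow t p).2 (a (freeFlow t p))) +
      ∫⁻ s in Set.Ioc 0 t, ENNReal.ofReal (Real.exp (s - t)) * ENNReal.ofReal
        (kinEnt n γ (freeFlow (t - s) p).2 (gain n γ ε F s (freeFlow (t - s) p))) := by
    filter_upwards [hF.ae_eq t] with p hp
    rw [hp]
    refine (ENNReal.ofReal_le_ofReal (kinEnt_duhamel_le hγ1 hd ha hG hG0 hGB ht p p.2)).trans ?_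
    rw [ofReal_duhamel (fun q => kinEnt_nonneg hγ1 hd p.2 (ha q))
      (measurable_kinEnt_const (γ := γ) hd p.2 hG)
      (fun s q => kinEnt_nonneg hγ1 hd p.2 (hG0 s q))
      (fun s q => kinEnt_mono hγ1 hd p.2 (hG0 s q) (hGB s q))]
    rfl
  refine (lintegral_mono_ae hpt).trans (le_of_eq ?_)
  have hm : Measurable fun p : En n × En n => ENNReal.ofReal (Real.exp (-t)) *
      ENNReal.ofReal (kinEnt n γ (freeFlow t p).2 (a (freeFlow t p))) :=
    measurable_const.mul (hka.comp (measurable_freeFlow measurable_const measurable_id))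
  rw [lintegral_add_left hm, lintegral_const_mul' _ _ ENNReal.ofReal_ne_top,
    lintegral_comp_freeFlow t hka]
  congr 1
  have h := lintegral_mul_lintegral_freeFlow (volume.restrict (Set.Ioc 0 t)) t (ψ := fun _ => 1)
    measurable_const (c := fun s => ENNReal.ofReal (Real.exp (s - t))) (by fun_prop) hkG
  simpa only [one_mul] using h

lemma lintegral_kinEnt_eq {n : ℕ} {γ : ℝ} (hd : 0 < dof n γ) {h : En n × En n → ℝ}
    (hh : Measurable h) :
    ∫⁻ p, ENNReal.ofReal (kinEnt n γ p.2 (h p)) =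
      ∫⁻ y, ∫⁻ v, ENNReal.ofReal (kinEnt n γ v (h (y, v))) := by
  have h1 : Measurable fun p : En n × En n => ENNReal.ofReal (kinEnt n γ p.2 (h p)) :=
    (measurable_kinEnt hd measurable_snd hh).ennreal_ofReal
  rw [Measure.volume_eq_prod, lintegral_prod _ h1.aemeasurable]

lemma lintegral_kinEnt_gain_le {n : ℕ} {γ ε : ℝ} (hn : 1 ≤ n) (hγ1 : 1 < γ) (hd : 0 < dof n γ)
    (hε : 0 < ε) {F : ℝ → En n × En n → ℝ} (hF : Measurable (Function.uncurry F))
    (hF0 : ∀ t p, 0 ≤ F t p) (s : ℝ) :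
    ∫⁻ p, ENNReal.ofReal (kinEnt n γ p.2 (gain n γ ε F s p)) ≤
      ∫⁻ p, ENNReal.ofReal (kinEnt n γ p.2 (F s p)) := by
  have hFs := measurable_slice hF s
  have hGs : Measurable (gain n γ ε F s) :=
    measurable_slice (measurable_gain (γ := γ) (ε := ε) hF) s
  have key : ∀ y, ∫⁻ v, ENNReal.ofReal (kinEnt n γ v (gain n γ ε F s (y, v))) ≤
      ∫⁻ v, ENNReal.ofReal (kinEnt n γ v (F s (y, v))) := fun y => by
    have h3 : Measurable fun v => F s (y, v) := hFs.comp measurable_prodMk_left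
    have h4 := lintegral_kinEnt_MaxwEps_le hn hγ1 hd hε h3 (fun w => hF0 s (y, w))
    simpa only [gain] using h4
  calc _ = _ := lintegral_kinEnt_eq hd hGs
    _ ≤ _ := lintegral_mono key
    _ = _ := (lintegral_kinEnt_eq hd hFs).symm

lemma IsMildSolution.entropy_le {n : ℕ} {γ ε : ℝ} (hn : 1 ≤ n) (hγ1 : 1 < γ) (hd : 0 < dof n γ)
    (hε : 0 < ε) {a : En n × En n → ℝ} (ham : Measurable a) (ha : ∀ p, 0 ≤ a p)
    (hai : ∫⁻ p, ENNReal.ofReal (a p) ≠ ⊤)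
    (hak : ∫⁻ p, ENNReal.ofReal (kinEnt n γ p.2 (a p)) ≠ ⊤)
    {F : ℝ → En n × En n → ℝ} (hF : IsMildSolution n γ ε a F) {t : ℝ} (ht : 0 ≤ t) :
    ∫⁻ p, ENNReal.ofReal (kinEnt n γ p.2 (F t p)) ≤
      ∫⁻ p, ENNReal.ofReal (kinEnt n γ p.2 (a p)) := by
  obtain ⟨K, hK0, hK⟩ := exists_kinEnt_MaxwEps_le hγ1 hd hε
  set H₀ := ∫⁻ p, ENNReal.ofReal (kinEnt n γ p.2 (a p)) with hH₀
  set m₀ := ∫⁻ p, ENNReal.ofReal (a p) with hm₀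
  have hgain : ∀ s, 0 ≤ s → ∫⁻ p, ENNReal.ofReal (kinEnt n γ p.2 (gain n γ ε F s p)) ≤
      ENNReal.ofReal K * m₀ := by
    intro s hs
    calc ∫⁻ p, ENNReal.ofReal (kinEnt n γ p.2 (gain n γ ε F s p))
        ≤ ∫⁻ p, ENNReal.ofReal K * ENNReal.ofReal (gain n γ ε F s p) := by
          refine lintegral_mono fun p => ?_
          rw [← ENNReal.ofReal_mul hK0]
          exact ENNReal.ofReal_le_ofReal (hK _ (fun w => hF.nonneg s (p.1, w)) p.2)
      _ ≤ ∫⁻ p, ENNReal.ofReal K * ENNReal.ofReal (F s p) :=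
          lintegral_fst_mul_gain_le hn hγ1 hd hε hF.measurable hF.nonneg
            (φ := fun _ => ENNReal.ofReal K) measurable_const s
      _ ≤ ENNReal.ofReal K * m₀ := by
          rw [lintegral_const_mul' _ _ ENNReal.ofReal_ne_top]
          exact mul_le_mul_right (hF.mass_le hn hγ1 hd hε ham ha hai hs) _
  have h4 := le_of_le_average (T := t)
    (a := fun r => ∫⁻ p, ENNReal.ofReal (kinEnt n γ p.2 (F r p)))
    (a₀ := H₀) (D := 0) (B := H₀ + ENNReal.ofReal K * m₀)
    (ENNReal.add_ne_top.2 ⟨hak, ENNReal.mul_ne_top ENNReal.ofReal_ne_top hai⟩) (fun r hr => ?_)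
    (fun r hr => ?_) ⟨ht, le_rfl⟩
  · simpa using h4
  · refine (hF.lintegral_kinEnt_le hγ1 hd hε ham ha hr.1).trans (add_le_add ?_ ?_)
    · refine mul_le_of_le_one_left' (ENNReal.ofReal_le_one.2 (Real.exp_le_one_iff.2 ?_))
      linarith [hr.1]
    · refine (setLIntegral_mono' measurableSet_Ioc fun s hs =>
        mul_le_mul_right (hgain s hs.1.le) _).trans ?_
      rw [lintegral_mul_const _ (by fun_prop), lintegral_Ioc_exp_sub hr.1]
      refine mul_le_of_le_one_left' (ENNReal.ofReal_le_one.2 ?_)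
      linarith [Real.exp_pos (-r)]
  · simp only [add_zero]
    exact (hF.lintegral_kinEnt_le hγ1 hd hε ham ha hr.1).trans (add_le_add_right
      (lintegral_mono fun s => mul_le_mul_right
        (lintegral_kinEnt_gain_le hn hγ1 hd hε hF.measurable hF.nonneg s) _) _)

/-- A Lipschitz weight vanishing at the origin and equal to `1` outside the ball of radius `R`. -/
def tailWeight {n : ℕ} (R : ℝ) (x : En n) : ENNReal := ENNReal.ofReal (min 1 (‖x‖ / R))

lemma measurable_tailWeight {n : ℕ} (R : ℝ) : Measurable (tailWeight R : En n → ENNReal) := by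
  have : Continuous fun x : En n => min 1 (‖x‖ / R) := by fun_prop
  exact this.measurable.ennreal_ofReal

lemma tailWeight_le_one {n : ℕ} (R : ℝ) (x : En n) : tailWeight R x ≤ 1 :=
  ENNReal.ofReal_le_one.2 (min_le_left _ _)

lemma tailWeight_eq_one {n : ℕ} {R : ℝ} (hR : 0 < R) {x : En n} (hx : R ≤ ‖x‖) :
    tailWeight R x = 1 := by
  rw [tailWeight, min_eq_left ((one_le_div hR).2 hx), ENNReal.ofReal_one]

lemma tailWeight_freeFlow_le {n : ℕ} {R T τ : ℝ} (hR : 0 < R) (hτ : |τ| ≤ T)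
    (p : En n × En n) :
    tailWeight R (freeFlow τ p).1 ≤
      tailWeight R p.1 + ENNReal.ofReal (T / R) * ENNReal.ofReal ‖p.2‖ := by
  have hT : 0 ≤ T := (abs_nonneg τ).trans hτ
  rw [tailWeight, tailWeight, ← ENNReal.ofReal_mul (by positivity),
    ← ENNReal.ofReal_add (by positivity) (by positivity)]
  refine ENNReal.ofReal_le_ofReal ?_
  have h1 : ‖(freeFlow τ p).1‖ ≤ ‖p.1‖ + T * ‖p.2‖ := by
    refine (norm_sub_le _ _).trans (add_le_add_right ?_ _)
    rw [norm_smul, Real.norm_eq_abs]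
    gcongr
  have h2 : ‖(freeFlow τ p).1‖ / R ≤ ‖p.1‖ / R + T / R * ‖p.2‖ := by
    rw [div_mul_eq_mul_div, ← add_div]
    gcongr
  have h3 : 0 ≤ T / R * ‖p.2‖ := by positivity
  rcases le_total 1 (‖p.1‖ / R) with h | h
  · rw [min_eq_left h]
    exact (min_le_left _ _).trans (by linarith)
  · rw [min_eq_right h]
    exact (min_le_right _ _).trans h2

lemma norm_mul_le_add_kinEnt {n : ℕ} {γ : ℝ} (hγ1 : 1 < γ) (hd : 0 < dof n γ) (v : En n) {z : ℝ}
    (hz : 0 ≤ z) : ‖v‖ * z ≤ z + kinEnt n γ v z := by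
  have hc := entCoeff_pos hγ1 hd
  have h1 : ‖v‖ ≤ 1 + ‖v‖ ^ 2 / 2 := by nlinarith [sq_nonneg (‖v‖ - 1)]
  have h2 : 0 ≤ entCoeff n γ * z ^ (1 + 2 / dof n γ) := by positivity
  unfold kinEnt
  nlinarith [mul_le_mul_of_nonneg_right h1 hz]

lemma lintegral_tailWeight_freeFlow_le {n : ℕ} {γ R T τ : ℝ} (hγ1 : 1 < γ) (hd : 0 < dof n γ)
    (hR : 0 < R) (hτ : |τ| ≤ T) {h : En n × En n → ℝ} (hm : Measurable h) (h0 : ∀ p, 0 ≤ h p) :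
    ∫⁻ p, tailWeight R (freeFlow τ p).1 * ENNReal.ofReal (h p) ≤
      (∫⁻ p, tailWeight R p.1 * ENNReal.ofReal (h p)) + ENNReal.ofReal (T / R) *
        ((∫⁻ p, ENNReal.ofReal (h p)) + ∫⁻ p, ENNReal.ofReal (kinEnt n γ p.2 (h p))) := by
  have hho : Measurable fun p => ENNReal.ofReal (h p) := hm.ennreal_ofReal
  have hw : Measurable fun p : En n × En n => tailWeight R p.1 :=
    (measurable_tailWeight R).comp measurable_fst
  rw [← lintegral_add_left hho, ← lintegral_const_mul' _ _ ENNReal.ofReal_ne_top,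
    ← lintegral_add_left (f := fun p => tailWeight R p.1 * ENNReal.ofReal (h p)) (hw.mul hho)]
  refine lintegral_mono fun p => (mul_le_mul_left (tailWeight_freeFlow_le hR hτ p) _).trans ?_
  rw [add_mul, mul_assoc, ← ENNReal.ofReal_mul (norm_nonneg _),
    ← ENNReal.ofReal_add (h0 p) (kinEnt_nonneg hγ1 hd p.2 (h0 p))]
  exact add_le_add_right (mul_le_mul_right
    (ENNReal.ofReal_le_ofReal (norm_mul_le_add_kinEnt hγ1 hd p.2 (h0 p))) _) _

/-- Propagation of tightness in the space variable. -/
lemma IsMildSolution.tailWeight_le {n : ℕ} {γ ε : ℝ} (hn : 1 ≤ n) (hγ1 : 1 < γ)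
    (hd : 0 < dof n γ) (hε : 0 < ε) {a : En n × En n → ℝ} (ham : Measurable a)
    (ha : ∀ p, 0 ≤ a p) (hai : ∫⁻ p, ENNReal.ofReal (a p) ≠ ⊤)
    (hak : ∫⁻ p, ENNReal.ofReal (kinEnt n γ p.2 (a p)) ≠ ⊤)
    {F : ℝ → En n × En n → ℝ} (hF : IsMildSolution n γ ε a F) {R T t : ℝ} (hR : 0 < R)
    (ht : t ∈ Set.Icc 0 T) :
    ∫⁻ p, tailWeight R p.1 * ENNReal.ofReal (F t p) ≤
      (∫⁻ p, tailWeight R p.1 * ENNReal.ofReal (a p)) + (1 + ENNReal.ofReal (Real.exp T)) *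
        (ENNReal.ofReal (T / R) * ((∫⁻ p, ENNReal.ofReal (a p)) +
          ∫⁻ p, ENNReal.ofReal (kinEnt n γ p.2 (a p)))) := by
  set D := ENNReal.ofReal (T / R) * ((∫⁻ p, ENNReal.ofReal (a p)) +
          ∫⁻ p, ENNReal.ofReal (kinEnt n γ p.2 (a p))) with hD
  have hw := measurable_tailWeight (n := n) R
  rw [add_mul, one_mul, ← add_assoc]
  refine le_of_le_average (a := fun r => ∫⁻ p, tailWeight R p.1 * ENNReal.ofReal (F r p)) hai
    (fun r hr => ?_) (fun r hr => ?_) ht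
  · refine (lintegral_mono fun p => ?_).trans (hF.mass_le hn hγ1 hd hε ham ha hai hr.1)
    exact mul_le_of_le_one_left' (tailWeight_le_one _ _)
  have hψ : Measurable fun p : En n × En n => tailWeight R p.1 := hw.comp measurable_fst
  rw [hF.lintegral_mul hγ1 hd hε ham ha (ψ := fun p => tailWeight R p.1) hψ r]
  refine add_le_add (mul_le_mul_right ?_ _)
    (setLIntegral_mono' measurableSet_Ioc fun s hs => mul_le_mul_right ?_ _)
  · refine lintegral_tailWeight_freeFlow_le hγ1 hd hR ?_ ham ha
    rw [abs_neg, abs_of_nonneg hr.1]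
    exact hr.2
  · have hG := measurable_slice (measurable_gain (γ := γ) (ε := ε) hF.measurable) s
    have hsr : |s - r| ≤ T := by
      rw [abs_le]; constructor <;> linarith [hs.1, hs.2, hr.1, hr.2]
    refine (lintegral_tailWeight_freeFlow_le hγ1 hd hR hsr hG
      (gain_nonneg hγ1 hd F s)).trans (add_le_add ?_ (mul_le_mul_right (add_le_add ?_ ?_) _))
    · exact lintegral_fst_mul_gain_le hn hγ1 hd hε hF.measurable hF.nonneg hw s
    · have h := lintegral_fst_mul_gain_le hn hγ1 hd hε hF.measurable hF.nonneg
        (φ := fun _ => 1) measurable_const s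
      simp only [one_mul] at h
      exact h.trans (hF.mass_le hn hγ1 hd hε ham ha hai hs.1.le)
    · exact (lintegral_kinEnt_gain_le hn hγ1 hd hε hF.measurable hF.nonneg s).trans
        (hF.entropy_le hn hγ1 hd hε ham ha hai hak hs.1.le)

lemma tendsto_lintegral_tailWeight {n : ℕ} {h : En n × En n → ℝ} (hm : Measurable h)
    (hi : ∫⁻ p, ENNReal.ofReal (h p) ≠ ⊤) :
    Filter.Tendsto (fun R => ∫⁻ p, tailWeight R p.1 * ENNReal.ofReal (h p)) Filter.atTop
      (nhds 0) := by
  have h0 : ∫⁻ _ : En n × En n, (0 : ENNReal) = 0 := lintegral_zero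
  rw [← h0]
  refine tendsto_lintegral_filter_of_dominated_convergence (fun p => ENNReal.ofReal (h p))
    (Filter.Eventually.of_forall fun R => ?_)
    (Filter.Eventually.of_forall fun R => ae_of_all _ fun p => ?_) hi
    (ae_of_all _ fun p => ?_)
  · exact ((measurable_tailWeight R).comp measurable_fst).mul hm.ennreal_ofReal
  · exact mul_le_of_le_one_left' (tailWeight_le_one _ _)
  · have h1 : Filter.Tendsto (fun R : ℝ => min 1 (‖p.1‖ / R)) Filter.atTop (nhds (min 1 0)) :=
      tendsto_const_nhds.min (tendsto_const_nhds.div_atTop Filter.tendsto_id)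
    have h2 := ENNReal.Tendsto.mul_const (b := ENNReal.ofReal (h p)) (ENNReal.tendsto_ofReal h1)
      (Or.inr ENNReal.ofReal_ne_top)
    simpa [tailWeight] using h2

lemma integrable_of_lintegral_ofReal_le {α : Type*} [MeasurableSpace α] {μ : Measure α} {f : α → ℝ}
    (hm : Measurable f) (h0 : ∀ x, 0 ≤ f x) {B : ENNReal} (hB : B ≠ ⊤)
    (h : ∫⁻ x, ENNReal.ofReal (f x) ∂μ ≤ B) : Integrable f μ ∧ ∫ x, f x ∂μ ≤ B.toReal := by
  refine ⟨⟨hm.aestronglyMeasurable, ?_⟩, ?_⟩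
  · rw [hasFiniteIntegral_iff_ofReal (ae_of_all _ h0)]
    exact h.trans_lt hB.lt_top
  · rw [integral_eq_lintegral_of_nonneg_ae (ae_of_all _ h0) hm.aestronglyMeasurable]
    exact ENNReal.toReal_mono hB h

lemma integrable_kinEnt {n : ℕ} {γ : ℝ} (hγ1 : 1 < γ) (hd : 0 < dof n γ) {f : En n × En n → ℝ}
    (hm : Measurable f) (h0 : ∀ p, 0 ≤ f p)
    (hint : Integrable (fun p : En n × En n => (1 + ‖p.2‖ ^ 2) * f p))
    (hent : Integrable (fun p : En n × En n => f p ^ (1 + 2 / dof n γ))) :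
    Integrable fun p : En n × En n => kinEnt n γ p.2 (f p) := by
  refine (hint.add (hent.const_mul (entCoeff n γ))).mono'
    (measurable_kinEnt hd measurable_snd hm).aestronglyMeasurable (ae_of_all _ fun p => ?_)
  rw [Real.norm_of_nonneg (kinEnt_nonneg hγ1 hd _ (h0 p))]
  have := h0 p
  have : 0 ≤ ‖p.2‖ ^ 2 * f p := by positivity
  simp only [kinEnt, Pi.add_apply]
  linarith

lemma integrable_moments_of_kinEnt {n : ℕ} {γ : ℝ} (hγ1 : 1 < γ) (hd : 0 < dof n γ)
    {f : En n × En n → ℝ} (hm : Measurable f) (h0 : ∀ p, 0 ≤ f p) (hi : Integrable f)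
    (hk : Integrable fun p : En n × En n => kinEnt n γ p.2 (f p)) :
    (Integrable (fun p : En n × En n => (1 + ‖p.2‖ ^ 2) * f p) ∧
      ∫ p : En n × En n, (1 + ‖p.2‖ ^ 2) * f p ≤
        (∫ p, f p) + 2 * ∫ p : En n × En n, kinEnt n γ p.2 (f p)) ∧
    (Integrable (fun p : En n × En n => f p ^ (1 + 2 / dof n γ)) ∧
      ∫ p : En n × En n, f p ^ (1 + 2 / dof n γ) ≤
        (entCoeff n γ)⁻¹ * ∫ p : En n × En n, kinEnt n γ p.2 (f p)) := by
  have hc := entCoeff_pos hγ1 hd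
  have h1 : ∀ p : En n × En n, (1 + ‖p.2‖ ^ 2) * f p ≤ f p + 2 * kinEnt n γ p.2 (f p) := by
    intro p
    have : 0 ≤ entCoeff n γ * f p ^ (1 + 2 / dof n γ) := by have := h0 p; positivity
    unfold kinEnt
    linarith
  have h2 : ∀ p : En n × En n,
      f p ^ (1 + 2 / dof n γ) ≤ (entCoeff n γ)⁻¹ * kinEnt n γ p.2 (f p) := by
    intro p
    have : 0 ≤ ‖p.2‖ ^ 2 / 2 * f p := by have := h0 p; positivity
    rw [← div_eq_inv_mul, le_div_iff₀ hc]
    unfold kinEnt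
    linarith
  have hd1 := hi.add (hk.const_mul 2)
  have hd2 := hk.const_mul (entCoeff n γ)⁻¹
  have hi1 : Integrable (fun p : En n × En n => (1 + ‖p.2‖ ^ 2) * f p) := by
    refine hd1.mono' (Measurable.aestronglyMeasurable (by fun_prop)) (ae_of_all _ fun p => ?_)
    have := h0 p
    rw [Real.norm_of_nonneg (by positivity)]
    exact h1 p
  have hi2 : Integrable (fun p : En n × En n => f p ^ (1 + 2 / dof n γ)) := by
    refine hd2.mono' (hm.pow_const _).aestronglyMeasurable (ae_of_all _ fun p => ?_)
    have := h0 p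
    rw [Real.norm_of_nonneg (by positivity)]
    exact h2 p
  refine ⟨⟨hi1, ?_⟩, hi2, ?_⟩
  · rw [← integral_const_mul, ← integral_add hi (hk.const_mul 2)]
    exact integral_mono hi1 hd1 h1
  · rw [← integral_const_mul]
    exact integral_mono hi2 hd2 h2

lemma setIntegral_norm_gt_le {n : ℕ} {R : ℝ} (hR : 0 < R) {h : En n × En n → ℝ}
    (hm : Measurable h) (h0 : ∀ p, 0 ≤ h p) {δ : ℝ} (hδ : 0 ≤ δ)
    (hle : ∫⁻ p, tailWeight R p.1 * ENNReal.ofReal (h p) ≤ ENNReal.ofReal δ) :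
    ∫ x in {x : En n | R < ‖x‖}, ∫ v : En n, h (x, v) ≤ δ := by
  have hS : MeasurableSet {x : En n | R < ‖x‖} :=
    measurableSet_lt measurable_const measurable_norm
  have h1 : ‖∫ x in {x : En n | R < ‖x‖}, ∫ v : En n, h (x, v)‖ₑ ≤ ENNReal.ofReal δ := by
    refine (enorm_integral_le_lintegral_enorm _).trans (le_trans ?_ hle)
    rw [lintegral_fst_mul (measurable_tailWeight R) hm]
    refine le_trans ?_ (setLIntegral_le_lintegral {x : En n | R < ‖x‖} _)
    refine setLIntegral_mono' hS fun x hx => ?_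
    rw [tailWeight_eq_one hR (le_of_lt hx), one_mul]
    refine (enorm_integral_le_lintegral_enorm _).trans (le_of_eq ?_)
    exact lintegral_congr fun v => Real.enorm_of_nonneg (h0 (x, v))
  rw [← ofReal_norm, ENNReal.ofReal_le_ofReal_iff hδ] at h1
  exact (Real.le_norm_self _).trans h1

/-- Proposition 3.1: for each `ε ∈ (0,1)` there is a mild solution `f^ε` of the
approximate BGK system, with `ε`-uniform bounds and `ε`-uniform tightness of the
macroscopic densities. -/
theorem stmt9 (n : ℕ) (hn : 1 ≤ n) (γ : ℝ)
    (hγ1 : 1 < γ) (hγ2 : γ < ((n : ℝ) + 2) / n)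
    (f₀ : En n × En n → ℝ) (hf₀meas : Measurable f₀) (hf₀nonneg : ∀ p, 0 ≤ f₀ p)
    (hf₀int : Integrable (fun p : En n × En n => (1 + ‖p.2‖ ^ 2) * f₀ p))
    (hf₀ent : Integrable (fun p : En n × En n => f₀ p ^ (1 + 2 / dof n γ))) :
    ∃ F : ℝ → ℝ → En n × En n → ℝ, ∃ C : ℝ,
      (∀ ε ∈ Set.Ioo (0:ℝ) 1,
        Measurable (Function.uncurry (F ε)) ∧
        (∀ t p, 0 ≤ F ε t p) ∧
        -- (i) mild form
        (∀ t : ℝ, 0 ≤ t → ∀ᵐ p : En n × En n,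
          F ε t p = Real.exp (-t) * f₀ (p.1 - t • p.2, p.2) +
            ∫ s in (0:ℝ)..t, Real.exp (s - t) *
              MaxwEps n γ ε (fun w => F ε s (p.1 - (t - s) • p.2, w)) p.2) ∧
        -- (ii) uniform bounds, with C independent of ε
        (∀ t : ℝ, 0 ≤ t →
          Integrable (fun p : En n × En n => (1 + ‖p.2‖ ^ 2) * F ε t p) ∧
          (∫ p : En n × En n, (1 + ‖p.2‖ ^ 2) * F ε t p) ≤ C ∧
          Integrable (fun p : En n × En n => F ε t p ^ (1 + 2 / dof n γ)) ∧
          (∫ p : En n × En n, F ε t p ^ (1 + 2 / dof n γ)) ≤ C)) ∧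
      -- (iii) uniform tightness of the macroscopic densities
      (∀ T : ℝ, 0 < T → ∀ δ : ℝ, 0 < δ → ∃ R₀ : ℝ, ∀ R : ℝ, R₀ ≤ R →
        ∀ ε ∈ Set.Ioo (0:ℝ) 1, ∀ t ∈ Set.Icc (0:ℝ) T,
          (∫ x in {x : En n | R < ‖x‖}, ∫ v : En n, F ε t (x, v)) ≤ δ) := by
  have hd := dof_pos hn hγ1 hγ2
  have hkint := integrable_kinEnt hγ1 hd hf₀meas hf₀nonneg hf₀int hf₀ent
  have hle (p : En n × En n) : f₀ p ≤ (1 + ‖p.2‖ ^ 2) * f₀ p := by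
    have := hf₀nonneg p
    have : 0 ≤ ‖p.2‖ ^ 2 * f₀ p := by positivity
    linarith
  have hfint : Integrable f₀ := hf₀int.mono' hf₀meas.aestronglyMeasurable
    (ae_of_all _ fun p => by rw [Real.norm_of_nonneg (hf₀nonneg p)]; exact hle p)
  have hmass : ∫⁻ p, ENNReal.ofReal (f₀ p) ≠ ⊤ := hfint.lintegral_lt_top.ne
  have hent : ∫⁻ p, ENNReal.ofReal (kinEnt n γ p.2 (f₀ p)) ≠ ⊤ := hkint.lintegral_lt_top.ne
  have hmom : ∫⁻ p : En n × En n, ENNReal.ofReal (1 + ‖p.2‖) * ‖f₀ p‖ₑ ≠ ⊤ := by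
    refine ne_top_of_le_ne_top (hf₀int.const_mul 2).lintegral_lt_top.ne
      (lintegral_mono fun p => ?_)
    rw [Real.enorm_of_nonneg (hf₀nonneg p), ← ENNReal.ofReal_mul (by positivity)]
    refine ENNReal.ofReal_le_ofReal ?_
    rw [← mul_assoc]
    refine mul_le_mul_of_nonneg_right ?_ (hf₀nonneg p)
    nlinarith [sq_nonneg (‖p.2‖ - 1)]
  have hex : ∀ ε : ℝ, ∃ F, ε ∈ Set.Ioo (0:ℝ) 1 → IsMildSolution n γ ε f₀ F := by
    intro ε
    by_cases hε : ε ∈ Set.Ioo (0:ℝ) 1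
    · obtain ⟨F, h1, h2, h3, h4⟩ :=
        exists_mildSolution hn hγ1 hd hε.1 hf₀meas hf₀nonneg hmom
      exact ⟨F, fun _ => ⟨h1, h2, h3, h4⟩⟩
    · exact ⟨0, fun h => absurd h hε⟩
  choose F hF using hex
  set m₀ := ∫⁻ p, ENNReal.ofReal (f₀ p) with hm₀
  set H₀ := ∫⁻ p, ENNReal.ofReal (kinEnt n γ p.2 (f₀ p)) with hH₀
  have hc := entCoeff_pos hγ1 hd
  refine ⟨F, m₀.toReal + 2 * H₀.toReal + (entCoeff n γ)⁻¹ * H₀.toReal, fun ε hε =>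
    ⟨(hF ε hε).measurable, (hF ε hε).nonneg, fun t ht => ?_, fun t ht => ?_⟩,
    fun T hT δ hδ => ?_⟩
  · filter_upwards [(hF ε hε).ae_eq t] with p hp
    rw [intervalIntegral.integral_of_le ht]
    exact hp
  · have hFt := measurable_slice (hF ε hε).measurable t
    have hF0 := (hF ε hε).nonneg t
    obtain ⟨hi, him⟩ := integrable_of_lintegral_ofReal_le hFt hF0 hmass
      ((hF ε hε).mass_le hn hγ1 hd hε.1 hf₀meas hf₀nonneg hmass ht)
    obtain ⟨hk, hkm⟩ := integrable_of_lintegral_ofReal_le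
      (measurable_kinEnt hd measurable_snd hFt)
      (fun p => kinEnt_nonneg hγ1 hd p.2 (hF0 p)) hent
      ((hF ε hε).entropy_le hn hγ1 hd hε.1 hf₀meas hf₀nonneg hmass hent ht)
    obtain ⟨⟨h1, h2⟩, h3, h4⟩ := integrable_moments_of_kinEnt hγ1 hd hFt hF0 hi hk
    have hm0 : 0 ≤ m₀.toReal := ENNReal.toReal_nonneg
    have hH0 : 0 ≤ H₀.toReal := ENNReal.toReal_nonneg
    have hcH : 0 ≤ (entCoeff n γ)⁻¹ * H₀.toReal := by positivity
    have := mul_le_mul_of_nonneg_left hkm (inv_nonneg.2 hc.le)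
    exact ⟨h1, by linarith, h3, by linarith⟩
  · have hE : m₀ + H₀ ≠ ⊤ := ENNReal.add_ne_top.2 ⟨hmass, hent⟩
    have hlim : Filter.Tendsto (fun R : ℝ => (∫⁻ p, tailWeight R p.1 * ENNReal.ofReal (f₀ p)) +
        (1 + ENNReal.ofReal (Real.exp T)) * (ENNReal.ofReal (T / R) * (m₀ + H₀)))
        Filter.atTop (nhds 0) := by
      have h1 : Filter.Tendsto (fun R : ℝ => ENNReal.ofReal (T / R)) Filter.atTop (nhds 0) := by
        simpa using ENNReal.tendsto_ofReal
          ((tendsto_const_nhds (x := T)).div_atTop Filter.tendsto_id)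
      have h2 := ENNReal.Tendsto.const_mul (a := 1 + ENNReal.ofReal (Real.exp T))
        (ENNReal.Tendsto.mul_const h1 (Or.inr hE))
        (Or.inr (ENNReal.add_ne_top.2 ⟨ENNReal.one_ne_top, ENNReal.ofReal_ne_top⟩))
      simpa using (tendsto_lintegral_tailWeight hf₀meas hmass).add h2
    obtain ⟨R₀, hR₀⟩ := Filter.eventually_atTop.1
      ((hlim.eventually (gt_mem_nhds (ENNReal.ofReal_pos.2 hδ))).and
        (Filter.eventually_gt_atTop 0))
    refine ⟨R₀, fun R hR ε hε t ht => ?_⟩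
    obtain ⟨hlt, hRpos⟩ := hR₀ R hR
    exact setIntegral_norm_gt_le hRpos (measurable_slice (hF ε hε).measurable t)
      ((hF ε hε).nonneg t) hδ.le
      (((hF ε hε).tailWeight_le hn hγ1 hd hε.1 hf₀meas hf₀nonneg hmass hent hRpos ht).trans
        hlt.le)
end
end
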